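/- For every integer ℓ ≥ 2 there exists d_ℓ such that every 24-edge-connected graph G with minimum degree at least d_ℓ admits a decomposition of its edge set into paths of length exactly ℓ together with at most one additional path of length at most ℓ. -/

import Mathlib

open Relation
open scoped Classical

/-- A path of a graph `G`, recorded with its two endpoints. -/
abbrev PathOn {V : Type} (G : SimpleGraph V) : Type := Σ u : V, Σ v : V, G.Walk u v

/-- `G` is `k`-edge-connected: removing any fewer than `k` edges leaves it
connected. -/
def EdgeConn {V : Type} (G : SimpleGraph V) (k : ℕ) : Prop :=
  ∀ F : Finset (Sym2 V), F.card < k →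
    ∀ u v : V, ReflTransGen (fun a b => G.Adj a b ∧ s(a, b) ∉ F) u v

namespace PD

lemma round_aux {I O C : Type*} [Fintype I] [Fintype O] [Fintype C]
    (inc : C → I × O → Prop) (τ : C → ℝ) (hτ : ∀ c, 0 < τ c) :
    ∀ (n : ℕ) (x : I × O → ℝ), (Finset.univ.filter (fun j => x j ≠ 0)).card = n →
      (∀ j, 0 ≤ x j) → (∀ i, ∑ o, x (i, o) = 1) →
      (∀ j, x j ≠ 0 → ∑ c, (if inc c j then 1 / τ c else 0) ≤ 1 / 2) →
      ∃ f : I → O, (∀ i, x (i, f i) ≠ 0) ∧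
        ∀ c, ((Finset.univ.filter (fun i => inc c (i, f i))).card : ℝ) ≤
          (∑ j, if inc c j then x j else 0) + τ c := by
  intro n
  induction n using Nat.strong_induction_on with
  | _ n ih =>
  intro x hn hx0 hx1 hinc
  have hle1 : ∀ j, x j ≤ 1 := by
    rintro ⟨i, o⟩
    rw [← hx1 i]
    exact Finset.single_le_sum (f := fun o => x (i, o)) (fun o _ => hx0 _) (Finset.mem_univ o)
  have hex : ∀ i, ∃ o, x (i, o) ≠ 0 := by
    intro i
    by_contra h
    push Not at h
    have := hx1 i
    simp [h] at this
  -- dead constraint bound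
  have hdead : ∀ (f : I → O), (∀ i, x (i, f i) ≠ 0) → ∀ c,
      ((Finset.univ.filter (fun j => x j ≠ 0 ∧ x j ≠ 1 ∧ inc c j)).card : ℝ) ≤ τ c →
      ((Finset.univ.filter (fun i => inc c (i, f i))).card : ℝ) ≤
          (∑ j, if inc c j then x j else 0) + τ c := by
    intro f hf c hc
    have h1 : (Finset.univ.filter (fun i => inc c (i, f i))).card ≤
        (Finset.univ.filter (fun j => x j ≠ 0 ∧ inc c j)).card := by
      apply Finset.card_le_card_of_injOn (fun i => (i, f i))
      · intro i hi; simp at hi ⊢; exact ⟨hf i, hi⟩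
      · intro i _ j _ h; simp at h; exact h.1
    have h2 : (Finset.univ.filter (fun j => x j ≠ 0 ∧ inc c j)).card ≤
        (Finset.univ.filter (fun j => x j ≠ 0 ∧ x j ≠ 1 ∧ inc c j)).card +
        (Finset.univ.filter (fun j => x j = 1 ∧ inc c j)).card := by
      rw [← Finset.card_union_add_card_inter]
      refine le_trans (Finset.card_le_card ?_) (Nat.le_add_right _ _)
      intro j hj; simp at hj ⊢; tauto
    have h3 : ((Finset.univ.filter (fun j => x j = 1 ∧ inc c j)).card : ℝ) ≤
        (∑ j, if inc c j then x j else 0) := by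
      rw [Finset.card_filter]
      push_cast
      apply Finset.sum_le_sum
      intro j _
      by_cases hc : inc c j <;> by_cases h : x j = 1 <;> simp [hc, h, hx0 j]
    have : ((Finset.univ.filter (fun i => inc c (i, f i))).card : ℝ) ≤
        (Finset.univ.filter (fun j => x j ≠ 0 ∧ x j ≠ 1 ∧ inc c j)).card +
        (Finset.univ.filter (fun j => x j = 1 ∧ inc c j)).card := by exact_mod_cast h1.trans h2
    linarith
  by_cases hF : ∀ j, x j = 0 ∨ x j = 1
  · choose f hf using hex
    refine ⟨f, hf, fun c => hdead f hf c ?_⟩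
    rw [Finset.filter_false_of_mem]
    · simpa using (hτ c).le
    · intro j _ h; rcases hF j with h' | h' <;> tauto
  push Not at hF
  obtain ⟨j0, hj0⟩ := hF
  let F := Finset.univ.filter (fun j => x j ≠ 0 ∧ x j ≠ 1)
  let R := Finset.univ.filter (fun i => ∃ o, (i, o) ∈ F)
  let Al := Finset.univ.filter (fun c => τ c < ((Finset.univ.filter (fun j => x j ≠ 0 ∧ x j ≠ 1 ∧ inc c j)).card : ℝ))
  have hF0 : 0 < F.card := Finset.card_pos.2 ⟨j0, by simp [F, hj0]⟩
  have hR : 2 * R.card ≤ F.card := by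
    have h1 : F.card = ∑ i ∈ R, (F.filter (fun j => j.1 = i)).card :=
      Finset.card_eq_sum_card_fiberwise (by
        intro j hj
        simp [R] ; exact ⟨j.2, hj⟩)
    rw [h1, mul_comm, ← smul_eq_mul]
    apply Finset.card_nsmul_le_sum
    intro i hi
    simp only [R, Finset.mem_filter, Finset.mem_univ, true_and] at hi
    obtain ⟨o, ho⟩ := hi
    have ho' := ho
    simp only [F, Finset.mem_filter, Finset.mem_univ, true_and] at ho
    have : ∃ o', o' ≠ o ∧ (i, o') ∈ F := by
      by_contra hcon
      push Not at hcon
      have hs := hx1 i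
      rw [← Finset.add_sum_erase _ _ (Finset.mem_univ o)] at hs
      by_cases hall : ∀ o' ∈ Finset.univ.erase o, x (i, o') = 0
      · rw [Finset.sum_eq_zero hall] at hs
        exact ho.2 (by linarith)
      · push Not at hall
        obtain ⟨o', ho', hne⟩ := hall
        have hne' := (Finset.mem_erase.1 ho').1
        have : x (i, o') = 1 := by
          have := hcon o' hne'
          simp only [F, Finset.mem_filter, Finset.mem_univ, true_and] at this
          tauto
        have h2 : x (i, o') ≤ ∑ o ∈ Finset.univ.erase o, x (i, o) :=
          Finset.single_le_sum (f := fun o => x (i, o)) (fun _ _ => hx0 _) ho'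
        have h3 : 0 < x (i, o) := lt_of_le_of_ne (hx0 _) (Ne.symm ho.1)
        linarith
    obtain ⟨o', hne, hF'⟩ := this
    have : ({(i, o), (i, o')} : Finset (I × O)) ⊆ F.filter (fun j => j.1 = i) := by
      intro j hj
      simp only [Finset.mem_insert, Finset.mem_singleton] at hj
      rcases hj with rfl | rfl <;> simp [ho', hF']
    refine le_trans ?_ (Finset.card_le_card this)
    rw [Finset.card_pair]
    intro h; simp at h; exact hne h.symm
  have hAl : 2 * Al.card < F.card := by
    have h1 : ∑ c, ∑ j ∈ F, (if inc c j then 1 / τ c else 0) ≤ (F.card : ℝ) / 2 := by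
      rw [Finset.sum_comm]
      have : ∑ j ∈ F, ∑ c, (if inc c j then 1 / τ c else 0) ≤ ∑ j ∈ F, (1/2 : ℝ) := by
        apply Finset.sum_le_sum
        intro j hj
        simp only [F, Finset.mem_filter, Finset.mem_univ, true_and] at hj
        exact hinc j hj.1
      refine this.trans ?_
      simp; linarith
    have h2 : ∑ c ∈ Al, ∑ j ∈ F, (if inc c j then 1 / τ c else 0) ≤ (F.card : ℝ) / 2 := by
      refine le_trans (Finset.sum_le_sum_of_subset_of_nonneg (Finset.subset_univ _) ?_) h1
      intro c _ _
      apply Finset.sum_nonneg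
      intro j _
      split_ifs
      · exact (one_div_pos.2 (hτ c)).le
      · exact le_rfl
    have h3 : ∀ c ∈ Al, (1:ℝ) < ∑ j ∈ F, (if inc c j then 1 / τ c else 0) := by
      intro c hc
      simp only [Al, Finset.mem_filter, Finset.mem_univ, true_and] at hc
      rw [← Finset.sum_filter, Finset.sum_const, nsmul_eq_mul, mul_one_div, lt_div_iff₀ (hτ c), one_mul]
      have he : F.filter (fun j => inc c j) =
          Finset.univ.filter (fun j => x j ≠ 0 ∧ x j ≠ 1 ∧ inc c j) := by
        ext j; simp [F, and_assoc]
      rw [he]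
      exact hc
    have h4 : (Al.card : ℝ) < (F.card : ℝ) / 2 := by
      rcases Al.eq_empty_or_nonempty with h | h
      · rw [h]; simp; exact Finset.card_pos.1 hF0
      · have := Finset.sum_lt_sum_of_nonempty h h3
        simp at this
        simp at h2
        linarith
    have : (2 * Al.card : ℝ) < F.card := by linarith
    exact_mod_cast this
  -- kernel vector
  let Φ : (F → ℝ) →ₗ[ℝ] ((R → ℝ) × (Al → ℝ)) :=
    { toFun := fun z => (fun i => ∑ j : F, if j.1.1 = i then z j else 0,
        fun c => ∑ j : F, if inc c j.1 then z j else 0)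
      map_add' := by
        intro a b
        ext k
        · simp only [Pi.add_apply, Prod.fst_add, ← Finset.sum_add_distrib]
          apply Finset.sum_congr rfl; intro j _; split_ifs <;> simp
        · simp only [Pi.add_apply, Prod.snd_add, ← Finset.sum_add_distrib]
          apply Finset.sum_congr rfl; intro j _; split_ifs <;> simp
      map_smul' := by
        intro a b
        ext k
        · simp only [Pi.smul_apply, Prod.smul_fst, smul_eq_mul, Finset.mul_sum, RingHom.id_apply]
          apply Finset.sum_congr rfl; intro j _; split_ifs <;> simp
        · simp only [Pi.smul_apply, Prod.smul_snd, smul_eq_mul, Finset.mul_sum, RingHom.id_apply]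
          apply Finset.sum_congr rfl; intro j _; split_ifs <;> simp }
  have hker : LinearMap.ker Φ ≠ ⊥ := by
    apply LinearMap.ker_ne_bot_of_finrank_lt
    simp
    omega
  obtain ⟨z, hz, hzne⟩ := (Submodule.ne_bot_iff _).1 hker
  rw [LinearMap.mem_ker] at hz
  have hz1 : ∀ i : R, (∑ j : F, if j.1.1 = i then z j else 0) = 0 := by
    intro i
    have := congrArg (fun p => p.1 i) hz
    simpa [Φ] using this
  have hz2 : ∀ c : Al, (∑ j : F, if inc c j.1 then z j else 0) = 0 := by
    intro c
    have := congrArg (fun p => p.2 c) hz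
    simpa [Φ] using this
  have hneg : ∃ j : F, z j < 0 := by
    by_contra hcon
    push Not at hcon
    apply hzne
    ext j
    have hjR : j.1.1 ∈ R := by simp [R]; exact ⟨j.1.2, j.2⟩
    have := hz1 ⟨j.1.1, hjR⟩
    rw [Finset.sum_eq_zero_iff_of_nonneg] at this
    · have := this j (Finset.mem_univ _)
      simpa using this
    · intro j _; split_ifs
      · exact hcon j
      · exact le_rfl
  obtain ⟨j1, hj1, hmin⟩ := Finset.exists_min_image (Finset.univ.filter (fun j : F => z j < 0))
    (fun j => x j.1 / (- z j)) (by obtain ⟨j, hj⟩ := hneg; exact ⟨j, by simp [hj]⟩)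
  simp only [Finset.mem_filter, Finset.mem_univ, true_and] at hj1 hmin
  let t := x j1.1 / (- z j1)
  have ht : 0 ≤ t := div_nonneg (hx0 _) (by linarith)
  let Z : I × O → ℝ := fun j => if h : j ∈ F then z ⟨j, h⟩ else 0
  have hZsum : ∀ p : I × O → Prop, (∑ j, if p j then Z j else 0) = ∑ j : F, if p j.1 then z j else 0 := by
    intro p
    rw [← Finset.sum_subset (Finset.subset_univ F)]
    · rw [← Finset.sum_coe_sort]
      apply Finset.sum_congr rfl
      intro j _
      simp [Z]
    · intro j _ hj; simp [Z, hj]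
  let x' : I × O → ℝ := fun j => x j + t * Z j
  have hx'0 : ∀ j, 0 ≤ x' j := by
    intro j
    by_cases hj : j ∈ F
    · have : Z j = z ⟨j, hj⟩ := by simp [Z, hj]
      simp only [x', this]
      rcases lt_or_ge (z ⟨j, hj⟩) 0 with h | h
      · have := hmin ⟨j, hj⟩ h
        rw [le_div_iff₀ (by linarith)] at this
        simp only [t]
        linarith
      · have := mul_nonneg ht h
        linarith [hx0 j]
    · simp [x', Z, hj, hx0]
  have hsupp : ∀ j, x j = 0 → x' j = 0 := by
    intro j hj
    have : j ∉ F := by simp [F, hj]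
    simp [x', Z, this, hj]
  have hx'1 : ∀ i, ∑ o, x' (i, o) = 1 := by
    intro i
    simp only [x', Finset.sum_add_distrib, hx1, ← Finset.mul_sum]
    have : ∑ o, Z (i, o) = 0 := by
      have h1 : ∑ o, Z (i, o) = ∑ j : I × O, if j.1 = i then Z j else 0 := by
        rw [Fintype.sum_prod_type]
        rw [Finset.sum_eq_single i] <;> simp
        intro b hb; simp [hb]
      rw [h1, hZsum (fun j => j.1 = i)]
      by_cases hi : i ∈ R
      · exact hz1 ⟨i, hi⟩
      · apply Finset.sum_eq_zero
        intro j _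
        rw [if_neg]
        intro h; apply hi; simp [R]; exact ⟨j.1.2, by rw [← h]; exact j.2⟩
    rw [this]; simp
  have hj1' : x' j1.1 = 0 := by
    have : Z j1.1 = z j1 := by simp [Z]
    simp only [x', this, t]
    have : z j1 ≠ 0 := hj1.ne
    field_simp; ring
  have hj1x : x j1.1 ≠ 0 := by
    have := j1.2
    simp only [F, Finset.mem_filter] at this
    exact this.2.1
  have hlt : (Finset.univ.filter (fun j => x' j ≠ 0)).card < n := by
    rw [← hn]
    apply Finset.card_lt_card
    refine ⟨fun j hj => ?_, fun h => ?_⟩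
    · simp at hj ⊢; exact fun h => hj (hsupp j h)
    · have := h (show j1.1 ∈ _ by simpa using hj1x)
      simp [hj1'] at this
  obtain ⟨f, hf, hfc⟩ := ih _ hlt x' rfl hx'0 hx'1 (fun j hj => hinc j (fun h => hj (hsupp j h)))
  have hf' : ∀ i, x (i, f i) ≠ 0 := fun i h => hf i (hsupp _ h)
  refine ⟨f, hf', fun c => ?_⟩
  by_cases hc : c ∈ Al
  · refine (hfc c).trans (le_of_eq ?_)
    congr 1
    have h0 := hz2 ⟨c, hc⟩
    rw [← hZsum (fun j => inc c j)] at h0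
    have : ∀ j, (if inc c j then x' j else 0) = (if inc c j then x j else 0) + t * (if inc c j then Z j else 0) := by
      intro j; split_ifs <;> simp [x']
    simp only [this, Finset.sum_add_distrib, ← Finset.mul_sum, h0]; simp
  · apply hdead f hf'
    simpa [Al] using hc

/-- Rounding lemma. -/
lemma round_lemma {I O C : Type*} [Fintype I] [Fintype O] [Fintype C]
    (A : I → Finset O) (hA : ∀ i, (A i).Nonempty)
    (inc : C → I → O → Prop) (τ : C → ℝ) (hτ : ∀ c, 0 < τ c)
    (hinc : ∀ i, ∀ o ∈ A i, ∑ c, (if inc c i o then 1 / τ c else 0) ≤ 1 / 2) :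
    ∃ f : I → O, (∀ i, f i ∈ A i) ∧
      ∀ c, ((Finset.univ.filter (fun i => inc c i (f i))).card : ℝ) ≤
        (∑ i, (((A i).filter (fun o => inc c i o)).card : ℝ) / (A i).card) + τ c := by
  have hc : ∀ i, ((A i).card : ℝ) ≠ 0 := fun i => by
    exact_mod_cast (Finset.card_pos.2 (hA i)).ne'
  obtain ⟨f, hf, h⟩ := round_aux (fun c j => inc c j.1 j.2) τ hτ _
    (fun j : I × O => if j.2 ∈ A j.1 then 1 / ((A j.1).card : ℝ) else 0) rfl
    (fun j => by split_ifs <;> positivity)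
    (fun i => by
      have := hc i
      simp only [Finset.sum_ite_mem, Finset.univ_inter, Finset.sum_const, nsmul_eq_mul]
      field_simp)
    (fun j hj => by
      apply hinc
      by_contra h
      simp [h] at hj)
  refine ⟨f, fun i => ?_, fun c => (h c).trans (le_of_eq ?_)⟩
  · by_contra h; have := hf i; simp [h] at this
  · congr 1
    rw [Fintype.sum_prod_type]
    apply Finset.sum_congr rfl
    intro i _
    simp only [← ite_and]
    rw [← Finset.sum_filter, Finset.sum_const, nsmul_eq_mul, mul_one_div]
    congr 3
    ext o; simp; tauto

end PD

namespace PD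

lemma exists_bundles {V : Type*} (g : ℕ) : ∀ (m : ℕ) (s : Finset V), g * m ≤ s.card →
    ∃ B : ℕ → Finset V, (∀ b, B b ⊆ s) ∧ (∀ b, b < m → (B b).card = g) ∧
      (∀ b b' v, v ∈ B b → v ∈ B b' → b = b') := by
  intro m
  induction m with
  | zero => intro s _; exact ⟨fun _ => ∅, by simp, by simp, by simp⟩
  | succ m ih =>
    intro s hs
    obtain ⟨t, hts, htc⟩ := Finset.exists_subset_card_eq (show g ≤ s.card by nlinarith)
    obtain ⟨B, h1, h2, h3⟩ := ih (s \ t) (by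
      rw [Finset.card_sdiff_of_subset hts, htc]
      have : g * (m+1) = g * m + g := by ring
      omega)
    refine ⟨fun b => if b = 0 then t else B (b - 1), ?_, ?_, ?_⟩
    · intro b; dsimp; split_ifs
      · exact hts
      · exact (h1 _).trans Finset.sdiff_subset
    · intro b hb; dsimp; split_ifs
      · exact htc
      · exact h2 _ (by omega)
    · intro b b' v hv hv'
      dsimp at hv hv'
      split_ifs at hv hv'
      · omega
      · have := (Finset.mem_sdiff.1 (h1 _ hv')).2; contradiction
      · have := (Finset.mem_sdiff.1 (h1 _ hv)).2; contradiction
      · have := h3 _ _ _ hv hv'; omega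

lemma exists_sdr {I V : Type*} [Nonempty V] (s : Finset I) (t : I → Finset V)
    (h : ∀ i ∈ s, s.card ≤ (t i).card) :
    ∃ F : I → V, (∀ i ∈ s, F i ∈ t i) ∧ (∀ i ∈ s, ∀ j ∈ s, F i = F j → i = j) := by
  have := (Finset.all_card_le_biUnion_card_iff_exists_injective (fun i : s => t i.1)).1 (by
    intro u
    rcases u.eq_empty_or_nonempty with rfl | ⟨i, hi⟩
    · simp
    · have h1 : u.card ≤ s.card := by
        simpa using Finset.card_le_univ u
      exact h1.trans ((h i.1 i.2).trans (Finset.card_le_card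
        (Finset.subset_biUnion_of_mem (fun i : s => t i.1) hi))))
  obtain ⟨f, hf, hft⟩ := this
  have hV : Nonempty V := inferInstance
  refine ⟨fun i => if h : i ∈ s then f ⟨i, h⟩ else hV.some, ?_, ?_⟩
  · intro i hi; simp [hi]; exact hft ⟨i, hi⟩
  · intro i hi j hj hij
    simp [hi, hj] at hij
    have := hf hij
    simpa using this

lemma step_lemma {I V A : Type*} [Fintype I] [Fintype V] [Fintype A] (en : I → V)
    (keys : I → Finset A) (κ φ : ℕ) (hκ : 1 ≤ κ) (hkeys : ∀ i, (keys i).card ≤ κ)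
    (forb : I → Finset V) (hforb : ∀ i, (forb i).card ≤ φ)
    (Out : V → Finset V) (m : V → ℕ) (hm : ∀ x, 1 ≤ m x)
    (hOut : ∀ x, (φ + 5) * m x ≤ (Out x).card)
    (hcount : ∀ x, (Finset.univ.filter (fun i => en i = x)).card ≤ m x) :
    ∃ nx : I → V, (∀ i, nx i ∈ Out (en i)) ∧ (∀ i, nx i ∉ forb i) ∧
      (∀ i j, en i = en j → nx i = nx j → i = j) ∧
      ∀ a v, ((Finset.univ.filter (fun i => a ∈ keys i ∧ nx i = v)).card : ℝ) ≤
        (∑ i, if a ∈ keys i ∧ v ∈ Out (en i) then 1 / (m (en i) : ℝ) else 0) +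
          4 * κ * (φ + 5) := by
  have hB : ∀ x, ∃ B : ℕ → Finset V, (∀ b, B b ⊆ Out x) ∧ (∀ b, b < m x → (B b).card = φ + 5) ∧
      (∀ b b' v, v ∈ B b → v ∈ B b' → b = b') := fun x => exists_bundles _ _ _ (hOut x)
  choose B hB1 hB2 hB3 using hB
  let N := Finset.univ.sup m
  have hN : ∀ x, m x ≤ N := fun x => Finset.le_sup (Finset.mem_univ x)
  let Al : I → Finset (Fin N) := fun i => Finset.univ.filter (fun b => b.1 < m (en i))
  have hAlc : ∀ i, (Al i).card = m (en i) := by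
    intro i
    have : (Al i) = (Finset.range (m (en i))).attachFin (fun b hb => by
        have := hN (en i); simp at hb; omega) := by
      ext b; simp [Al]
    rw [this]; simp
  obtain ⟨inc, hinl, hinr⟩ : ∃ inc : (V × Fin N) ⊕ (A × V) → I → Fin N → Prop,
      (∀ x b i o, inc (Sum.inl (x, b)) i o ↔ en i = x ∧ o = b) ∧
      (∀ a v i o, inc (Sum.inr (a, v)) i o ↔ a ∈ keys i ∧ v ∈ B (en i) o) :=
    ⟨fun c i o => match c with
    | Sum.inl (x, b) => en i = x ∧ o = b
    | Sum.inr (a, v) => a ∈ keys i ∧ v ∈ B (en i) o, fun _ _ _ _ => Iff.rfl, fun _ _ _ _ => Iff.rfl⟩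
  obtain ⟨τ, hτl, hτr⟩ : ∃ τ : (V × Fin N) ⊕ (A × V) → ℝ, (∀ c, τ (Sum.inl c) = 4) ∧
      (∀ c, τ (Sum.inr c) = 4 * κ * (φ + 5)) :=
    ⟨fun c => match c with
    | Sum.inl _ => 4
    | Sum.inr _ => 4 * κ * (φ + 5), fun _ => rfl, fun _ => rfl⟩
  have hκ' : (1:ℝ) ≤ κ := by exact_mod_cast hκ
  have hτpos : (0:ℝ) < 4 * κ * (φ + 5) := by positivity
  obtain ⟨f, hf, hfc⟩ := round_lemma Al (fun i => by
      rw [← Finset.card_pos, hAlc]; exact hm _) inc τ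
    (by rintro (c | c)
        · rw [hτl]; norm_num
        · rw [hτr]; exact hτpos)
    (by
      intro i o ho
      have ho' : o.1 < m (en i) := by simpa [Al] using ho
      rw [Fintype.sum_sum_type]
      have h1 : ∑ c : V × Fin N, (if inc (Sum.inl c) i o then 1 / τ (Sum.inl c) else 0) = 1 / 4 := by
        rw [Finset.sum_eq_single (en i, o)]
        · simp [hinl, hτl]
        · rintro ⟨x, b⟩ _ hne
          rw [if_neg]
          rw [hinl]
          rintro ⟨rfl, rfl⟩; exact hne rfl
        · simp
      have h2 : ∑ c : A × V, (if inc (Sum.inr c) i o then 1 / τ (Sum.inr c) else 0) ≤ 1 / 4 := by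
        simp only [hτr]
        rw [← Finset.sum_filter, Finset.sum_const, nsmul_eq_mul, mul_one_div]
        have : (Finset.univ.filter (fun c : A × V => inc (Sum.inr c) i o)) = (keys i) ×ˢ (B (en i) o) := by
          ext ⟨a, v⟩; simp [hinr]
        rw [this, Finset.card_product, hB2 _ _ ho', div_le_iff₀ hτpos]
        push_cast
        have : ((keys i).card : ℝ) ≤ κ := by exact_mod_cast hkeys i
        nlinarith [mul_le_mul_of_nonneg_right this (show (0:ℝ) ≤ φ + 5 by positivity)]
      rw [h1]; linarith)
  have hcap : ∀ x b, (Finset.univ.filter (fun i => en i = x ∧ f i = b)).card ≤ 5 := by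
    intro x b
    have h := hfc (Sum.inl (x, b))
    have h1 : (∑ i, (((Al i).filter (fun o => inc (Sum.inl (x, b)) i o)).card : ℝ) / (Al i).card) ≤ 1 := by
      have : ∀ i, (((Al i).filter (fun o => inc (Sum.inl (x, b)) i o)).card : ℝ) / (Al i).card ≤
          if en i = x then 1 / (m x : ℝ) else 0 := by
        intro i
        split_ifs with hi
        · rw [hAlc, hi]
          gcongr
          have : ((Al i).filter (fun o => inc (Sum.inl (x, b)) i o)) ⊆ {b} := by
            intro o ho; simp [hinl] at ho; simp [ho.2.2]
          exact_mod_cast (Finset.card_le_card this)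
        · rw [Finset.filter_false_of_mem]
          · simp
          · intro o _ h; rw [hinl] at h; exact hi h.1
      refine (Finset.sum_le_sum (fun i _ => this i)).trans ?_
      rw [← Finset.sum_filter, Finset.sum_const, nsmul_eq_mul, mul_one_div]
      have := hcount x
      have hmx := hm x
      rw [div_le_one (by exact_mod_cast hmx)]
      exact_mod_cast this
    have h2 : ((Finset.univ.filter (fun i => en i = x ∧ f i = b)).card : ℝ) ≤ 5 := by
      have he : (Finset.univ.filter (fun i => en i = x ∧ f i = b)) =
          (Finset.univ.filter (fun i => inc (Sum.inl (x, b)) i (f i))) := by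
        ext i; simp [hinl]
      rw [he]
      rw [hτl] at h
      linarith
    exact_mod_cast h2
  have hsdr : ∀ x b, ∃ F : I → V,
      (∀ i ∈ Finset.univ.filter (fun i => en i = x ∧ f i = b), F i ∈ B (en i) (f i) \ forb i) ∧
      (∀ i ∈ Finset.univ.filter (fun i => en i = x ∧ f i = b),
        ∀ j ∈ Finset.univ.filter (fun i => en i = x ∧ f i = b), F i = F j → i = j) := by
    intro x b
    have : Nonempty V := ⟨x⟩
    apply exists_sdr
    intro i hi
    refine (hcap x b).trans ?_
    have h1 := Finset.le_card_sdiff (forb i) (B (en i) (f i))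
    have h2 := hB2 (en i) (f i) (by simpa [Al] using hf i)
    have h3 := hforb i
    omega
  choose F hF1 hF2 using hsdr
  have hmem : ∀ i, F (en i) (f i) i ∈ B (en i) (f i) \ forb i := fun i => hF1 _ _ i (by simp)
  refine ⟨fun i => F (en i) (f i) i, ?_, ?_, ?_, ?_⟩
  · intro i; exact hB1 _ _ (Finset.mem_sdiff.1 (hmem i)).1
  · intro i; exact (Finset.mem_sdiff.1 (hmem i)).2
  · intro i j hij h
    dsimp only at h
    have hb : f i = f j := by
      have h1 := (Finset.mem_sdiff.1 (hmem i)).1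
      have h2 := (Finset.mem_sdiff.1 (hmem j)).1
      rw [← h, ← hij] at h2
      exact Fin.ext (hB3 _ _ _ _ h1 h2)
    rw [← hij, ← hb] at h
    exact hF2 (en i) (f i) i (by simp) j (by simp [hij, hb]) h
  · intro a v
    have h := hfc (Sum.inr (a, v))
    have h0 : (Finset.univ.filter (fun i => a ∈ keys i ∧ F (en i) (f i) i = v)).card ≤
        (Finset.univ.filter (fun i => inc (Sum.inr (a, v)) i (f i))).card := by
      apply Finset.card_le_card
      intro i hi
      simp at hi
      simp [hinr]
      exact ⟨hi.1, by rw [← hi.2]; exact (Finset.mem_sdiff.1 (hmem i)).1⟩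
    have h1 : (∑ i, (((Al i).filter (fun o => inc (Sum.inr (a, v)) i o)).card : ℝ) / (Al i).card) ≤
        ∑ i, if a ∈ keys i ∧ v ∈ Out (en i) then 1 / (m (en i) : ℝ) else 0 := by
      apply Finset.sum_le_sum
      intro i _
      rw [hAlc]
      split_ifs with hi
      · gcongr
        have : ((Al i).filter (fun o => inc (Sum.inr (a, v)) i o)).card ≤ 1 := by
          rw [Finset.card_le_one]
          intro o ho o' ho'
          simp [hinr] at ho ho'
          exact Fin.ext (hB3 _ _ _ _ ho.2.2 ho'.2.2)
        exact_mod_cast this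
      · rw [Finset.filter_false_of_mem]
        · simp
        · intro o _ h; rw [hinr] at h; exact hi ⟨h.1, hB1 _ _ h.2⟩
    have h0' : ((Finset.univ.filter (fun i => a ∈ keys i ∧ F (en i) (f i) i = v)).card : ℝ) ≤
        (Finset.univ.filter (fun i => inc (Sum.inr (a, v)) i (f i))).card := by exact_mod_cast h0
    rw [hτr] at h
    linarith

end PD

namespace PD

lemma regroup {I V : Type*} [Fintype I] [Fintype V] (P : I → Prop) (S : V → Prop) (p : I → V)
    (m : V → ℕ) (hm : ∀ x, 1 ≤ m x) (c : ℝ)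
    (h : ∀ x, ((Finset.univ.filter (fun i => P i ∧ p i = x)).card : ℝ) ≤ c * m x) :
    (∑ i, if P i ∧ S (p i) then 1 / (m (p i) : ℝ) else 0) ≤
      c * (Finset.univ.filter (fun x => S x)).card := by
  have h1 : (∑ i, if P i ∧ S (p i) then 1 / (m (p i) : ℝ) else 0) =
      ∑ x, ∑ i, if P i ∧ p i = x then (if S x then 1 / (m x : ℝ) else 0) else 0 := by
    rw [Finset.sum_comm]
    apply Finset.sum_congr rfl
    intro i _
    rw [Finset.sum_eq_single (p i)]
    · by_cases h1 : P i <;> by_cases h2 : S (p i) <;> simp [h1, h2]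
    · intro b _ hb
      rw [if_neg]
      rintro ⟨_, h⟩; exact hb h.symm
    · simp
  rw [h1]
  have h2 : ∀ x, (∑ i, if P i ∧ p i = x then (if S x then 1 / (m x : ℝ) else 0) else 0) ≤
      if S x then c else 0 := by
    intro x
    rw [← Finset.sum_filter, Finset.sum_const, nsmul_eq_mul]
    split_ifs
    · have := h x
      have hmx : (0:ℝ) < m x := by exact_mod_cast hm x
      rw [mul_one_div, div_le_iff₀ hmx]
      exact this
    · simp
  refine (Finset.sum_le_sum (fun x _ => h2 x)).trans ?_
  rw [← Finset.sum_filter, Finset.sum_const, nsmul_eq_mul, mul_comm]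

lemma walk_aux {I V : Type*} [Fintype I] [Fintype V] (L φ Q M : ℕ) (hQ : 1 ≤ Q) (hM : 1 ≤ M)
    (Out : ℕ → V → Finset V) (m : V → ℕ) (hmM : ∀ v, M ≤ m v)
    (hOut : ∀ k, k < L → ∀ v, (φ + L + 6) * m v ≤ (Out k v).card)
    (hin : ∀ k, k < L → ∀ v, (Finset.univ.filter (fun x => v ∈ Out k x)).card ≤ Q * m v)
    (e : I → V) (forb : I → Finset V) (hforb : ∀ i, (forb i).card ≤ φ)
    (δ τ : ℝ) (hτ : τ = 4 * (L + 2) * (φ + L + 6)) (hτδ : τ ≤ δ * M)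
    (hδ : (2 * Q : ℝ) ^ L * δ ≤ 1)
    (hn : ∀ x, ((Finset.univ.filter (fun i => e i = x)).card : ℝ) ≤ δ * m x) :
    ∀ n ≤ L, ∃ p : I → ℕ → V, (∀ i, p i 0 = e i) ∧
      (∀ k < n, ∀ i, p i (k + 1) ∈ Out k (p i k)) ∧
      (∀ k < n, ∀ i j, p i k = p j k → p i (k + 1) = p j (k + 1) → i = j) ∧
      (∀ k < n, ∀ i, p i (k + 1) ∉ forb i) ∧
      (∀ k < n, ∀ i, ∀ j ≤ k, p i (k + 1) ≠ p i j) ∧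
      (∀ k ≤ n, ∀ v, ((Finset.univ.filter (fun i => p i k = v)).card : ℝ) ≤
        (2 * Q) ^ k * δ * m v) ∧
      (∀ k < n, ∀ j ≤ k, ∀ w v,
        ((Finset.univ.filter (fun i => p i j = w ∧ p i (k + 1) = v)).card : ℝ) ≤
          (∑ i, if p i j = w ∧ v ∈ Out k (p i k) then 1 / (m (p i k) : ℝ) else 0) + τ) := by
  have hm1 : ∀ v, 1 ≤ m v := fun v => hM.trans (hmM v)
  have hτ0 : 0 < τ := by rw [hτ]; positivity
  have hM' : (1:ℝ) ≤ M := by exact_mod_cast hM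
  have hQ' : (1:ℝ) ≤ Q := by exact_mod_cast hQ
  have hδ0 : 0 < δ := by
    by_contra h
    push Not at h
    have : δ * M ≤ 0 := mul_nonpos_of_nonpos_of_nonneg h (by linarith)
    linarith
  intro n
  induction n with
  | zero =>
    intro _
    refine ⟨fun i _ => e i, by simp, by simp, by simp, by simp, by simp, ?_, by simp⟩
    intro k hk v
    obtain rfl : k = 0 := by omega
    simpa using hn v
  | succ n ih =>
    intro hnL
    obtain ⟨p, h0, h1, h2, h3, h4, h5, h6⟩ := ih (by omega)
    have hpow : (2 * Q : ℝ) ^ n * δ ≤ 1 := by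
      refine le_trans ?_ hδ
      gcongr
      · linarith
      · omega
    obtain ⟨nx, hx1, hx2, hx3, hx4⟩ := step_lemma (A := Option (Fin (L + 1) × V)) (fun i => p i n)
      (fun i => insert none (Finset.univ.image (fun j : Fin (L + 1) => some (j, p i j)))) (L + 2)
      (φ + L + 1) (by omega)
      (fun i => by
        refine (Finset.card_insert_le _ _).trans ?_
        have := Finset.card_image_le (s := (Finset.univ : Finset (Fin (L + 1))))
          (f := fun j : Fin (L + 1) => some (j, p i j))
        simp at this
        omega)
      (fun i => forb i ∪ (Finset.range (n + 1)).image (p i))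
      (fun i => by
        refine (Finset.card_union_le _ _).trans ?_
        have := Finset.card_image_le (s := Finset.range (n + 1)) (f := p i)
        have := hforb i
        simp at *
        omega)
      (Out n) m hm1
      (fun x => hOut n (by omega) x)
      (fun x => by
        have := h5 n le_rfl x
        have h' : (2 * Q : ℝ) ^ n * δ * m x ≤ m x := by
          have : (0:ℝ) ≤ m x := by positivity
          nlinarith
        exact_mod_cast this.trans h')
    have hτ' : (4 * ((L + 2 : ℕ) : ℝ) * (((φ + L + 1 : ℕ) : ℝ) + 5)) = τ := by
      rw [hτ]; push_cast; ring
    rw [hτ'] at hx4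
    let p' : I → ℕ → V := fun i k => if k ≤ n then p i k else nx i
    have hp' : ∀ i k, k ≤ n → p' i k = p i k := fun i k hk => by simp [p', hk]
    have hp'' : ∀ i, p' i (n + 1) = nx i := fun i => by simp [p']
    refine ⟨p', ?_, ?_, ?_, ?_, ?_, ?_, ?_⟩
    · intro i; rw [hp' _ _ (by omega), h0]
    · intro k hk i
      rcases Nat.lt_succ_iff_lt_or_eq.1 hk with hk | rfl
      · rw [hp' _ _ (by omega), hp' _ _ (by omega)]; exact h1 k hk i
      · rw [hp'', hp' _ _ le_rfl]; exact hx1 i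
    · intro k hk i j
      rcases Nat.lt_succ_iff_lt_or_eq.1 hk with hk | rfl
      · simp only [hp' _ _ (show k ≤ n by omega), hp' _ _ (show k + 1 ≤ n by omega)]
        exact h2 k hk i j
      · simp only [hp' _ _ le_rfl, hp'']; exact hx3 i j
    · intro k hk i
      rcases Nat.lt_succ_iff_lt_or_eq.1 hk with hk | rfl
      · rw [hp' _ _ (by omega)]; exact h3 k hk i
      · rw [hp'']; have := hx2 i
        simp at this; exact this.1
    · intro k hk i j hj
      rcases Nat.lt_succ_iff_lt_or_eq.1 hk with hk | rfl
      · rw [hp' _ _ (by omega), hp' _ _ (by omega)]; exact h4 k hk i j hj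
      · rw [hp'', hp' _ _ hj]; have := hx2 i
        simp at this; exact fun h => this.2 j (by omega) h.symm
    · intro k hk v
      rcases Nat.le_succ_iff.1 hk with hk | rfl
      · simp only [hp' _ _ hk]; exact h5 k hk v
      · simp only [hp'']
        have this : ((Finset.univ.filter (fun i => nx i = v)).card : ℝ) ≤
            (∑ i, if v ∈ Out n (p i n) then 1 / (m (p i n) : ℝ) else 0) + τ := by
          have := hx4 none v
          simp only [Finset.mem_insert, true_or, true_and] at this
          convert this
        have hr := regroup (fun _ : I => True) (fun x => v ∈ Out n x) (fun i => p i n) m hm1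
          ((2 * Q) ^ n * δ) (by simpa using h5 n le_rfl)
        have hr : (∑ i, if v ∈ Out n (p i n) then 1 / (m (p i n) : ℝ) else 0) ≤
            (2 * Q) ^ n * δ * (Finset.univ.filter (fun x => v ∈ Out n x)).card := by
          simp only [true_and] at hr
          convert hr
        have hi : ((Finset.univ.filter (fun x => v ∈ Out n x)).card : ℝ) ≤ Q * m v := by
          exact_mod_cast hin n (by omega) v
        have hpd : 0 < (2 * Q : ℝ) ^ n * δ := by positivity
        have hpd2 : δ ≤ (2 * Q : ℝ) ^ n * δ := by
          have : (1:ℝ) ≤ (2 * Q : ℝ) ^ n := one_le_pow₀ (by linarith)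
          nlinarith
        have hmv : (M : ℝ) ≤ m v := by exact_mod_cast hmM v
        have h7 : τ ≤ (2 * Q : ℝ) ^ n * δ * (Q * m v) := by
          calc τ ≤ δ * M := hτδ
            _ ≤ ((2 * Q : ℝ) ^ n * δ) * (1 * m v) := by
              rw [one_mul]; gcongr
            _ ≤ _ := by gcongr
        have h8 := mul_le_mul_of_nonneg_left hi hpd.le
        calc _ ≤ _ := this
          _ ≤ (2 * Q : ℝ) ^ n * δ * (Q * m v) + (2 * Q : ℝ) ^ n * δ * (Q * m v) := by
            linarith
          _ = _ := by rw [Nat.succ_eq_add_one, pow_succ]; ring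
    · intro k hk j hj w v
      rcases Nat.lt_succ_iff_lt_or_eq.1 hk with hk | rfl
      · simp only [hp' _ _ (show k ≤ n by omega), hp' _ _ (show k + 1 ≤ n by omega),
          hp' _ _ (show j ≤ n by omega)]
        exact h6 k hk j hj w v
      · simp only [hp' _ _ le_rfl, hp'', hp' _ _ hj]
        have := hx4 (some (⟨j, by omega⟩, w)) v
        have hk : ∀ i, (some ((⟨j, by omega⟩ : Fin (L + 1)), w) ∈
          insert none (Finset.univ.image (fun j : Fin (L + 1) => some (j, p i j)))) ↔ p i j = w := by
          intro i; simp
        simp only [hk] at this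
        exact this

/-- Walk lemma. -/
lemma walk_lemma {I V : Type*} [Fintype I] [Fintype V] (L φ Q M : ℕ) (hQ : 1 ≤ Q) (hM : 1 ≤ M)
    (Out : ℕ → V → Finset V) (m : V → ℕ) (hmM : ∀ v, M ≤ m v)
    (hOut : ∀ k, k < L → ∀ v, (φ + L + 6) * m v ≤ (Out k v).card)
    (hin : ∀ k, k < L → ∀ v, (Finset.univ.filter (fun x => v ∈ Out k x)).card ≤ Q * m v)
    (e : I → V) (forb : I → Finset V) (hforb : ∀ i, (forb i).card ≤ φ)
    (δ ε τ : ℝ) (hτ : τ = 4 * (L + 2) * (φ + L + 6)) (hτδ : τ ≤ δ * M) (hτε : τ ≤ ε * M)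
    (hδ : (2 * Q : ℝ) ^ L * δ ≤ 1)
    (hn : ∀ x, ((Finset.univ.filter (fun i => e i = x)).card : ℝ) ≤ δ * m x) :
    ∃ p : I → ℕ → V, (∀ i, p i 0 = e i) ∧
      (∀ k < L, ∀ i, p i (k + 1) ∈ Out k (p i k)) ∧
      (∀ k < L, ∀ i j, p i k = p j k → p i (k + 1) = p j (k + 1) → i = j) ∧
      (∀ k < L, ∀ i, p i (k + 1) ∉ forb i) ∧
      (∀ i, ∀ j ≤ L, ∀ k ≤ L, p i j = p i k → j = k) ∧
      (∀ k ≤ L, ∀ v, ((Finset.univ.filter (fun i => p i k = v)).card : ℝ) ≤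
        (2 * Q) ^ L * δ * m v) ∧
      (∀ k ≤ L, ∀ j < k, ∀ w v,
        ((Finset.univ.filter (fun i => p i j = w ∧ p i k = v)).card : ℝ) ≤ (2 * Q) ^ L * ε * m v) ∧
      (∀ k ≤ L, 1 ≤ k → ∀ u v,
        ((Finset.univ.filter (fun i => e i = u ∧ p i k = v)).card : ℝ) ≤
          ((Finset.univ.filter (fun i => e i = u)).card : ℝ) / M + τ) := by
  have hm1 : ∀ v, 1 ≤ m v := fun v => hM.trans (hmM v)
  have hτ0 : 1 ≤ τ := by rw [hτ]; nlinarith [(Nat.cast_nonneg L : (0:ℝ) ≤ L), (Nat.cast_nonneg φ : (0:ℝ) ≤ φ)]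
  have hM' : (1:ℝ) ≤ M := by exact_mod_cast hM
  have hQ' : (1:ℝ) ≤ Q := by exact_mod_cast hQ
  have hpos : ∀ δ : ℝ, τ ≤ δ * M → 0 < δ := by
    intro δ hτδ
    by_contra h
    push Not at h
    have : δ * M ≤ 0 := mul_nonpos_of_nonpos_of_nonneg h (by linarith)
    linarith
  have hδ0 := hpos δ hτδ
  have hε0 := hpos ε hτε
  obtain ⟨p, h0, h1, h2, h3, h4, h5, h6⟩ := walk_aux L φ Q M hQ hM Out m hmM hOut hin e forb hforb
    δ τ hτ hτδ hδ hn L le_rfl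
  have hbase : (1:ℝ) ≤ 2 * Q := by linarith
  have hback : ∀ k ≤ L, ∀ j < k, ∀ w v,
        ((Finset.univ.filter (fun i => p i j = w ∧ p i k = v)).card : ℝ) ≤ (2 * Q) ^ k * ε * m v := by
    intro k
    induction k with
    | zero => intro _ j hj; omega
    | succ k ih =>
      intro hk j hj w v
      have hmv : (M : ℝ) ≤ m v := by exact_mod_cast hmM v
      have hpp : (1:ℝ) ≤ (2 * Q : ℝ) ^ k := one_le_pow₀ hbase
      have hpd2 : ε ≤ (2 * Q : ℝ) ^ k * ε := by nlinarith
      have hkey : τ ≤ (2 * Q : ℝ) ^ k * ε * (Q * m v) := by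
          calc τ ≤ ε * M := hτε
            _ ≤ ((2 * Q : ℝ) ^ k * ε) * (1 * m v) := by
              rw [one_mul]; gcongr
            _ ≤ _ := by gcongr
      rcases Nat.lt_succ_iff_lt_or_eq.1 hj with hj | rfl
      · have := h6 k (by omega) j hj.le w v
        have hr : (∑ i, if p i j = w ∧ v ∈ Out k (p i k) then 1 / (m (p i k) : ℝ) else 0) ≤
            (2 * Q) ^ k * ε * (Finset.univ.filter (fun x => v ∈ Out k x)).card := by
          convert regroup (fun i : I => p i j = w) (fun x => v ∈ Out k x) (fun i => p i k) m hm1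
            ((2 * Q) ^ k * ε) (fun x => ih (by omega) j hj w x)
        have hi : ((Finset.univ.filter (fun x => v ∈ Out k x)).card : ℝ) ≤ Q * m v := by
          exact_mod_cast hin k (by omega) v
        have h8 := mul_le_mul_of_nonneg_left hi (show 0 ≤ (2 * Q : ℝ) ^ k * ε by positivity)
        calc _ ≤ _ := this
          _ ≤ (2 * Q : ℝ) ^ k * ε * (Q * m v) + (2 * Q : ℝ) ^ k * ε * (Q * m v) := by
            linarith
          _ = _ := by ring
      · have : (Finset.univ.filter (fun i => p i j = w ∧ p i (j + 1) = v)).card ≤ 1 := by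
          rw [Finset.card_le_one]
          intro a ha b hb
          simp at ha hb
          exact h2 j (by omega) a b (ha.1.trans hb.1.symm) (ha.2.trans hb.2.symm)
        have h9 : ((Finset.univ.filter (fun i => p i j = w ∧ p i (j + 1) = v)).card : ℝ) ≤ 1 := by
          exact_mod_cast this
        refine h9.trans (hτ0.trans (hkey.trans ?_))
        rw [pow_succ]
        have : 0 ≤ (2 * Q : ℝ) ^ j * ε * (Q * m v) := by positivity
        nlinarith
  have hmono : ∀ k ≤ L, ∀ c : ℝ, 0 < c → ∀ v, (2 * Q : ℝ) ^ k * c * m v ≤ (2 * Q : ℝ) ^ L * c * m v := by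
    intro k hk c hc v
    gcongr
  refine ⟨p, h0, h1, h2, h3, ?_, ?_, ?_, ?_⟩
  · have : ∀ i, ∀ j ≤ L, ∀ k ≤ L, j < k → p i j ≠ p i k := by
      intro i j hj k hk hjk
      obtain ⟨k, rfl⟩ : ∃ k', k = k' + 1 := ⟨k - 1, by omega⟩
      exact (h4 k (by omega) i j (by omega)).symm
    intro i j hj k hk h
    rcases lt_trichotomy j k with h' | h' | h'
    · exact absurd h (this i j hj k hk h')
    · exact h'
    · exact absurd h.symm (this i k hk j hj h')
  · intro k hk v; exact (h5 k hk v).trans (hmono k hk δ hδ0 v)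
  · intro k hk j hj w v
    exact (hback k hk j hj w v).trans (hmono k hk ε hε0 v)
  · intro k hk hk1 u v
    obtain ⟨k, rfl⟩ : ∃ k', k = k' + 1 := ⟨k - 1, by omega⟩
    have := h6 k (by omega) 0 (by omega) u v
    simp only [h0] at this
    refine this.trans ?_
    gcongr
    have hle : ∀ i, (if e i = u ∧ v ∈ Out k (p i k) then 1 / (m (p i k) : ℝ) else 0) ≤
        if e i = u then 1 / (M : ℝ) else 0 := by
      intro i
      by_cases hi : e i = u
      · simp only [hi, true_and, if_true]
        split_ifs
        · have : (M : ℝ) ≤ m (p i k) := by exact_mod_cast hmM _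
          gcongr
        · positivity
      · simp [hi]
    refine (Finset.sum_le_sum (fun i _ => hle i)).trans ?_
    rw [← Finset.sum_filter, Finset.sum_const, nsmul_eq_mul, mul_one_div]

end PD

namespace PD

lemma pack_aux {E ι : Type*} [Fintype E] [Fintype ι] [Nonempty ι] (r : ι → Finset E → ℤ)
    (hmono : ∀ i X Y, X ⊆ Y → r i X ≤ r i Y)
    (hsub : ∀ i X Y, r i (X ∪ Y) + r i (X ∩ Y) ≤ r i X + r i Y) :
    ∀ (n : ℕ) (R : Finset E) (A : ι → Finset E), R.card = n →
      (∀ i, Disjoint (A i) R) → (∀ i j, i ≠ j → Disjoint (A i) (A j)) →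
      (∀ X ⊆ R, ∑ i, (r i Finset.univ - r i (A i ∪ X)) ≤ ((R \ X).card : ℤ)) →
      ∃ B : ι → Finset E, (∀ i j, i ≠ j → Disjoint (B i) (B j)) ∧
        ∀ i, r i (B i) = r i Finset.univ := by
  intro n
  induction n with
  | zero =>
    intro R A hR _ hd hinv
    have hR : R = ∅ := Finset.card_eq_zero.1 hR
    subst hR
    refine ⟨A, hd, fun i => ?_⟩
    have h := hinv ∅ (by simp)
    simp only [Finset.union_empty, Finset.sdiff_self, Finset.card_empty, Nat.cast_zero] at h
    have h1 : ∀ j, 0 ≤ r j Finset.univ - r j (A j) := fun j => by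
      have := hmono j _ _ (Finset.subset_univ (A j)); linarith
    have h2 := Finset.single_le_sum (f := fun j => r j Finset.univ - r j (A j))
      (fun j _ => h1 j) (Finset.mem_univ i)
    have h3 := h1 i
    linarith
  | succ n ih =>
    intro R A hR hAR hd hinv
    obtain ⟨e, he⟩ : R.Nonempty := Finset.card_pos.1 (by omega)
    by_contra hcon
    have hbad : ∀ i, ∃ X ⊆ R, e ∉ X ∧ ∑ j, (r j Finset.univ - r j (A j ∪ X)) = ((R \ X).card : ℤ) ∧
        r i (A i ∪ insert e X) = r i (A i ∪ X) := by
      intro i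
      by_contra hno
      apply hcon
      have hAe : ∀ j, e ∉ A j := fun j hj => (Finset.disjoint_left.1 (hAR j)) hj he
      apply ih (R.erase e) (Function.update A i (insert e (A i)))
      · rw [Finset.card_erase_of_mem he, hR]; rfl
      · intro j
        by_cases hj : j = i
        · subst hj
          simp only [Function.update_self]
          rw [Finset.disjoint_left]
          intro x hx hx'
          rcases Finset.mem_insert.1 hx with rfl | hx
          · simp at hx'
          · exact Finset.disjoint_left.1 (hAR j) hx (Finset.mem_of_mem_erase hx')
        · simp only [Function.update_of_ne hj]
          exact (hAR j).mono_right (Finset.erase_subset _ _)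
      · intro j k hjk
        by_cases hj : j = i
        · subst hj
          simp only [Function.update_self, Function.update_of_ne hjk.symm]
          rw [Finset.disjoint_insert_left]
          exact ⟨hAe k, hd _ _ hjk⟩
        · by_cases hk : k = i
          · subst hk
            simp only [Function.update_self, Function.update_of_ne hj]
            rw [Finset.disjoint_insert_right]
            exact ⟨hAe j, hd _ _ hjk⟩
          · simp only [Function.update_of_ne hk, Function.update_of_ne hj]
            exact hd _ _ hjk
      · intro X hX
        by_contra hlt
        push Not at hlt
        have hXR : X ⊆ R := hX.trans (Finset.erase_subset _ _)
        have heX : e ∉ X := fun h => by simpa using hX h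
        have hc : ((R \ X).card : ℤ) = ((R.erase e) \ X).card + 1 := by
          have hee : (R.erase e) \ X = (R \ X).erase e := by
            ext x; simp only [Finset.mem_sdiff, Finset.mem_erase]; tauto
          rw [hee, Finset.card_erase_of_mem (by simp [he, heX])]
          have : 0 < (R \ X).card := Finset.card_pos.2 ⟨e, by simp [he, heX]⟩
          omega
        have hle : ∀ j, r j (A j ∪ X) ≤ r j (Function.update A i (insert e (A i)) j ∪ X) := by
          intro j
          apply hmono
          apply Finset.union_subset_union_left
          by_cases hj : j = i
          · subst hj; simp
          · simp [hj]
        have hi := hinv X hXR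
        have hs : ∑ j, (r j Finset.univ - r j (Function.update A i (insert e (A i)) j ∪ X)) +
            (r i (insert e (A i) ∪ X) - r i (A i ∪ X)) ≤
            ∑ j, (r j Finset.univ - r j (A j ∪ X)) := by
          rw [← Finset.add_sum_erase _ _ (Finset.mem_univ i),
            ← Finset.add_sum_erase _ (fun j => r j Finset.univ - r j (A j ∪ X)) (Finset.mem_univ i)]
          have : ∑ j ∈ Finset.univ.erase i, (r j Finset.univ - r j (Function.update A i (insert e (A i)) j ∪ X)) ≤
              ∑ j ∈ Finset.univ.erase i, (r j Finset.univ - r j (A j ∪ X)) := by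
            apply Finset.sum_le_sum; intro j _; linarith [hle j]
          simp only [Function.update_self]
          linarith
        have hle' := hle i
        simp only [Function.update_self] at hle'
        apply hno
        refine ⟨X, hXR, heX, by linarith, ?_⟩
        have : A i ∪ insert e X = insert e (A i) ∪ X := by
          ext x; simp
        rw [this]
        linarith
    choose X hXR heX htight hcl using hbad
    -- union of tight sets
    have hun : ∀ S : Finset ι, S.Nonempty →
        ∑ j, (r j Finset.univ - r j (A j ∪ S.biUnion X)) = ((R \ S.biUnion X).card : ℤ) := by
      intro S hS
      induction hS using Finset.Nonempty.cons_induction with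
      | singleton a => simpa using htight a
      | cons a S ha hS ihS =>
        rw [Finset.cons_eq_insert, Finset.biUnion_insert]
        set Y := S.biUnion X with hY
        have hYR : Y ⊆ R := Finset.biUnion_subset.2 (fun i _ => hXR i)
        have h1 := hinv (X a ∪ Y) (Finset.union_subset (hXR a) hYR)
        have h2 := hinv (X a ∩ Y) (Finset.inter_subset_left.trans (hXR a))
        have h3 : ∑ j, (r j Finset.univ - r j (A j ∪ X a)) + ∑ j, (r j Finset.univ - r j (A j ∪ Y)) ≤
            ∑ j, (r j Finset.univ - r j (A j ∪ (X a ∪ Y))) +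
              ∑ j, (r j Finset.univ - r j (A j ∪ (X a ∩ Y))) := by
          rw [← Finset.sum_add_distrib, ← Finset.sum_add_distrib]
          apply Finset.sum_le_sum
          intro j _
          have := hsub j (A j ∪ X a) (A j ∪ Y)
          rw [← Finset.union_inter_distrib_left, ← Finset.union_union_distrib_left] at this
          linarith
        have h4 : ((R \ (X a ∪ Y)).card : ℤ) + (R \ (X a ∩ Y)).card = (R \ X a).card + (R \ Y).card := by
          have e1 : R \ (X a ∪ Y) = (R \ X a) ∩ (R \ Y) := by ext x; simp; tauto
          have e2 : R \ (X a ∩ Y) = (R \ X a) ∪ (R \ Y) := by ext x; simp; tauto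
          rw [e1, e2]
          have := Finset.card_inter_add_card_union (R \ X a) (R \ Y)
          exact_mod_cast this
        have h5 := htight a
        linarith
    have hX := hun Finset.univ Finset.univ_nonempty
    set Z := Finset.univ.biUnion X with hZ
    have heZ : e ∉ Z := by simp [hZ, heX]
    have hZR : Z ⊆ R := Finset.biUnion_subset.2 (fun i _ => hXR i)
    have hfin := hinv (insert e Z) (Finset.insert_subset he hZR)
    have hr : ∀ i, r i (A i ∪ insert e Z) = r i (A i ∪ Z) := by
      intro i
      apply le_antisymm
      · have h1 := hsub i (A i ∪ insert e (X i)) (A i ∪ Z)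
        have hXZ : X i ⊆ Z := Finset.subset_biUnion_of_mem X (Finset.mem_univ i)
        have e1 : (A i ∪ insert e (X i)) ∪ (A i ∪ Z) = A i ∪ insert e Z := by
          ext x; simp only [Finset.mem_union, Finset.mem_insert]
          have := @hXZ x
          tauto
        rw [e1, hcl i] at h1
        have h2 : r i (A i ∪ X i) ≤ r i ((A i ∪ insert e (X i)) ∩ (A i ∪ Z)) := by
          apply hmono
          intro x hx
          have := @hXZ x
          simp only [Finset.mem_union, Finset.mem_insert, Finset.mem_inter] at *
          tauto
        linarith
      · apply hmono
        intro x hx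
        simp only [Finset.mem_union, Finset.mem_insert] at *
        tauto
    simp only [hr] at hfin
    rw [hX] at hfin
    have : (R \ insert e Z).card < (R \ Z).card := by
      apply Finset.card_lt_card
      refine ⟨Finset.sdiff_subset_sdiff le_rfl (Finset.subset_insert _ _), fun h => ?_⟩
      have := h (show e ∈ R \ Z by simp [he, heZ])
      simp at this
    omega

lemma pack {E ι : Type*} [Fintype E] [Fintype ι] [Nonempty ι] (r : ι → Finset E → ℤ)
    (hmono : ∀ i X Y, X ⊆ Y → r i X ≤ r i Y)
    (hsub : ∀ i X Y, r i (X ∪ Y) + r i (X ∩ Y) ≤ r i X + r i Y)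
    (h : ∀ X, ∑ i, (r i Finset.univ - r i X) ≤ ((Finset.univ \ X).card : ℤ)) :
    ∃ B : ι → Finset E, (∀ i j, i ≠ j → Disjoint (B i) (B j)) ∧
        ∀ i, r i (B i) = r i Finset.univ :=
  pack_aux r hmono hsub _ Finset.univ (fun _ => ∅) rfl (by simp) (by simp) (by simpa using h)

end PD

namespace PD

lemma z2_add_self {V : Type*} (x : V → ZMod 2) : x + x = 0 := by
  funext v; exact CharTwo.add_self_eq_zero _

section
variable {V E : Type} [Fintype V] [Fintype E] (a b : E → V)

/-- the edge `e` crosses the cut `S` -/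
def crossE (S : Finset V) (e : E) : Prop := ¬ (a e ∈ S ↔ b e ∈ S)

noncomputable def vecE (e : E) : V → ZMod 2 := Pi.single (a e) 1 + Pi.single (b e) 1

noncomputable def spE (X : Finset E) : Submodule (ZMod 2) (V → ZMod 2) :=
  Submodule.span (ZMod 2) (vecE a b '' (X : Set E))

noncomputable def rkE (X : Finset E) : ℕ := Module.finrank (ZMod 2) (spE a b X)

lemma spE_mono {X Y : Finset E} (h : X ⊆ Y) : spE a b X ≤ spE a b Y :=
  Submodule.span_mono (Set.image_mono (by exact_mod_cast h))

lemma rkE_mono {X Y : Finset E} (h : X ⊆ Y) : rkE a b X ≤ rkE a b Y :=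
  Submodule.finrank_mono (spE_mono a b h)

lemma rkE_sub (X Y : Finset E) : rkE a b (X ∪ Y) + rkE a b (X ∩ Y) ≤ rkE a b X + rkE a b Y := by
  have h1 : spE a b (X ∪ Y) = spE a b X ⊔ spE a b Y := by
    simp only [spE, Finset.coe_union, Set.image_union, Submodule.span_union]
  have h2 : spE a b (X ∩ Y) ≤ spE a b X ⊓ spE a b Y :=
    le_inf (spE_mono a b Finset.inter_subset_left) (spE_mono a b Finset.inter_subset_right)
  have h3 := Submodule.finrank_sup_add_finrank_inf_eq (spE a b X) (spE a b Y)
  have h4 := Submodule.finrank_mono h2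
  rw [← h1] at h3
  simp only [rkE]
  omega

noncomputable def sumF (S : Finset V) : (V → ZMod 2) →ₗ[ZMod 2] ZMod 2 :=
  ∑ v ∈ S, LinearMap.proj v

lemma sumF_single (S : Finset V) (u : V) : sumF S (Pi.single u 1) = if u ∈ S then 1 else 0 := by
  simp [sumF, Pi.single_apply]

lemma sumF_vecE (S : Finset V) (e : E) : sumF S (vecE a b e) = if crossE a b S e then 1 else 0 := by
  rw [vecE, map_add, sumF_single, sumF_single]
  by_cases h1 : a e ∈ S <;> by_cases h2 : b e ∈ S <;> simp [crossE, h1, h2]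
  decide

lemma rkE_lt [Nonempty V] (X : Finset E) : rkE a b X < Fintype.card V := by
  have : Module.finrank (ZMod 2) (V → ZMod 2) = Fintype.card V := by simp
  rw [← this]
  apply Submodule.finrank_lt
  intro h
  have h1 : spE a b X ≤ LinearMap.ker (sumF (Finset.univ : Finset V)) := by
    rw [spE, Submodule.span_le]
    rintro _ ⟨e, _, rfl⟩
    simp only [SetLike.mem_coe, LinearMap.mem_ker, sumF_vecE]
    simp [crossE]
  rw [h] at h1
  have := h1 (Submodule.mem_top (x := Pi.single (Classical.arbitrary V) 1))
  rw [LinearMap.mem_ker, sumF_single] at this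
  simp at this

/-- connectivity relation by a set of edges -/
def connS (X : Finset E) : Setoid V :=
  EqvGen.setoid (fun u v => ∃ e ∈ X, a e = u ∧ b e = v)

lemma rkE_ge (X : Finset E) :
    Fintype.card V ≤ rkE a b X + Fintype.card (Quotient (connS a b X)) := by
  let f : Quotient (connS a b X) → (V → ZMod 2) := fun C => Pi.single C.out 1
  have hW : spE a b X ⊔ Submodule.span (ZMod 2) (Set.range f) = ⊤ := by
    have h1 : ∀ u v, EqvGen (fun u v => ∃ e ∈ X, a e = u ∧ b e = v) u v →
        (Pi.single u 1 + Pi.single v 1 : V → ZMod 2) ∈ spE a b X := by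
      intro u v h
      induction h with
      | rel u v h =>
        obtain ⟨e, he, rfl, rfl⟩ := h
        exact Submodule.subset_span ⟨e, he, rfl⟩
      | refl u => rw [z2_add_self]; exact Submodule.zero_mem _
      | symm u v _ ih => rw [add_comm]; exact ih
      | trans u v w _ _ ih1 ih2 =>
        have := Submodule.add_mem _ ih1 ih2
        have h' : (Pi.single u 1 + Pi.single v 1 + (Pi.single v 1 + Pi.single w 1) : V → ZMod 2) =
            Pi.single u 1 + Pi.single w 1 := by
          rw [add_assoc, ← add_assoc (Pi.single v 1) (Pi.single v 1), z2_add_self, zero_add]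
        rwa [h'] at this
    have h2 : ∀ v, (Pi.single v 1 : V → ZMod 2) ∈ spE a b X ⊔ Submodule.span (ZMod 2) (Set.range f) := by
      intro v
      have hq : EqvGen (fun u v => ∃ e ∈ X, a e = u ∧ b e = v)
          (Quotient.mk (connS a b X) v).out v := Quotient.exact (Quotient.out_eq (Quotient.mk (connS a b X) v))
      have h3 := h1 _ _ hq
      have h4 : f (Quotient.mk (connS a b X) v) ∈ Submodule.span (ZMod 2) (Set.range f) :=
        Submodule.subset_span ⟨_, rfl⟩
      have h5 := Submodule.add_mem _ (Submodule.mem_sup_right (S := spE a b X) h4)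
        (Submodule.mem_sup_left (T := Submodule.span (ZMod 2) (Set.range f)) h3)
      have h6 : f (Quotient.mk (connS a b X) v) + (Pi.single (Quotient.mk (connS a b X) v).out 1 + Pi.single v 1) = Pi.single v 1 := by
        simp only [f]
        rw [← add_assoc, z2_add_self, zero_add]
      rwa [h6] at h5
    rw [eq_top_iff]
    intro x _
    have : x = ∑ v, x v • (Pi.single v 1 : V → ZMod 2) := by
      ext w; simp [Pi.single_apply]
    rw [this]
    exact Submodule.sum_mem _ (fun v _ => Submodule.smul_mem _ _ (h2 v))
  have h1 := Submodule.finrank_add_le_finrank_add_finrank (spE a b X) (Submodule.span (ZMod 2) (Set.range f))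
  rw [hW, finrank_top] at h1
  have h2 : Module.finrank (ZMod 2) (Submodule.span (ZMod 2) (Set.range f)) ≤ _ := finrank_range_le_card f
  simp only [Module.finrank_fintype_fun_eq_card] at h1
  simp only [rkE]
  omega

lemma rkE_cross {X : Finset E} (h : rkE a b X = rkE a b Finset.univ) (S : Finset V)
    (hS : ∃ e, crossE a b S e) : ∃ e ∈ X, crossE a b S e := by
  have h1 : spE a b X = spE a b Finset.univ :=
    Submodule.eq_of_le_of_finrank_eq (spE_mono a b (Finset.subset_univ _)) h
  by_contra hcon
  push Not at hcon
  have h2 : spE a b X ≤ LinearMap.ker (sumF S) := by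
    rw [spE, Submodule.span_le]
    rintro _ ⟨e, he, rfl⟩
    simp only [SetLike.mem_coe, LinearMap.mem_ker, sumF_vecE]
    rw [if_neg (hcon e he)]
  obtain ⟨e, he⟩ := hS
  have h3 : vecE a b e ∈ spE a b Finset.univ := Submodule.subset_span ⟨e, by simp, rfl⟩
  rw [← h1] at h3
  have := h2 h3
  rw [LinearMap.mem_ker, sumF_vecE, if_pos he] at this
  simp at this

/-- the counting condition -/
lemma pack_cond [Nontrivial V] (hab : ∀ e, a e ≠ b e)
    (hcut : ∀ S : Finset V, S.Nonempty → S ≠ Finset.univ →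
      12 ≤ (Finset.univ.filter (fun e => crossE a b S e)).card)
    (q : V → ℕ) (hq : ∀ v, 4 * q v ≤ (Finset.univ.filter (fun e => crossE a b {v} e)).card)
    (hd : ∀ v, 20 ≤ (Finset.univ.filter (fun e => crossE a b {v} e)).card) (X : Finset E) :
    5 * (rkE a b Finset.univ - rkE a b X) +
      ∑ v, (if ∃ e ∈ X, a e = v ∨ b e = v then 0 else q v) ≤ (Finset.univ \ X).card := by
  have hrk := rkE_lt a b Finset.univ
  have hge := rkE_ge a b X
  set c := Fintype.card (Quotient (connS a b X)) with hc
  let cl : Quotient (connS a b X) → Finset V := fun C => Finset.univ.filter (fun v => Quotient.mk _ v = C)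
  have hX : ∀ C, ∀ e ∈ X, ¬ crossE a b (cl C) e := by
    intro C e he
    have : Quotient.mk (connS a b X) (a e) = Quotient.mk (connS a b X) (b e) :=
      Quotient.sound (EqvGen.rel _ _ ⟨e, he, rfl, rfl⟩)
    simp [crossE, cl, this]
  have hdc : ∑ C, (Finset.univ.filter (fun e => crossE a b (cl C) e)).card ≤ 2 * (Finset.univ \ X).card := by
    have h1 : ∀ C, (Finset.univ.filter (fun e => crossE a b (cl C) e)).card =
        ∑ e ∈ Finset.univ \ X, if crossE a b (cl C) e then 1 else 0 := by
      intro C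
      rw [← Finset.sum_filter, ← Finset.card_eq_sum_ones]
      congr 1
      ext e
      simp only [Finset.mem_filter, Finset.mem_univ, true_and, Finset.mem_sdiff]
      exact ⟨fun h => ⟨fun he => hX C e he h, h⟩, fun h => h.2⟩
    simp only [h1]
    rw [Finset.sum_comm, mul_comm, ← smul_eq_mul]
    apply Finset.sum_le_card_nsmul
    intro e _
    rw [← Finset.sum_filter, ← Finset.card_eq_sum_ones]
    refine le_trans (Finset.card_le_card (t := {Quotient.mk _ (a e), Quotient.mk _ (b e)}) ?_) Finset.card_le_two
    intro C hC
    simp only [crossE, cl, Finset.mem_filter, Finset.mem_univ, true_and, Finset.mem_insert, Finset.mem_singleton] at hC ⊢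
    by_contra h
    push Not at h
    apply hC
    exact ⟨fun h' => absurd h'.symm h.1, fun h' => absurd h'.symm h.2⟩
  by_cases hc1 : c ≤ 1
  · have h0 : ∀ v, ∃ e ∈ X, a e = v ∨ b e = v := by
      intro v
      obtain ⟨w, hw⟩ := exists_ne v
      have hsub : Subsingleton (Quotient (connS a b X)) := Fintype.card_le_one_iff_subsingleton.1 hc1
      have hvw : EqvGen (fun u v => ∃ e ∈ X, a e = u ∧ b e = v) w v :=
        Quotient.exact (s := connS a b X) (Subsingleton.elim _ _)
      by_contra hcon
      push Not at hcon
      have : ∀ x y, EqvGen (fun u v => ∃ e ∈ X, a e = u ∧ b e = v) x y → (x = v ↔ y = v) := by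
        intro x y h
        induction h with
        | rel x y h =>
          obtain ⟨e, he, rfl, rfl⟩ := h
          have := hcon e he
          tauto
        | refl => rfl
        | symm _ _ _ ih => exact ih.symm
        | trans _ _ _ _ _ ih1 ih2 => exact ih1.trans ih2
      exact hw ((this w v hvw).2 rfl)
    have : ∑ v, (if ∃ e ∈ X, a e = v ∨ b e = v then 0 else q v) = 0 := by
      apply Finset.sum_eq_zero; intro v _; rw [if_pos (h0 v)]
    rw [this]
    have : rkE a b Finset.univ - rkE a b X = 0 := by omega
    rw [this]; omega
  push Not at hc1
  -- each component
  have hcomp : ∀ C, 10 + 2 * (∑ v ∈ cl C, (if ∃ e ∈ X, a e = v ∨ b e = v then 0 else q v)) ≤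
      (Finset.univ.filter (fun e => crossE a b (cl C) e)).card := by
    intro C
    by_cases hiso : ∃ v ∈ cl C, ¬ ∃ e ∈ X, a e = v ∨ b e = v
    · obtain ⟨v, hv, hvi⟩ := hiso
      have hclv : cl C = {v} := by
        ext w
        rw [Finset.mem_singleton]
        refine ⟨fun hw => ?_, fun hw => hw ▸ hv⟩
        simp only [cl, Finset.mem_filter, Finset.mem_univ, true_and] at hv hw
        have hvw : EqvGen (fun u v => ∃ e ∈ X, a e = u ∧ b e = v) w v :=
          Quotient.exact (s := connS a b X) (hw.trans hv.symm)
        push Not at hvi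
        have : ∀ x y, EqvGen (fun u v => ∃ e ∈ X, a e = u ∧ b e = v) x y → (x = v ↔ y = v) := by
          intro x y h
          induction h with
          | rel x y h =>
            obtain ⟨e, he, rfl, rfl⟩ := h
            have := hvi e he
            tauto
          | refl => rfl
          | symm _ _ _ ih => exact ih.symm
          | trans _ _ _ _ _ ih1 ih2 => exact ih1.trans ih2
        exact (this w v hvw).2 rfl
      rw [hclv, Finset.sum_singleton, if_neg hvi]
      have := hq v
      have := hd v
      omega
    · push Not at hiso
      have : ∑ v ∈ cl C, (if ∃ e ∈ X, a e = v ∨ b e = v then 0 else q v) = 0 := by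
        apply Finset.sum_eq_zero; intro v hv; rw [if_pos (hiso v hv)]
      rw [this]
      have h1 : (cl C).Nonempty := ⟨C.out, by simp [cl]⟩
      have h2 : cl C ≠ Finset.univ := by
        intro h
        obtain ⟨C', hC'⟩ := Fintype.exists_ne_of_one_lt_card hc1 C
        have : C'.out ∈ cl C := by rw [h]; simp
        simp [cl] at this
        exact hC' this
      have := hcut _ h1 h2
      omega
  have hsum := Finset.sum_le_sum (fun C (_ : C ∈ Finset.univ) => hcomp C)
  rw [Finset.sum_add_distrib, ← Finset.mul_sum] at hsum
  have hpart : ∑ C, ∑ v ∈ cl C, (if ∃ e ∈ X, a e = v ∨ b e = v then 0 else q v) =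
      ∑ v, (if ∃ e ∈ X, a e = v ∨ b e = v then 0 else q v) :=
    Finset.sum_fiberwise _ _ _
  rw [hpart] at hsum
  simp only [Finset.sum_const, smul_eq_mul, Finset.card_univ, ← hc] at hsum
  omega

lemma graph_pack [Nontrivial V] (hab : ∀ e, a e ≠ b e)
    (hcut : ∀ S : Finset V, S.Nonempty → S ≠ Finset.univ →
      12 ≤ (Finset.univ.filter (fun e => crossE a b S e)).card)
    (K : ℕ) (s : V → ℕ)
    (hq : ∀ v, 4 * (K * s v) ≤ (Finset.univ.filter (fun e => crossE a b {v} e)).card)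
    (hd : ∀ v, 20 ≤ (Finset.univ.filter (fun e => crossE a b {v} e)).card) :
    ∃ (T : Fin 5 → Finset E) (D : Fin K → V → Finset E),
      (∀ i S, S.Nonempty → S ≠ Finset.univ → ∃ e ∈ T i, crossE a b S e) ∧
      (∀ k v, (D k v).card = s v) ∧
      (∀ k v, ∀ e ∈ D k v, a e = v ∨ b e = v) ∧
      (∀ i j, i ≠ j → Disjoint (T i) (T j)) ∧
      (∀ i k v, Disjoint (T i) (D k v)) ∧
      (∀ k v k' v', (k, v) ≠ (k', v') → Disjoint (D k v) (D k' v')) := by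
  let ι := Fin 5 ⊕ (Σ _ : Fin K, Σ v : V, Fin (s v))
  let r : ι → Finset E → ℤ := fun i X => match i with
    | Sum.inl _ => rkE a b X
    | Sum.inr ⟨_, v, _⟩ => if ∃ e ∈ X, a e = v ∨ b e = v then 1 else 0
  have hex : ∀ v, ∃ e, a e = v ∨ b e = v := by
    intro v
    have := hd v
    obtain ⟨e, he⟩ := Finset.card_pos.1 (show 0 < (Finset.univ.filter (fun e => crossE a b {v} e)).card by omega)
    simp [crossE] at he
    exact ⟨e, by tauto⟩
  obtain ⟨B, hB1, hB2⟩ := pack (ι := ι) r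
    (by
      rintro (i | ⟨k, v, j⟩) X Y h
      · simp only [r]; exact_mod_cast rkE_mono a b h
      · simp only [r]
        by_cases h1 : ∃ e ∈ X, a e = v ∨ b e = v
        · have h2 : ∃ e ∈ Y, a e = v ∨ b e = v := by
            obtain ⟨e, he, h'⟩ := h1; exact ⟨e, h he, h'⟩
          rw [if_pos h1, if_pos h2]
        · rw [if_neg h1]; split_ifs <;> simp)
    (by
      rintro (i | ⟨k, v, j⟩) X Y
      · simp only [r]; exact_mod_cast rkE_sub a b X Y
      · simp only [r]
        by_cases h1 : ∃ e ∈ X, a e = v ∨ b e = v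
        · by_cases h2 : ∃ e ∈ Y, a e = v ∨ b e = v
          · rw [if_pos h1, if_pos h2]; split_ifs <;> simp
          · have h3 : ¬ ∃ e ∈ X ∩ Y, a e = v ∨ b e = v := by
              rintro ⟨e, he, h⟩; exact h2 ⟨e, Finset.mem_of_mem_inter_right he, h⟩
            rw [if_pos h1, if_neg h2, if_neg h3]; split_ifs <;> simp
        · have h3 : ¬ ∃ e ∈ X ∩ Y, a e = v ∨ b e = v := by
              rintro ⟨e, he, h⟩; exact h1 ⟨e, Finset.mem_of_mem_inter_left he, h⟩
          rw [if_neg h1, if_neg h3]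
          by_cases h2 : ∃ e ∈ Y, a e = v ∨ b e = v
          · rw [if_pos h2]; split_ifs <;> simp
          · have h4 : ¬ ∃ e ∈ X ∪ Y, a e = v ∨ b e = v := by
              rintro ⟨e, he, h⟩
              rcases Finset.mem_union.1 he with he | he
              · exact h1 ⟨e, he, h⟩
              · exact h2 ⟨e, he, h⟩
            rw [if_neg h2, if_neg h4])
    (by
      intro X
      have h := pack_cond a b hab hcut (fun v => K * s v) hq hd X
      have hm := rkE_mono a b (Finset.subset_univ X)
      rw [Fintype.sum_sum_type]
      simp only [r]
      rw [Finset.sum_const, Finset.card_univ, Fintype.card_fin]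
      have h2 : ∑ x : (Σ _ : Fin K, Σ v : V, Fin (s v)),
          ((if ∃ e ∈ (Finset.univ : Finset E), a e = x.2.1 ∨ b e = x.2.1 then (1:ℤ) else 0) -
            (if ∃ e ∈ X, a e = x.2.1 ∨ b e = x.2.1 then 1 else 0)) =
          ((∑ v, (if ∃ e ∈ X, a e = v ∨ b e = v then 0 else K * s v) : ℕ) : ℤ) := by
        obtain ⟨F, hF⟩ : ∃ F : V → ℤ, ∀ v, F v = if ∃ e ∈ X, a e = v ∨ b e = v then 0 else 1 :=
          ⟨_, fun _ => rfl⟩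
        have h1 : ∀ x : (Σ _ : Fin K, Σ v : V, Fin (s v)),
          ((if ∃ e ∈ (Finset.univ : Finset E), a e = x.2.1 ∨ b e = x.2.1 then (1:ℤ) else 0) -
            (if ∃ e ∈ X, a e = x.2.1 ∨ b e = x.2.1 then 1 else 0)) = F x.2.1 := by
          intro x
          have : ∃ e ∈ (Finset.univ : Finset E), a e = x.2.1 ∨ b e = x.2.1 := by
            obtain ⟨e, he⟩ := hex x.2.1; exact ⟨e, by simp, he⟩
          rw [if_pos this, hF]
          split_ifs <;> simp
        rw [Finset.sum_congr rfl (fun x _ => h1 x)]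
        rw [Fintype.sum_sigma]
        simp only [Fintype.sum_sigma, Finset.sum_const, Finset.card_univ, Fintype.card_fin]
        rw [Finset.smul_sum, Nat.cast_sum]
        apply Finset.sum_congr rfl
        intro v _
        rw [hF]
        split_ifs <;> simp
      have h3 : (5 • ((rkE a b Finset.univ : ℤ) - rkE a b X)) =
        ((5 * (rkE a b Finset.univ - rkE a b X) : ℕ) : ℤ) := by
        push_cast [hm]; simp
      rw [h3]
      refine le_trans (le_of_eq ?_) (Nat.cast_le.2 h)
      rw [Nat.cast_add]
      congr 1)
  have hslot : ∀ (k : Fin K) (v : V) (j : Fin (s v)), ∃ e ∈ B (Sum.inr ⟨k, v, j⟩), a e = v ∨ b e = v := by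
    intro k v j
    have := hB2 (Sum.inr ⟨k, v, j⟩)
    simp only [r] at this
    have h1 : ∃ e ∈ (Finset.univ : Finset E), a e = v ∨ b e = v := by
      obtain ⟨e, he⟩ := hex v; exact ⟨e, by simp, he⟩
    rw [if_pos h1] at this
    by_contra h
    rw [if_neg h] at this
    simp at this
  choose g hg1 hg2 using hslot
  have hgi : ∀ k v j k' v' j', g k v j = g k' v' j' → (⟨k, v, j⟩ : Σ _ : Fin K, Σ v : V, Fin (s v)) = ⟨k', v', j'⟩ := by
    intro k v j k' v' j' h
    by_contra hne
    have hd := hB1 (Sum.inr ⟨k, v, j⟩) (Sum.inr ⟨k', v', j'⟩) (fun h => hne (Sum.inr.inj h))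
    exact Finset.disjoint_left.1 hd (hg1 k v j) (h ▸ hg1 k' v' j')
  refine ⟨fun i => B (Sum.inl i), fun k v => Finset.univ.image (g k v), ?_, ?_, ?_, ?_, ?_, ?_⟩
  · intro i S hS hS'
    apply rkE_cross
    · have := hB2 (Sum.inl i)
      simp only [r] at this
      exact_mod_cast this
    · have := hcut S hS hS'
      obtain ⟨e, he⟩ := Finset.card_pos.1 (show 0 < (Finset.univ.filter (fun e => crossE a b S e)).card by omega)
      exact ⟨e, by simpa using he⟩
  · intro k v
    rw [Finset.card_image_of_injective]
    · simp
    · intro j j' h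
      have := hgi _ _ _ _ _ _ h
      simpa using this
  · intro k v e he
    obtain ⟨j, _, rfl⟩ := Finset.mem_image.1 he
    exact hg2 k v j
  · intro i j hij
    exact hB1 _ _ (fun h => hij (Sum.inl.inj h))
  · intro i k v
    rw [Finset.disjoint_left]
    intro e he he'
    obtain ⟨j, _, rfl⟩ := Finset.mem_image.1 he'
    exact Finset.disjoint_left.1 (hB1 (Sum.inl i) (Sum.inr ⟨k, v, j⟩) (by simp)) he (hg1 k v j)
  · intro k v k' v' hne
    rw [Finset.disjoint_left]
    intro e he he'
    obtain ⟨j, _, rfl⟩ := Finset.mem_image.1 he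
    obtain ⟨j', _, h⟩ := Finset.mem_image.1 he'
    have := hgi _ _ _ _ _ _ h
    apply hne
    simp at this
    rw [this.1, this.2.1]

end
end PD

namespace PD

noncomputable def dg {V : Type} [Fintype V] (G : SimpleGraph V) (v : V) : ℕ :=
  (Finset.univ.filter (fun w => G.Adj v w)).card

lemma maxcut {V : Type} [Fintype V] (G : SimpleGraph V) :
    ∃ col : V → Bool, ∀ S : Finset V,
      (Finset.univ.filter (fun p : V × V => G.Adj p.1 p.2 ∧ p.1 ∈ S ∧ p.2 ∉ S)).card ≤
      2 * (Finset.univ.filter (fun p : V × V => (G.Adj p.1 p.2 ∧ col p.1 = true ∧ col p.2 = false) ∧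
        ¬ (p.1 ∈ S ↔ p.2 ∈ S))).card := by
  obtain ⟨col, _, hcol⟩ := Finset.exists_max_image (Finset.univ : Finset (V → Bool))
    (fun col => (Finset.univ.filter (fun p : V × V => G.Adj p.1 p.2 ∧ col p.1 ≠ col p.2)).card)
    Finset.univ_nonempty
  refine ⟨col, fun S => ?_⟩
  let col' : V → Bool := fun v => if v ∈ S then !(col v) else col v
  have h1 := hcol col' (Finset.mem_univ _)
  have hsplit : ∀ c : V → Bool,
      (Finset.univ.filter (fun p : V × V => G.Adj p.1 p.2 ∧ c p.1 ≠ c p.2)).card =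
      (Finset.univ.filter (fun p : V × V => G.Adj p.1 p.2 ∧ c p.1 ≠ c p.2 ∧ (p.1 ∈ S ↔ p.2 ∈ S))).card +
      (Finset.univ.filter (fun p : V × V => G.Adj p.1 p.2 ∧ c p.1 ≠ c p.2 ∧ ¬(p.1 ∈ S ↔ p.2 ∈ S))).card := by
    intro c
    rw [← Finset.card_union_of_disjoint]
    · congr 1; ext p; simp only [Finset.mem_filter, Finset.mem_univ, true_and, Finset.mem_union]; tauto
    · rw [Finset.disjoint_left]; intro p; simp only [Finset.mem_filter, Finset.mem_univ, true_and]; tauto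
  rw [hsplit, hsplit] at h1
  have h2 : (Finset.univ.filter (fun p : V × V => G.Adj p.1 p.2 ∧ col' p.1 ≠ col' p.2 ∧ (p.1 ∈ S ↔ p.2 ∈ S))) =
      (Finset.univ.filter (fun p : V × V => G.Adj p.1 p.2 ∧ col p.1 ≠ col p.2 ∧ (p.1 ∈ S ↔ p.2 ∈ S))) := by
    ext ⟨u, v⟩
    simp only [Finset.mem_filter, Finset.mem_univ, true_and, col']
    by_cases hu : u ∈ S <;> by_cases hv : v ∈ S <;> simp [hu, hv]
  have h3 : (Finset.univ.filter (fun p : V × V => G.Adj p.1 p.2 ∧ col' p.1 ≠ col' p.2 ∧ ¬(p.1 ∈ S ↔ p.2 ∈ S))) =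
      (Finset.univ.filter (fun p : V × V => G.Adj p.1 p.2 ∧ col p.1 = col p.2 ∧ ¬(p.1 ∈ S ↔ p.2 ∈ S))) := by
    ext ⟨u, v⟩
    simp only [Finset.mem_filter, Finset.mem_univ, true_and, col']
    by_cases hu : u ∈ S <;> by_cases hv : v ∈ S <;> simp [hu, hv]
  rw [h2, h3] at h1
  set P := (Finset.univ.filter (fun p : V × V => G.Adj p.1 p.2 ∧ p.1 ∈ S ∧ p.2 ∉ S)) with hP
  set Mo := (Finset.univ.filter (fun p : V × V => G.Adj p.1 p.2 ∧ col p.1 = col p.2 ∧ ¬(p.1 ∈ S ↔ p.2 ∈ S))) with hMo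
  set Bi := (Finset.univ.filter (fun p : V × V => G.Adj p.1 p.2 ∧ col p.1 ≠ col p.2 ∧ ¬(p.1 ∈ S ↔ p.2 ∈ S))) with hBi
  set C := (Finset.univ.filter (fun p : V × V => (G.Adj p.1 p.2 ∧ col p.1 = true ∧ col p.2 = false) ∧
        ¬ (p.1 ∈ S ↔ p.2 ∈ S))) with hC
  have h4 : P.card + P.card ≤ Mo.card + Bi.card := by
    have hsw : (P.image Prod.swap).card = P.card := Finset.card_image_of_injective _ Prod.swap_injective
    calc P.card + P.card = P.card + (P.image Prod.swap).card := by rw [hsw]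
      _ = (P ∪ P.image Prod.swap).card := by
        rw [Finset.card_union_of_disjoint]
        rw [Finset.disjoint_left]
        rintro ⟨u, v⟩ h h'
        simp [hP] at h h'
        tauto
      _ ≤ (Mo ∪ Bi).card := by
        apply Finset.card_le_card
        rintro ⟨u, v⟩ h
        simp [hP, hMo, hBi, G.adj_comm v u] at h ⊢
        tauto
      _ ≤ _ := Finset.card_union_le _ _
  have h5 : Bi.card ≤ 2 * C.card := by
    have hsw : (C.image Prod.swap).card ≤ C.card := Finset.card_image_le
    calc Bi.card ≤ (C ∪ C.image Prod.swap).card := by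
          apply Finset.card_le_card
          rintro ⟨u, v⟩ h
          simp [hC, hBi, G.adj_comm v u] at h ⊢
          have h2 := h.2.1
          have : (col u = true ∧ col v = false) ∨ (col v = true ∧ col u = false) := by
            revert h2; cases col u <;> cases col v <;> simp
          tauto
      _ ≤ C.card + (C.image Prod.swap).card := Finset.card_union_le _ _
      _ ≤ _ := by omega
  omega

lemma edgeConn_cut {V : Type} [Fintype V] (G : SimpleGraph V) (hG : EdgeConn G 24) (S : Finset V)
    (hS : S.Nonempty) (hS' : S ≠ Finset.univ) :
    24 ≤ (Finset.univ.filter (fun p : V × V => G.Adj p.1 p.2 ∧ p.1 ∈ S ∧ p.2 ∉ S)).card := by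
  by_contra hlt
  push Not at hlt
  obtain ⟨u, hu⟩ := hS
  obtain ⟨v, hv⟩ : ∃ v, v ∉ S := by
    by_contra h; push Not at h; exact hS' (Finset.eq_univ_iff_forall.2 h)
  have := hG ((Finset.univ.filter (fun p : V × V => G.Adj p.1 p.2 ∧ p.1 ∈ S ∧ p.2 ∉ S)).image
    (fun p => s(p.1, p.2))) (lt_of_le_of_lt Finset.card_image_le hlt) u v
  apply hv
  clear hv
  induction this with
  | refl => exact hu
  | tail _ h ih =>
    rename_i b c _
    by_contra hc
    apply h.2
    rw [Finset.mem_image]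
    exact ⟨(b, c), by simp [h.1, ih, hc], rfl⟩

lemma exists_parent {V : Type} [Fintype V] (H : SimpleGraph V) (r : V)
    (hH : ∀ S : Finset V, S.Nonempty → S ≠ Finset.univ → ∃ u v, u ∈ S ∧ v ∉ S ∧ H.Adj u v) :
    ∃ (f : V → V) (h : V → ℕ), ∀ v, v ≠ r → H.Adj v (f v) ∧ h (f v) < h v := by
  have hreach : ∀ v, H.Reachable v r := by
    by_contra hcon
    push Not at hcon
    obtain ⟨x, hx⟩ := hcon
    obtain ⟨u, v, hu, hv, huv⟩ := hH (Finset.univ.filter (fun v => H.Reachable v r)) ⟨r, by simp⟩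
      (fun h => by
        have : x ∈ Finset.univ.filter (fun v => H.Reachable v r) := by rw [h]; simp
        simp at this; exact hx this)
    simp at hu hv
    exact hv (huv.symm.reachable.trans hu)
  have : ∀ v, ∃ w, v ≠ r → H.Adj v w ∧ H.dist w r < H.dist v r := by
    intro v
    by_cases hv : v = r
    · exact ⟨v, fun h => absurd hv h⟩
    · obtain ⟨p, hp⟩ := (hreach v).exists_walk_length_eq_dist
      cases p with
      | nil => exact absurd rfl hv
      | cons h q =>
        rename_i w
        refine ⟨w, fun _ => ⟨h, ?_⟩⟩
        have := SimpleGraph.dist_le q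
        simp at hp
        omega
  choose f hf using this
  exact ⟨f, fun v => H.dist v r, hf⟩

theorem struct {V : Type} [Fintype V] [Nontrivial V] (G : SimpleGraph V) (hG : EdgeConn G 24)
    (hd : ∀ v, 40 ≤ dg G v) (K : ℕ) (s : V → ℕ) (hs : ∀ v, 8 * (K * s v) ≤ dg G v) (root : Fin 5 → V) :
    ∃ (col : V → Bool) (Out : ℕ → V → Finset V) (f : Fin 5 → V → V) (h : Fin 5 → V → ℕ),
      (∀ k v w, w ∈ Out k v → G.Adj v w ∧ col v ≠ col w) ∧
      (∀ k < K, ∀ v, (Out k v).card = s v) ∧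
      (∀ k k' v v' w w', w ∈ Out k v → w' ∈ Out k' v' → s(v, w) = s(v', w') → k = k' ∧ v = v') ∧
      (∀ i v, v ≠ root i → G.Adj v (f i v) ∧ col v ≠ col (f i v) ∧ h i (f i v) < h i v) ∧
      (∀ i k v v' w, v ≠ root i → w ∈ Out k v' → s(v, f i v) ≠ s(v', w)) ∧
      (∀ i j v w, i ≠ j → v ≠ root i → w ≠ root j → s(v, f i v) ≠ s(w, f j w)) := by
  obtain ⟨col, hcol⟩ := maxcut G
  let E := {p : V × V // G.Adj p.1 p.2 ∧ col p.1 = true ∧ col p.2 = false}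
  let a : E → V := fun e => e.1.1
  let b : E → V := fun e => e.1.2
  have hcard : ∀ S : Finset V, (Finset.univ.filter (fun e => crossE a b S e)).card =
      (Finset.univ.filter (fun p : V × V => (G.Adj p.1 p.2 ∧ col p.1 = true ∧ col p.2 = false) ∧
        ¬ (p.1 ∈ S ↔ p.2 ∈ S))).card := by
    intro S
    apply Finset.card_bij (fun e _ => e.1)
    · intro e he
      exact Finset.mem_filter.2 ⟨Finset.mem_univ _, e.2, (Finset.mem_filter.1 he).2⟩
    · intro e _ e' _ h; exact Subtype.ext h
    · intro p hp
      simp only [Finset.mem_filter, Finset.mem_univ, true_and] at hp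
      exact ⟨⟨p, hp.1⟩, Finset.mem_filter.2 ⟨Finset.mem_univ _, hp.2⟩, rfl⟩
  have hdeg : ∀ v, dg G v ≤ 2 * (Finset.univ.filter (fun e => crossE a b {v} e)).card := by
    intro v
    rw [hcard]
    refine le_trans ?_ (hcol {v})
    apply Finset.card_le_card_of_injOn (fun w => (v, w))
    · intro w hw
      simp at hw ⊢
      exact ⟨hw, hw.ne'⟩
    · intro w _ w' _ h; simpa using h
  obtain ⟨T, D, h1, h2, h3, h4, h5, h6⟩ := graph_pack a b (fun e => e.2.1.ne)
    (fun S hS hS' => by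
      have := hcol S
      have := edgeConn_cut G hG S hS hS'
      rw [hcard]
      omega) K s
    (fun v => by have := hdeg v; have := hs v; omega)
    (fun v => by have := hdeg v; have := hd v; omega)
  -- other endpoint
  let oth : V → E → V := fun v e => if a e = v then b e else a e
  have hoth : ∀ k v, ∀ e ∈ D k v, s(v, oth v e) = s(a e, b e) := by
    intro k v e he
    rcases h3 k v e he with h | h
    · simp [oth, h]
    · by_cases h' : a e = v
      · simp [oth, h']
      · simp [oth, h', h, Sym2.eq_swap]
  have hEinj : ∀ e e' : E, s(a e, b e) = s(a e', b e') → e = e' := by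
    intro e e' h
    rw [Sym2.eq_iff] at h
    rcases h with ⟨h1, h2⟩ | ⟨h1, h2⟩
    · exact Subtype.ext (Prod.ext h1 h2)
    · have h3 := e.2.2.1
      have h4 := e'.2.2.2
      change col (a e) = true at h3
      change col (b e') = false at h4
      rw [h1, h4] at h3
      simp at h3
  have hEadj : ∀ (e : E) u v, s(u, v) = s(a e, b e) → G.Adj u v ∧ col u ≠ col v := by
    intro e u v h
    have e1 : G.Adj (a e) (b e) := e.2.1
    have e2 : col (a e) = true := e.2.2.1
    have e3 : col (b e) = false := e.2.2.2
    rw [Sym2.eq_iff] at h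
    rcases h with ⟨rfl, rfl⟩ | ⟨rfl, rfl⟩
    · exact ⟨e1, by rw [e2, e3]; simp⟩
    · exact ⟨e1.symm, by rw [e2, e3]; simp⟩
  let Out : ℕ → V → Finset V := fun k v => if hk : k < K then (D ⟨k, hk⟩ v).image (oth v) else ∅
  have hOut : ∀ k v w, w ∈ Out k v → ∃ hk : k < K, ∃ e ∈ D ⟨k, hk⟩ v, s(v, w) = s(a e, b e) := by
    intro k v w hw
    by_cases hk : k < K
    · simp only [Out, hk, dif_pos, Finset.mem_image] at hw
      obtain ⟨e, he, rfl⟩ := hw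
      exact ⟨hk, e, he, hoth _ _ _ he⟩
    · simp [Out, hk] at hw
  have htree : ∀ i, ∃ (f : V → V) (h : V → ℕ), ∀ v, v ≠ root i →
      (∃ e ∈ T i, s(v, f v) = s(a e, b e)) ∧ h (f v) < h v := by
    intro i
    let H : SimpleGraph V := SimpleGraph.mk (fun u v => ∃ e ∈ T i, s(u, v) = s(a e, b e))
      ⟨by rintro u v ⟨e, he, h⟩; exact ⟨e, he, by rw [← h, Sym2.eq_swap]⟩⟩
      ⟨by rintro u ⟨e, he, h⟩; exact G.loopless.irrefl _ (hEadj e u u h).1⟩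
    obtain ⟨f, h, hf⟩ := exists_parent H (root i) (by
      intro S hS hS'
      obtain ⟨e, he, hc⟩ := h1 i S hS hS'
      by_cases ha : a e ∈ S
      · have hb : b e ∉ S := fun hb => hc ⟨fun _ => hb, fun _ => ha⟩
        exact ⟨_, _, ha, hb, e, he, rfl⟩
      · have hb : b e ∈ S := by
          by_contra hb; exact hc ⟨fun h => absurd h ha, fun h => absurd h hb⟩
        exact ⟨_, _, hb, ha, e, he, Sym2.eq_swap⟩)
    exact ⟨f, h, hf⟩
  choose f h hf using htree
  refine ⟨col, Out, f, h, ?_, ?_, ?_, ?_, ?_, ?_⟩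
  · intro k v w hw
    obtain ⟨_, e, _, he⟩ := hOut k v w hw
    exact hEadj e v w he
  · intro k hk v
    simp only [Out, hk, dif_pos]
    rw [Finset.card_image_of_injOn, h2]
    intro e he e' he' hee
    apply hEinj
    rw [← hoth _ _ _ he, ← hoth _ _ _ he', hee]
  · intro k k' v v' w w' hw hw' hs
    obtain ⟨hk, e, he, hse⟩ := hOut k v w hw
    obtain ⟨hk', e', he', hse'⟩ := hOut k' v' w' hw'
    have hee : e = e' := hEinj _ _ (by rw [← hse, ← hse', hs])
    subst hee
    by_contra hne
    refine Finset.disjoint_left.1 (h6 ⟨k, hk⟩ v ⟨k', hk'⟩ v' ?_) he he'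
    intro h
    simp at h
    exact hne h
  · intro i v hv
    obtain ⟨⟨e, he, hse⟩, hlt⟩ := hf i v hv
    obtain ⟨h1, h2⟩ := hEadj e _ _ hse
    exact ⟨h1, h2, hlt⟩
  · intro i k v v' w hv hw hs
    obtain ⟨⟨e, he, hse⟩, hlt⟩ := hf i v hv
    obtain ⟨hk', e', he', hse'⟩ := hOut k v' w hw
    have hee : e = e' := hEinj _ _ (by rw [← hse, ← hse', hs])
    subst hee
    exact Finset.disjoint_left.1 (h5 i ⟨k, hk'⟩ v') he he'
  · intro i j v w hij hv hw hs
    obtain ⟨⟨e, he, hse⟩, hlt⟩ := hf i v hv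
    obtain ⟨⟨e', he', hse'⟩, hlt⟩ := hf j w hw
    have hee : e = e' := hEinj _ _ (by rw [← hse, ← hse', hs])
    subst hee
    exact Finset.disjoint_left.1 (h4 i j hij) he he'

end PD

namespace PD

/-- a family of edges is connected (spanning `V`). -/
def Cn {V ι : Type} (a b : ι → V) : Prop :=
  ∀ S : V → Prop, (∀ i, S (a i) ↔ S (b i)) → ∀ u v, S u → S v

lemma te_one {V ι : Type} (a b : ι → V) (i0 : ι) (u : V) (h : Cn a b) :
    ∃ c, (c = a i0 ∨ c = b i0) ∧ Cn (Function.update a i0 c) (Function.update b i0 u) := by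
  by_contra hcon
  push Not at hcon
  have key : ∀ c, ¬ Cn (Function.update a i0 c) (Function.update b i0 u) →
      ∃ S : V → Prop, (∀ i, i ≠ i0 → (S (a i) ↔ S (b i))) ∧ S c ∧ S u ∧ ∃ y, ¬ S y := by
    intro c hc
    simp only [Cn] at hc
    push Not at hc
    obtain ⟨S, hS, x, y, hx, hy⟩ := hc
    have h0 := hS i0
    simp only [Function.update_self] at h0
    have hS' : ∀ i, i ≠ i0 → (S (a i) ↔ S (b i)) := by
      intro i hi
      have := hS i
      simpa [Function.update_of_ne hi] using this
    by_cases hc : S c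
    · exact ⟨S, hS', hc, h0.1 hc, y, hy⟩
    · exact ⟨fun z => ¬ S z, fun i hi => not_congr (hS' i hi), hc, fun hu => hc (h0.2 hu), x, not_not.2 hx⟩
  obtain ⟨S1, h1, h1a, h1u, y1, hy1⟩ := key _ (hcon (a i0) (Or.inl rfl))
  obtain ⟨S2, h2, h2b, h2u, y2, hy2⟩ := key _ (hcon (b i0) (Or.inr rfl))
  have hb : ¬ S1 (b i0) := by
    intro hb
    exact hy1 (h S1 (fun i => by
      by_cases hi : i = i0
      · subst hi; tauto
      · exact h1 i hi) _ _ h1u)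
  have ha : ¬ S2 (a i0) := by
    intro hb
    exact hy2 (h S2 (fun i => by
      by_cases hi : i = i0
      · subst hi; tauto
      · exact h2 i hi) _ _ h2u)
  exact ha (h (fun z => S1 z ∧ S2 z) (fun i => by
      by_cases hi : i = i0
      · subst hi; tauto
      · rw [h1 i hi, h2 i hi]) u (a i0) ⟨h1u, h2u⟩).2

lemma te {V ι : Type} (a b u : ι → V) (h : Cn a b) (s : Finset ι) :
    ∃ c : ι → V, (∀ i ∈ s, c i = a i ∨ c i = b i) ∧
      Cn (fun i => if i ∈ s then c i else a i) (fun i => if i ∈ s then u i else b i) := by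
  induction s using Finset.induction_on with
  | empty => exact ⟨a, by simp, by simpa using h⟩
  | insert i0 s hi0 ih =>
    obtain ⟨c, hc, hC⟩ := ih
    obtain ⟨c0, hc0, hC0⟩ := te_one _ _ i0 (u i0) hC
    simp only [hi0, if_false] at hc0
    refine ⟨Function.update c i0 c0, ?_, ?_⟩
    · intro i hi
      by_cases h : i = i0
      · subst h; simpa using hc0
      · rw [Function.update_of_ne h]
        exact hc i ((Finset.mem_insert.1 hi).resolve_left h)
    · convert hC0 using 1
      · funext i
        by_cases h : i = i0
        · subst h; simp
        · simp [h]
      · funext i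
        by_cases h : i = i0
        · subst h; simp
        · simp [h]

lemma tj {V ι : Type} [Fintype V] [Fintype ι] (a b : ι → V) (h : Cn a b) (t : V → ZMod 2)
    (ht : ∑ v, t v = 0) :
    ∃ c : ι → ZMod 2, ∀ v, ∑ i, c i * ((if a i = v then 1 else 0) + (if b i = v then 1 else 0)) = t v := by
  by_cases hV : Nonempty V
  swap
  · exact ⟨fun _ => 0, fun v => absurd ⟨v⟩ hV⟩
  obtain ⟨r⟩ := hV
  let x : ι → V → ZMod 2 := fun i => Pi.single (a i) 1 + Pi.single (b i) 1
  have hall : ∀ v, (Pi.single r 1 + Pi.single v 1 : V → ZMod 2) ∈ Submodule.span (ZMod 2) (Set.range x) := by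
    intro v
    refine h (fun v => (Pi.single r 1 + Pi.single v 1 : V → ZMod 2) ∈ Submodule.span (ZMod 2) (Set.range x)) ?_ r v ?_
    · intro i
      have hx : x i ∈ Submodule.span (ZMod 2) (Set.range x) := Submodule.subset_span ⟨i, rfl⟩
      have h2 : ∀ y : V → ZMod 2, y + y = 0 := fun y => by
        funext z; exact CharTwo.add_self_eq_zero _
      constructor
      · intro hm
        have := Submodule.add_mem _ hm hx
        convert this using 1
        have := h2 (Pi.single (a i) 1)
        simp only [x]
        rw [show (Pi.single r 1 + Pi.single (a i) 1 + (Pi.single (a i) 1 + Pi.single (b i) 1) : V → ZMod 2)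
          = Pi.single r 1 + (Pi.single (a i) 1 + Pi.single (a i) 1) + Pi.single (b i) 1 by abel, this]
        simp
      · intro hm
        have := Submodule.add_mem _ hm hx
        convert this using 1
        have := h2 (Pi.single (b i) 1)
        simp only [x]
        rw [show (Pi.single r 1 + Pi.single (b i) 1 + (Pi.single (a i) 1 + Pi.single (b i) 1) : V → ZMod 2)
          = Pi.single r 1 + (Pi.single (b i) 1 + Pi.single (b i) 1) + Pi.single (a i) 1 by abel, this]
        simp
    · have : (Pi.single r 1 + Pi.single r 1 : V → ZMod 2) = 0 := by
        funext z; exact CharTwo.add_self_eq_zero _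
      show _ ∈ _
      rw [this]; exact Submodule.zero_mem _
  have hmem : t ∈ Submodule.span (ZMod 2) (Set.range x) := by
    have : t = ∑ v, t v • (Pi.single r 1 + Pi.single v 1 : V → ZMod 2) := by
      simp only [smul_add, Finset.sum_add_distrib]
      rw [← Finset.sum_smul, ht, zero_smul, zero_add]
      funext z
      simp [Finset.sum_apply, Pi.single_apply]
    rw [this]
    exact Submodule.sum_mem _ (fun v _ => Submodule.smul_mem _ _ (hall v))
  rw [Submodule.mem_span_range_iff_exists_fun] at hmem
  obtain ⟨c, hc⟩ := hmem
  refine ⟨c, fun v => ?_⟩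
  rw [← hc]
  simp [x, Finset.sum_apply, Pi.single_apply, eq_comm, mul_add]

end PD

namespace PD

section
variable {H V : Type} [Fintype H]

/-- reachability under two maps -/
def Rch (σ τ : H → H) : H → H → Prop := EqvGen (fun a b => b = σ a ∨ b = τ a)

lemma card_even_of_inv (C : Finset H) (σ : H → H) (h1 : ∀ h ∈ C, σ h ∈ C) (h2 : ∀ h ∈ C, σ (σ h) = h)
    (h3 : ∀ h ∈ C, σ h ≠ h) : Even C.card := by
  have : ∑ h ∈ C, (1 : ZMod 2) = 0 := by
    apply Finset.sum_involution (fun h _ => σ h)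
    · intro a _; decide
    · intro a ha _; exact h3 a ha
    · intro a ha; exact h1 a ha
    · intro a ha; exact h2 a ha
  simp at this
  exact (ZMod.natCast_eq_zero_iff_even).1 this

/-- swapping -/
noncomputable def swp (τ : H → H) (h1 h2 : H) : H → H := fun h =>
  if h = h1 then h2 else if h = h2 then h1 else if h = τ h1 then τ h2 else if h = τ h2 then τ h1 else τ h

lemma fpf_exists (x : H → V) (hev : ∀ v, Even (Finset.univ.filter (fun h => x h = v)).card) :
    ∃ τ : H → H, (∀ h, τ (τ h) = h) ∧ (∀ h, τ h ≠ h) ∧ (∀ h, x (τ h) = x h) := by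
  have key : ∀ n : ℕ, ∀ C : Finset H, C.card = 2 * n → ∃ τ : H → H, ∀ h ∈ C, τ h ∈ C ∧ τ (τ h) = h ∧ τ h ≠ h := by
    intro n
    induction n with
    | zero => intro C hC; have : C = ∅ := by simpa using hC
              subst this; exact ⟨id, by simp⟩
    | succ n ih =>
      intro C hC
      obtain ⟨a, ha⟩ : C.Nonempty := by rw [← Finset.card_pos]; omega
      obtain ⟨b, hb⟩ : (C.erase a).Nonempty := by
        rw [← Finset.card_pos, Finset.card_erase_of_mem ha]; omega
      obtain ⟨τ, hτ⟩ := ih ((C.erase a).erase b) (by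
        rw [Finset.card_erase_of_mem hb, Finset.card_erase_of_mem ha]; omega)
      simp only [Finset.mem_erase] at hb hτ
      refine ⟨fun h => if h = a then b else if h = b then a else τ h, ?_⟩
      intro h hh
      by_cases h1 : h = a
      · subst h1; simp [hb.1, hb.2]
      · by_cases h2 : h = b
        · subst h2; simp [hb.1, hb.1.symm, ha]
        · have := hτ h ⟨h2, h1, hh⟩
          simp [h1, h2, this.1, this.2]
  have : ∀ v, ∃ τ : H → H, ∀ h ∈ (Finset.univ.filter (fun h => x h = v)), τ h ∈ (Finset.univ.filter (fun h => x h = v)) ∧ τ (τ h) = h ∧ τ h ≠ h := by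
    intro v
    obtain ⟨n, hn⟩ := hev v
    exact key n _ (by omega)
  choose T hT using this
  simp only [Finset.mem_filter, Finset.mem_univ, true_and] at hT
  refine ⟨fun h => T (x h) h, fun h => ?_, fun h => ?_, fun h => ?_⟩
  · have := hT (x h) h rfl
    show T (x (T (x h) h)) (T (x h) h) = h
    rw [this.1]; exact this.2.1
  · exact (hT (x h) h rfl).2.2
  · exact (hT (x h) h rfl).1

lemma swp_props (x : H → V) (τ : H → H) (t1 : ∀ h, τ (τ h) = h) (t2 : ∀ h, τ h ≠ h) (t3 : ∀ h, x (τ h) = x h)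
    (h1 h2 : H) (hx : x h1 = x h2) (hne : h1 ≠ h2) (hne' : h2 ≠ τ h1) :
    (∀ h, swp τ h1 h2 (swp τ h1 h2 h) = h) ∧ (∀ h, swp τ h1 h2 h ≠ h) ∧ (∀ h, x (swp τ h1 h2 h) = x h) := by
  have inj : ∀ a b, τ a = τ b → a = b := fun a b h => by rw [← t1 a, h, t1]
  have a1 := t2 h1
  have a2 := t2 h2
  have a3 : τ h1 ≠ τ h2 := fun h => hne (inj _ _ h)
  have a4 : h1 ≠ τ h2 := fun h => hne' (by rw [h, t1])
  refine ⟨fun h => ?_, fun h => ?_, fun h => ?_⟩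
  · unfold swp
    by_cases c1 : h = h1
    · subst c1; simp [hne.symm]
    by_cases c2 : h = h2
    · subst c2; simp [hne.symm]
    by_cases c3 : h = τ h1
    · subst c3; simp [a1, hne'.symm, a2, a4.symm, a3.symm]
    by_cases c4 : h = τ h2
    · subst c4; simp [a1, hne'.symm, a2, a4.symm, a3.symm]
    have c5 : τ h ≠ h1 := fun h' => c3 (by rw [← h', t1])
    have c6 : τ h ≠ h2 := fun h' => c4 (by rw [← h', t1])
    have c7 : τ h ≠ τ h1 := fun h' => c1 (inj _ _ h')
    have c8 : τ h ≠ τ h2 := fun h' => c2 (inj _ _ h')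
    simp [c1, c2, c3, c4, c5, c6, c7, c8, t1]
  · unfold swp
    split_ifs with c1 c2 c3 c4
    · subst c1; exact hne.symm
    · subst c2; exact hne
    · subst c3; exact a3.symm
    · subst c4; exact a3
    · exact t2 h
  · unfold swp
    split_ifs with c1 c2 c3 c4
    · subst c1; exact hx.symm
    · subst c2; exact hx
    · subst c3; rw [t3, t3, hx]
    · subst c4; rw [t3, t3, hx]
    · exact t3 h

lemma swp_rch_aux (x : H → V) (σ τ τ' : H → H) (s1 : ∀ h, σ (σ h) = h) (s2 : ∀ h, σ h ≠ h)
    (t1 : ∀ h, τ (τ h) = h) (t2 : ∀ h, τ h ≠ h)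
    (h1 h2 : H) (hR : ¬ Rch σ τ h1 h2)
    (e : ∀ h, h ≠ h1 → h ≠ h2 → h ≠ τ h1 → h ≠ τ h2 → τ' h = τ h) :
    Rch σ τ' h1 (τ h1) := by
  by_contra hcon
  let C : Finset H := Finset.univ.filter (fun g => Rch σ τ' h1 g ∧ Rch σ τ h1 g)
  have c1 : h1 ∈ C := by simp only [C, Finset.mem_filter, Finset.mem_univ, true_and]; exact ⟨EqvGen.refl _, EqvGen.refl _⟩
  have hsσ : ∀ (τ : H → H) g, Rch σ τ h1 g → Rch σ τ h1 (σ g) := fun τ g hg => EqvGen.trans _ _ _ hg (EqvGen.rel _ _ (Or.inl rfl))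
  have hsτ : ∀ (τ : H → H) g, Rch σ τ h1 g → Rch σ τ h1 (τ g) := fun τ g hg => EqvGen.trans _ _ _ hg (EqvGen.rel _ _ (Or.inr rfl))
  have e1 : Even C.card := card_even_of_inv C σ (fun h hh => by
    simp only [C, Finset.mem_filter, Finset.mem_univ, true_and] at hh ⊢
    exact ⟨hsσ _ _ hh.1, hsσ _ _ hh.2⟩) (fun h _ => s1 h) (fun h _ => s2 h)
  have e2 : Even (C.erase h1).card := card_even_of_inv _ τ (fun h hh => by
    rw [Finset.mem_erase] at hh
    obtain ⟨hne, hC⟩ := hh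
    simp only [C, Finset.mem_filter, Finset.mem_univ, true_and] at hC
    have n1 : h ≠ τ h1 := fun h' => hcon (h' ▸ hC.1)
    have n2 : h ≠ h2 := fun h' => hR (h' ▸ hC.2)
    have n3 : h ≠ τ h2 := fun h' => hR (by
      have := hsτ _ _ hC.2
      rwa [h', t1] at this)
    have := e h hne n2 n1 n3
    rw [Finset.mem_erase]
    refine ⟨fun h' => n1 (by rw [← h', t1]), ?_⟩
    simp only [C, Finset.mem_filter, Finset.mem_univ, true_and]
    refine ⟨?_, hsτ _ _ hC.2⟩
    rw [← this]; exact hsτ _ _ hC.1) (fun h _ => t1 h) (fun h _ => t2 h)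
  rw [Finset.card_erase_of_mem c1] at e2
  have : 0 < C.card := Finset.card_pos.2 ⟨_, c1⟩
  grind

lemma swp_rch (x : H → V) (σ τ : H → H) (s1 : ∀ h, σ (σ h) = h) (s2 : ∀ h, σ h ≠ h)
    (t1 : ∀ h, τ (τ h) = h) (t2 : ∀ h, τ h ≠ h)
    (h1 h2 : H) (hR : ¬ Rch σ τ h1 h2) :
    ∀ g g', Rch σ τ g g' → Rch σ (swp τ h1 h2) g g' := by
  have q1 := swp_rch_aux x σ τ (swp τ h1 h2) s1 s2 t1 t2 h1 h2 hR (fun h a b c d => by simp [swp, a, b, c, d])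
  have q2 := swp_rch_aux x σ τ (swp τ h1 h2) s1 s2 t1 t2 h2 h1 (fun h => hR (EqvGen.symm _ _ h)) (fun h a b c d => by simp [swp, a, b, c, d])
  intro g g' h
  induction h with
  | refl x => exact EqvGen.refl _
  | symm x y _ ih => exact EqvGen.symm _ _ ih
  | trans x y z _ _ ih1 ih2 => exact EqvGen.trans _ _ _ ih1 ih2
  | rel a b h =>
    rcases h with rfl | rfl
    · exact EqvGen.rel _ _ (Or.inl rfl)
    · by_cases c1 : a = h1
      · subst c1; exact q1
      by_cases c2 : a = h2
      · subst c2; exact q2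
      by_cases c3 : a = τ h1
      · subst c3; rw [t1]; exact EqvGen.symm _ _ q1
      by_cases c4 : a = τ h2
      · subst c4; rw [t1]; exact EqvGen.symm _ _ q2
      exact EqvGen.rel _ _ (Or.inr (by simp [swp, c1, c2, c3, c4]))

theorem circ_exists (x : H → V) (σ : H → H) (s1 : ∀ h, σ (σ h) = h) (s2 : ∀ h, σ h ≠ h)
    (hev : ∀ v, Even (Finset.univ.filter (fun h => x h = v)).card)
    (hconn : ∀ S : V → Prop, (∀ h, S (x h) ↔ S (x (σ h))) → ∀ g g', S (x g) → S (x g'))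
    (cf : H → H → Prop) (hsymm : ∀ g h, cf g h → cf h g) (K : V → ℕ)
    (hK : ∀ g, (Finset.univ.filter (fun h => x h = x g ∧ cf g h)).card ≤ K (x g))
    (hdeg : (∀ g h, ¬ cf g h) ∨ ∀ g, 4 * K (x g) + 2 < (Finset.univ.filter (fun h => x h = x g)).card) :
    ∃ τ : H → H, (∀ h, τ (τ h) = h) ∧ (∀ h, τ h ≠ h) ∧ (∀ h, x (τ h) = x h) ∧ (∀ h, ¬ cf h (τ h)) ∧
      ∀ g g', Rch σ τ g g' := by
  let TT : Set (H → H) := {τ | (∀ h, τ (τ h) = h) ∧ (∀ h, τ h ≠ h) ∧ (∀ h, x (τ h) = x h)}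
  -- counting helper
  have hfind : ∀ (τ : H → H), (∀ h, τ (τ h) = h) → (∀ h, x (τ h) = x h) → ∀ h1, ∀ B : Finset H,
      (∀ h ∈ B, x h = x h1) → 2 * K (x h1) < B.card → ∃ h2 ∈ B, ¬ cf h1 h2 ∧ ¬ cf (τ h1) (τ h2) := by
    intro τ t1 t3 h1 B hB hcard
    by_contra hcon
    push Not at hcon
    have hsub : B ⊆ (Finset.univ.filter (fun h => x h = x h1 ∧ cf h1 h)) ∪
        ((Finset.univ.filter (fun h => x h = x (τ h1) ∧ cf (τ h1) h)).image τ) := by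
      intro h hh
      rw [Finset.mem_union]
      by_cases hc : cf h1 h
      · left; simp [hB h hh, hc]
      · right
        rw [Finset.mem_image]
        exact ⟨τ h, by simp [t3, hB h hh, hcon h hh hc], t1 h⟩
    have := Finset.card_le_card hsub
    have h2 := Finset.card_union_le (Finset.univ.filter (fun h => x h = x h1 ∧ cf h1 h))
        ((Finset.univ.filter (fun h => x h = x (τ h1) ∧ cf (τ h1) h)).image τ)
    have h3 : ((Finset.univ.filter (fun h => x h = x (τ h1) ∧ cf (τ h1) h)).image τ).card ≤ K (x (τ h1)) :=
      Finset.card_image_le.trans (hK _)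
    have h4 := hK h1
    rw [show K (x (τ h1)) = K (x h1) by rw [t3]] at h3
    omega
  -- no bad pairs
  have hgood : ∃ τ ∈ TT, ∀ h, ¬ cf h (τ h) := by
    obtain ⟨τ0, hτ0⟩ := fpf_exists x hev
    obtain ⟨τ, hτ, hmin⟩ := Set.exists_min_image TT (fun τ => (Finset.univ.filter (fun h => cf h (τ h))).card)
      (Set.toFinite _) ⟨τ0, hτ0⟩
    refine ⟨τ, hτ, ?_⟩
    obtain ⟨t1, t2, t3⟩ := hτ
    by_contra hcon
    push Not at hcon
    obtain ⟨h1, hbad⟩ := hcon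
    replace hdeg := hdeg.resolve_left (fun h => h _ _ hbad)
    obtain ⟨h2, hB, g1, g2⟩ := hfind τ t1 t3 h1 (((Finset.univ.filter (fun h => x h = x h1)).erase h1).erase (τ h1))
      (fun h hh => by simp at hh; exact hh.2.2) (by
        rw [Finset.card_erase_of_mem (by simp [t2, t3]), Finset.card_erase_of_mem (by simp)]
        have := hdeg h1
        omega)
    simp at hB
    obtain ⟨n1, n2, n3⟩ := hB
    have hp := swp_props x τ t1 t2 t3 h1 h2 n3.symm (Ne.symm n2) n1
    have := hmin (swp τ h1 h2) hp
    refine absurd this (not_le.2 (Finset.card_lt_card ?_))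
    rw [Finset.ssubset_iff_of_subset]
    · refine ⟨h1, by simpa using hbad, fun hm => g1 (by simpa [swp] using (Finset.mem_filter.1 hm).2)⟩
    · intro h hh
      simp only [Finset.mem_filter, Finset.mem_univ, true_and] at hh ⊢
      by_cases c1 : h = h1
      · subst c1; exact hbad
      by_cases c2 : h = h2
      · subst c2; simp [swp, c1] at hh; exact absurd (hsymm _ _ hh) g1
      by_cases c3 : h = τ h1
      · subst c3; simp [swp, c1, c2] at hh; exact absurd hh g2
      by_cases c4 : h = τ h2
      · subst c4; simp [swp, c1, c2, c3] at hh; exact absurd (hsymm _ _ hh) g2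
      simpa [swp, c1, c2, c3, c4] using hh
  obtain ⟨τ0, hτ0, hτ0'⟩ := hgood
  obtain ⟨τ, ⟨⟨t1, t2, t3⟩, t4⟩, hmax⟩ := Set.exists_max_image {τ | τ ∈ TT ∧ ∀ h, ¬ cf h (τ h)}
    (fun τ => (Finset.univ.filter (fun p : H × H => Rch σ τ p.1 p.2)).card)
      (Set.toFinite _) ⟨τ0, hτ0, hτ0'⟩
  refine ⟨τ, t1, t2, t3, t4, ?_⟩
  by_contra hcon
  push Not at hcon
  obtain ⟨g, g', hgg⟩ := hcon
  -- swapping two is impossible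
  have hno : ∀ h1 h2, x h1 = x h2 → ¬ Rch σ τ h1 h2 → ¬ cf h1 h2 → ¬ cf (τ h1) (τ h2) → False := by
    intro h1 h2 hx hR g1 g2
    have hne : h1 ≠ h2 := fun h => hR (h ▸ EqvGen.refl _)
    have hne' : h2 ≠ τ h1 := fun h => hR (EqvGen.rel _ _ (Or.inr h))
    have hp := swp_props x τ t1 t2 t3 h1 h2 hx hne hne'
    have := hmax (swp τ h1 h2) ⟨hp, fun h => by
      by_cases c1 : h = h1
      · subst c1; simpa [swp] using g1
      by_cases c2 : h = h2
      · subst c2; simp [swp, c1]; exact fun h => g1 (hsymm _ _ h)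
      by_cases c3 : h = τ h1
      · subst c3; simpa [swp, c1, c2] using g2
      by_cases c4 : h = τ h2
      · subst c4; simp [swp, c1, c2, c3]; exact fun h => g2 (hsymm _ _ h)
      simpa [swp, c1, c2, c3, c4] using t4 h⟩
    refine absurd this (not_le.2 (Finset.card_lt_card ?_))
    rw [Finset.ssubset_iff_of_subset]
    · refine ⟨(h1, h2), ?_, by simpa using hR⟩
      simp only [Finset.mem_filter, Finset.mem_univ, true_and]
      exact EqvGen.rel _ _ (Or.inr (by simp [swp]))
    · intro h hh
      simp only [Finset.mem_filter, Finset.mem_univ, true_and] at hh ⊢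
      exact swp_rch x σ τ s1 s2 t1 t2 h1 h2 hR _ _ hh
  -- find vertex with two classes
  obtain ⟨h1, h2, hx, hR⟩ : ∃ h1 h2, x h1 = x h2 ∧ ¬ Rch σ τ h1 h2 := by
    by_contra hc
    push Not at hc
    obtain ⟨z, hz, hz'⟩ := hconn (fun v => ∃ h, x h = v ∧ Rch σ τ g h) (fun h => by
      have hr : Rch σ τ h (σ h) := EqvGen.rel _ _ (Or.inl rfl)
      constructor
      · rintro ⟨z, hz, hz'⟩
        exact ⟨σ h, rfl, EqvGen.trans _ _ _ (EqvGen.trans _ _ _ hz' (hc _ _ hz)) hr⟩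
      · rintro ⟨z, hz, hz'⟩
        exact ⟨h, rfl, EqvGen.trans _ _ _ (EqvGen.trans _ _ _ hz' (hc _ _ hz)) (EqvGen.symm _ _ hr)⟩) g g' ⟨g, rfl, EqvGen.refl _⟩
    exact hgg (EqvGen.trans _ _ _ hz' (hc _ _ hz))
  -- classes
  set A := Finset.univ.filter (fun h => x h = x h1 ∧ Rch σ τ h1 h) with hA
  set B := Finset.univ.filter (fun h => x h = x h1 ∧ ¬ Rch σ τ h1 h) with hB
  have hAB : A.card + B.card = (Finset.univ.filter (fun h => x h = x h1)).card := by
    rw [← Finset.card_union_of_disjoint]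
    · congr 1; ext p; simp only [hA, hB, Finset.mem_filter, Finset.mem_univ, true_and, Finset.mem_union]; tauto
    · rw [Finset.disjoint_left]; intro p; simp only [hA, hB, Finset.mem_filter, Finset.mem_univ, true_and]; tauto
  rcases hdeg with hdeg | hdeg
  · exact hno h1 h2 hx hR (hdeg _ _) (hdeg _ _)
  have hd := hdeg h1
  by_cases hBig : 2 * K (x h1) < B.card
  · obtain ⟨z, hz, g1, g2⟩ := hfind τ t1 t3 h1 B (fun h hh => by simp [hB] at hh; exact hh.1) hBig
    simp [hB] at hz
    exact hno h1 z hz.1.symm hz.2 g1 g2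
  · obtain ⟨z, hz, g1, g2⟩ := hfind τ t1 t3 h2 A (fun h hh => by simp [hA] at hh; rw [hh.1, hx]) (by rw [← hx]; omega)
    simp [hA] at hz
    exact hno h2 z (by rw [hz.1, hx]) (fun h => hR (EqvGen.trans _ _ _ hz.2 (EqvGen.symm _ _ h))) g1 g2

theorem circuit (x : H → V) (σ : H → H) (s1 : ∀ h, σ (σ h) = h) (s2 : ∀ h, σ h ≠ h)
    (hev : ∀ v, Even (Finset.univ.filter (fun h => x h = v)).card)
    (hconn : ∀ S : V → Prop, (∀ h, S (x h) ↔ S (x (σ h))) → ∀ g g', S (x g) → S (x g'))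
    (cf : H → H → Prop) (hsymm : ∀ g h, cf g h → cf h g) (K : V → ℕ)
    (hK : ∀ g, (Finset.univ.filter (fun h => x h = x g ∧ cf g h)).card ≤ K (x g))
    (hdeg : (∀ g h, ¬ cf g h) ∨ ∀ g, 4 * K (x g) + 2 < (Finset.univ.filter (fun h => x h = x g)).card) (h0 : H) :
    ∃ (n : ℕ) (q : ℕ → H), q 0 = h0 ∧ q n = h0 ∧ 0 < n ∧ (∀ k, x (q (k+1)) = x (σ (q k))) ∧
      (∀ k, ¬ cf (σ (q k)) (q (k+1))) ∧
      (∀ j < n, ∀ k < n, q j = q k → j = k) ∧ (∀ j k, q j ≠ σ (q k)) ∧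
      (∀ h, ∃ k < n, q k = h ∨ q k = σ h) := by
  obtain ⟨τ, t1, t2, t3, t4, t5⟩ := circ_exists x σ s1 s2 hev hconn cf hsymm K hK hdeg
  let φ : H → H := fun h => τ (σ h)
  have hφinj : Function.Injective φ := fun a b h => by
    have : σ a = σ b := by rw [← t1 (σ a), ← t1 (σ b)]; exact congrArg τ h
    rw [← s1 a, this, s1]
  have hper : h0 ∈ Function.periodicPts φ := by
    have := hφinj.mem_periodicPts h0
    exact this
  have hnpos := Function.minimalPeriod_pos_of_mem_periodicPts hper
  have hσφ : ∀ k h, φ^[k] (σ (φ^[k] h)) = σ h := by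
    intro k
    induction k with
    | zero => intro h; rfl
    | succ k ih =>
      intro h
      rw [Function.iterate_succ_apply, Function.iterate_succ_apply' φ k h]
      have : φ (σ (φ (φ^[k] h))) = σ (φ^[k] h) := by simp [φ, s1, t1]
      rw [this, ih]
  have hno' : ∀ n h, φ^[n] h ≠ σ h := by
    intro n h heq
    rcases Nat.even_or_odd' n with ⟨k, rfl | rfl⟩
    · rw [← hσφ k h, two_mul, Function.iterate_add_apply] at heq
      exact s2 _ ((hφinj.iterate k heq).symm)
    · rw [← hσφ k h, show 2 * k + 1 = k + (k + 1) by ring, Function.iterate_add_apply, Function.iterate_succ_apply'] at heq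
      have := hφinj.iterate k heq
      exact t2 _ this
  refine ⟨Function.minimalPeriod φ h0, fun k => φ^[k] h0, rfl, ?_, hnpos, ?_, ?_, ?_, ?_, ?_⟩
  · exact Function.iterate_minimalPeriod
  · intro k; simp only [Function.iterate_succ_apply']; exact t3 _
  · intro k; simp only [Function.iterate_succ_apply']; exact t4 _
  · intro j hj k hk h
    exact Function.iterate_injOn_Iio_minimalPeriod hj hk h
  · intro j k h
    simp only at h
    -- φ^[j] h0 = φ^[j + n*..] ...
    have : φ^[j + k * Function.minimalPeriod φ h0] h0 = σ (φ^[k] h0) := by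
      rw [Function.iterate_add_apply, mul_comm, Function.iterate_mul]
      have : (φ^[Function.minimalPeriod φ h0])^[k] h0 = h0 :=
        Function.iterate_fixed Function.iterate_minimalPeriod k
      rw [this, h]
    have hge : k ≤ j + k * Function.minimalPeriod φ h0 := by nlinarith
    obtain ⟨d, hd⟩ := Nat.exists_eq_add_of_le hge
    rw [hd, add_comm k d, Function.iterate_add_apply] at this
    exact hno' _ _ this
  · intro h
    have key : ∀ g g', Rch σ τ g g' → ((∃ k, φ^[k] h0 = g ∨ φ^[k] h0 = σ g) ↔ (∃ k, φ^[k] h0 = g' ∨ φ^[k] h0 = σ g')) := by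
      intro g g' hr
      have hpred : ∀ k, ∃ j, φ (φ^[j] h0) = φ^[k] h0 := by
        intro k
        rcases k with _ | k
        · refine ⟨Function.minimalPeriod φ h0 - 1, ?_⟩
          rw [← Function.iterate_succ_apply' φ, Nat.succ_eq_add_one, Nat.sub_add_cancel hnpos]
          exact Function.iterate_minimalPeriod
        · exact ⟨k, (Function.iterate_succ_apply' φ _ _).symm⟩
      have hτcl : ∀ g, (∃ k, φ^[k] h0 = g ∨ φ^[k] h0 = σ g) → (∃ k, φ^[k] h0 = τ g ∨ φ^[k] h0 = σ (τ g)) := by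
        rintro g ⟨k, h | h⟩
        · obtain ⟨j, hj⟩ := hpred k
          refine ⟨j, Or.inr ?_⟩
          rw [← h, ← hj]
          simp [φ, t1, s1]
        · refine ⟨k + 1, Or.inl ?_⟩
          rw [Function.iterate_succ_apply', h]
          simp [φ, s1]
      induction hr with
      | refl => rfl
      | symm _ _ _ ih => exact ih.symm
      | trans _ _ _ _ _ i1 i2 => exact i1.trans i2
      | rel a b hab =>
        rcases hab with rfl | rfl
        · simp only [s1]
          constructor <;> rintro ⟨k, h⟩ <;> exact ⟨k, h.symm⟩
        · exact ⟨hτcl a, fun h => by have := hτcl _ h; rwa [t1] at this⟩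
    obtain ⟨k, hk⟩ := (key h0 h (t5 _ _)).1 ⟨0, Or.inl rfl⟩
    refine ⟨k % Function.minimalPeriod φ h0, Nat.mod_lt _ hnpos, ?_⟩
    simp only [Function.iterate_mod_minimalPeriod_eq]
    exact hk

end
end PD

namespace PD

lemma tree_cn {V : Type} (f : V → V) (h : V → ℕ) (r : V) (hf : ∀ v, v ≠ r → h (f v) < h v) :
    Cn (fun v : {v // v ≠ r} => v.1) (fun v : {v // v ≠ r} => f v.1) := by
  intro S hS u v hu
  have key : ∀ n v, h v < n → (S v ↔ S r) := by
    intro n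
    induction n with
    | zero => intro v hv; omega
    | succ n ih =>
      intro v hv
      by_cases hvr : v = r
      · rw [hvr]
      · rw [hS ⟨v, hvr⟩]
        exact ih (f v) (by have := hf v hvr; omega)
  rw [key _ v (Nat.lt_succ_self _), ← key _ u (Nat.lt_succ_self _)]
  exact hu

lemma tree_edge_inj {V : Type} (f : V → V) (h : V → ℕ) (r : V) (hf : ∀ v, v ≠ r → h (f v) < h v)
    (v w : V) (hv : v ≠ r) (hw : w ≠ r) (he : s(v, f v) = s(w, f w)) : v = w := by
  rw [Sym2.eq_iff] at he
  rcases he with ⟨h1, _⟩ | ⟨h1, h2⟩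
  · exact h1
  · have a1 := hf v hv
    have a2 := hf w hw
    rw [h2] at a1
    rw [← h1] at a2
    omega

set_option maxHeartbeats 400000 in
theorem twopath {V : Type} [Fintype V] (col : V → Bool) (f : Fin 2 → V → V) (h : Fin 2 → V → ℕ) (r : Fin 2 → V)
    (hf : ∀ i v, v ≠ r i → col v ≠ col (f i v) ∧ h i (f i v) < h i v)
    (hdis : ∀ v w, v ≠ r 0 → w ≠ r 1 → s(v, f 0 v) ≠ s(w, f 1 w)) (a : V) :
    ∃ (par z : V → V) (rk : V → ℕ),
      (∀ y, col y = col a → y ≠ a → col (par y) = col a ∧ col (z y) ≠ col a ∧ par y ≠ y ∧ rk (par y) < rk y ∧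
        (∃ i v, v ≠ r i ∧ s(par y, z y) = s(v, f i v)) ∧ (∃ i v, v ≠ r i ∧ s(z y, y) = s(v, f i v))) ∧
      (∀ y y', col y = col a → y ≠ a → col y' = col a → y' ≠ a →
        s(par y, z y) ≠ s(z y', y') ∧ (s(par y, z y) = s(par y', z y') → y = y') ∧
        (s(z y, y) = s(z y', y') → y = y')) := by
  by_cases htriv : ∀ y, col y = col a → y = a
  · exact ⟨id, id, fun _ => 0, fun y hy hya => absurd (htriv y hy) hya, fun y _ hy hya => absurd (htriv y hy) hya⟩
  push Not at htriv
  obtain ⟨y0, hy0, hy0a⟩ := htriv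
  have cn0 := tree_cn (f 0) (h 0) (r 0) (fun v hv => (hf 0 v hv).2)
  have cn1 := tree_cn (f 1) (h 1) (r 1) (fun v hv => (hf 1 v hv).2)
  let t : V → ZMod 2 := fun v => ∑ i : {v // v ≠ r 0}, ((if i.1 = v then 1 else 0) + (if f 0 i.1 = v then 1 else 0))
  obtain ⟨c, hc⟩ := tj _ _ cn1 t (by
    simp only [t]
    rw [Finset.sum_comm]
    apply Finset.sum_eq_zero
    intro i _
    rw [Finset.sum_add_distrib]
    simp
    decide)
  let M := {v // v ≠ r 0} ⊕ {i : {v // v ≠ r 1} // c i = 1}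
  let idx : M → Fin 2 := fun m => match m with | .inl _ => 0 | .inr _ => 1
  let bs : M → V := fun m => match m with | .inl v => v.1 | .inr v => v.1.1
  have hbs : ∀ m, bs m ≠ r (idx m) := by
    rintro (v | v)
    · exact v.2
    · exact v.1.2
  have hMinj : ∀ m m', s(bs m, f (idx m) (bs m)) = s(bs m', f (idx m') (bs m')) → m = m' := by
    rintro (v | v) (w | w) he
    · congr 1; exact Subtype.ext (tree_edge_inj (f 0) (h 0) (r 0) (fun v hv => (hf 0 v hv).2) _ _ v.2 w.2 he)
    · exact absurd he (hdis _ _ v.2 w.1.2)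
    · exact absurd he.symm (hdis _ _ w.2 v.1.2)
    · congr 1; exact Subtype.ext (Subtype.ext (tree_edge_inj (f 1) (h 1) (r 1) (fun v hv => (hf 1 v hv).2) _ _ v.1.2 w.1.2 he))
  let x : M × Bool → V := fun p => if p.2 then f (idx p.1) (bs p.1) else bs p.1
  let σ : M × Bool → M × Bool := fun p => (p.1, !p.2)
  have hxσ : ∀ p, s(x p, x (σ p)) = s(bs p.1, f (idx p.1) (bs p.1)) := by
    rintro ⟨m, b⟩
    cases b
    · rfl
    · exact Sym2.eq_swap
  have hcn : ∀ S : V → Prop, (∀ h, S (x h) ↔ S (x (σ h))) → ∀ u v, S u → S v := by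
    intro S hS
    refine cn0 S (fun i => ?_)
    exact hS (Sum.inl i, false)
  obtain ⟨h0, hh0⟩ : ∃ h0, x h0 = a := by
    by_contra hcon
    push Not at hcon
    exact hy0a (hcn (fun v => v = a) (fun h => by simp [hcon]) a y0 rfl)
  have hcover : ∀ y, ∃ p, x p = y := by
    intro y
    by_contra hcon
    push Not at hcon
    have hx : ∀ v, v = y := fun v => hcn (fun v => v = y) (fun h => by simp [hcon]) y v rfl
    exact hcon h0 (hx _)
  have heven : ∀ v, Even (Finset.univ.filter (fun h => x h = v)).card := by
    intro v
    rw [← ZMod.natCast_eq_zero_iff_even, Finset.natCast_card_filter, Fintype.sum_prod_type]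
    have : ∀ m : M, ∑ b : Bool, (if x (m, b) = v then (1 : ZMod 2) else 0) =
        (if bs m = v then 1 else 0) + (if f (idx m) (bs m) = v then 1 else 0) := by
      intro m
      rw [Fintype.sum_bool]
      exact add_comm _ _
    rw [Finset.sum_congr rfl (fun m _ => this m)]
    rw [Fintype.sum_sum_type]
    have e1 : (∑ i : {v // v ≠ r 0}, ((if bs (Sum.inl i) = v then (1 : ZMod 2) else 0) +
        (if f (idx (Sum.inl i)) (bs (Sum.inl i)) = v then 1 else 0))) = t v := rfl
    have e2 : (∑ i : {i : {v // v ≠ r 1} // c i = 1}, ((if bs (Sum.inr i) = v then (1 : ZMod 2) else 0) +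
        (if f (idx (Sum.inr i)) (bs (Sum.inr i)) = v then 1 else 0))) = t v := by
      rw [← hc v]
      rw [← Finset.sum_subtype (Finset.univ.filter (fun i => c i = 1)) (fun i => by simp)
        (fun i : {v // v ≠ r 1} => ((if i.1 = v then (1 : ZMod 2) else 0) + (if f 1 i.1 = v then 1 else 0)))]
      rw [Finset.sum_filter]
      apply Finset.sum_congr rfl
      intro i _
      have : c i = 0 ∨ c i = 1 := by generalize c i = z; revert z; decide
      rcases this with h | h <;> simp [h]
    rw [e1, e2]
    exact CharTwo.add_self_eq_zero _
  obtain ⟨n, q, q0, qn, npos, q1, _, qinj, qσ, qall⟩ := circuit x σ (fun p => by simp [σ])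
    (fun p => by intro h; have := congrArg Prod.snd h; simp [σ] at this) heven
    (fun S hS g g' hg => hcn S hS _ _ hg) (fun _ _ => False) (fun _ _ h => h) (fun _ => 0) (fun g => by simp)
    (Or.inl (fun _ _ h => h)) h0
  let X : ℕ → V := fun k => x (q k)
  have hX0 : X 0 = a := by simp [X, q0, hh0]
  have hEd : ∀ k, s(X k, X (k+1)) = s(bs (q k).1, f (idx (q k).1) (bs (q k).1)) := by
    intro k; simp only [X]; rw [q1 k, hxσ]
  have hEinj : ∀ j < n, ∀ k < n, s(X j, X (j+1)) = s(X k, X (k+1)) → j = k := by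
    intro j hj k hk he
    rw [hEd, hEd] at he
    have h1 := hMinj _ _ he
    apply qinj j hj k hk
    have h2 := qσ j k
    by_contra hne
    apply h2
    refine Prod.ext h1 ?_
    have : (q j).2 ≠ (q k).2 := fun h => hne (Prod.ext h1 h)
    simp only [σ]
    revert this
    cases (q j).2 <;> cases (q k).2 <;> simp
  have hXcol : ∀ k, col (X k) ≠ col (X (k+1)) := by
    intro k
    have h1 := hEd k
    have h2 := (hf _ _ (hbs (q k).1)).1
    rw [Sym2.eq_iff] at h1
    rcases h1 with ⟨h1, h3⟩ | ⟨h1, h3⟩ <;> rw [h1, h3]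
    · exact h2
    · exact h2.symm
  have hXpar : ∀ k, (col (X k) = col a ↔ Even k) := by
    intro k
    induction k with
    | zero => simp [hX0]
    | succ k ih =>
      have := hXcol k
      rw [Nat.even_add_one, ← ih]
      revert this
      cases col (X k) <;> cases col (X (k+1)) <;> cases col a <;> simp
  have hvis : ∀ y, ∃ k, k ≤ n ∧ X k = y := by
    intro y
    obtain ⟨p, rfl⟩ := hcover y
    obtain ⟨k, hk, h | h⟩ := qall p
    · exact ⟨k, hk.le, by simp [X, h]⟩
    · exact ⟨k+1, hk, by simp [X, q1, h, σ]⟩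
  have hvis' : ∀ y, ∃ k, X k = y := fun y => (hvis y).imp fun k hk => hk.2
  let rk : V → ℕ := fun y => Nat.find (hvis' y)
  have rk1 : ∀ y, X (rk y) = y := fun y => Nat.find_spec (hvis' y)
  have rk2 : ∀ k, rk (X k) ≤ k := fun k => Nat.find_min' _ rfl
  have rkn : ∀ y, rk y ≤ n := fun y => by
    obtain ⟨k, hk, h⟩ := hvis y
    exact (Nat.find_min' (hvis' y) h).trans hk
  have rk3 : ∀ y, col y = col a → y ≠ a → Even (rk y) ∧ 2 ≤ rk y := by
    intro y hy hya
    have he : Even (rk y) := (hXpar _).1 (by rw [rk1, hy])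
    refine ⟨he, ?_⟩
    have : rk y ≠ 0 := fun h => hya (by rw [← rk1 y, h, hX0])
    obtain ⟨j, hj⟩ := he
    omega
  refine ⟨fun y => X (rk y - 2), fun y => X (rk y - 1), rk, ?_, ?_⟩
  · intro y hy hya
    obtain ⟨he, h2⟩ := rk3 y hy hya
    obtain ⟨d, hd⟩ := Nat.exists_eq_add_of_le h2
    have e1 : rk y - 2 = d := by omega
    have e2 : rk y - 1 = d + 1 := by omega
    have e3 : X (d + 2) = y := by rw [← rk1 y, hd, add_comm 2 d]
    have hde : Even d := by rw [hd] at he; grind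
    have hlt : rk (X d) < rk y := by have := rk2 d; omega
    simp only [e1, e2]
    refine ⟨(hXpar d).2 hde, fun h => ?_, fun h => ?_, hlt, ?_, ?_⟩
    · exact (Nat.even_add_one.1 ((hXpar _).1 h)) hde
    · rw [h] at hlt; omega
    · exact ⟨_, _, hbs _, hEd d⟩
    · refine ⟨_, _, hbs (q (d+1)).1, ?_⟩
      rw [← hEd (d+1), e3]
  · intro y y' hy hya hy' hya'
    obtain ⟨he, h2⟩ := rk3 y hy hya
    obtain ⟨he', h2'⟩ := rk3 y' hy' hya'
    obtain ⟨d, hd⟩ := Nat.exists_eq_add_of_le h2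
    obtain ⟨d', hd'⟩ := Nat.exists_eq_add_of_le h2'
    have e1 : rk y - 2 = d := by omega
    have e2 : rk y - 1 = d + 1 := by omega
    have e3 : X (d + 2) = y := by rw [← rk1 y, hd, add_comm 2 d]
    have e1' : rk y' - 2 = d' := by omega
    have e2' : rk y' - 1 = d' + 1 := by omega
    have e3' : X (d' + 2) = y' := by rw [← rk1 y', hd', add_comm 2 d']
    have n1 := rkn y
    have n2 := rkn y'
    simp only [e1, e2, e1', e2']
    refine ⟨fun h => ?_, fun h => ?_, fun h => ?_⟩
    · conv at h => rhs; rw [← e3']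
      have := hEinj d (by omega) (d' + 1) (by omega) h
      grind
    · have := hEinj d (by omega) d' (by omega) h
      rw [← e3, this, e3']
    · rw [← e3, ← e3'] at h
      have := hEinj (d+1) (by omega) (d' + 1) (by omega) h
      rw [← e3, show d = d' by omega, e3']

end PD

namespace PD

/-- consecutive edges of a vertex list -/
def pe {V : Type} : List V → List (Sym2 V)
  | [] => []
  | [_] => []
  | x :: y :: l => s(x, y) :: pe (y :: l)

lemma pe_append {V : Type} (A : List V) (x : V) (T : List V) : pe (A ++ x :: T) = pe (A ++ [x]) ++ pe (x :: T) := by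
  induction A with
  | nil => simp [pe]
  | cons a A ih =>
    cases A with
    | nil => simp [pe]
    | cons b A => simp only [List.cons_append, pe] at ih ⊢; rw [ih]

/-- windows are good -/
def WG {V : Type} (ℓ : ℕ) (W : List V) : Prop :=
  ∀ i j, i < j → j ≤ i + ℓ → j < W.length → W[i]? ≠ W[j]?

lemma WG.nodup {V : Type} {ℓ : ℕ} {W : List V} (h : WG ℓ W) (hl : W.length ≤ ℓ + 1) : W.Nodup := by
  rw [List.nodup_iff_getElem?_ne_getElem?]
  intro i j hij hj
  exact h i j hij (by omega) hj

lemma WG.take {V : Type} {ℓ : ℕ} {W : List V} (h : WG ℓ W) (n : ℕ) : WG ℓ (W.take n) := by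
  intro i j hij hj hl
  simp only [List.length_take, lt_min_iff] at hl
  rw [List.getElem?_take_of_lt (by omega), List.getElem?_take_of_lt (by omega)]
  exact h i j hij hj hl.2

lemma WG.drop {V : Type} {ℓ : ℕ} {W : List V} (h : WG ℓ W) (n : ℕ) : WG ℓ (W.drop n) := by
  intro i j hij hj hl
  simp only [List.length_drop] at hl
  rw [List.getElem?_drop, List.getElem?_drop]
  exact h _ _ (by omega) (by omega) (by omega)

lemma chop {V : Type} (R : V → V → Prop) (ℓ : ℕ) (hℓ : 1 ≤ ℓ) : ∀ (n : ℕ) (W : List V), W.length ≤ n → WG ℓ W → W.IsChain R →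
    ∃ LL : List (List V), (∀ l ∈ LL, l.Nodup ∧ l.IsChain R ∧ 2 ≤ l.length ∧ l.length ≤ ℓ + 1) ∧
      (LL.filter (fun l => l.length ≠ ℓ + 1)).length ≤ 1 ∧ LL.flatMap pe = pe W := by
  intro n
  induction n with
  | zero =>
    intro W hn _ _
    have : W = [] := by simpa using hn
    subst this
    exact ⟨[], by simp, by simp, by simp [pe]⟩
  | succ n ih =>
    intro W hn hW hc
    by_cases h1 : W.length ≤ 1
    · refine ⟨[], by simp, by simp, ?_⟩
      match W, h1 with
      | [], _ => simp [pe]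
      | [x], _ => simp [pe]
    by_cases h2 : W.length ≤ ℓ + 1
    · refine ⟨[W], ?_, ?_, by simp⟩
      · intro l hl
        simp at hl; subst hl
        exact ⟨hW.nodup h2, hc, by omega, h2⟩
      · exact (List.length_filter_le _ _).trans (by simp)
    · obtain ⟨LL, a1, a2, a3⟩ := ih (W.drop ℓ) (by simp; omega) (hW.drop ℓ) (hc.drop ℓ)
      refine ⟨W.take (ℓ + 1) :: LL, ?_, ?_, ?_⟩
      · intro l hl
        rcases List.mem_cons.1 hl with rfl | hl
        · refine ⟨(hW.take _).nodup (by simp), hc.take _, ?_, ?_⟩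
          · simp; omega
          · simp
        · exact a1 l hl
      · have : (W.take (ℓ + 1)).length = ℓ + 1 := by simp; omega
        rw [List.filter_cons_of_neg (by simpa using this)]
        exact a2
      · rw [List.flatMap_cons, a3]
        have e1 : W.drop ℓ = W[ℓ]'(by omega) :: W.drop (ℓ+1) := by
          rw [List.drop_eq_getElem_cons (by omega)]
        have e2 : W.take (ℓ + 1) = W.take ℓ ++ [W[ℓ]'(by omega)] := by
          rw [List.take_succ_eq_append_getElem (by omega)]
        rw [e1, e2, ← pe_append, ← e1, List.take_append_drop]

section tour
variable {H V : Type} (Lh : H → List V)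

/-- concatenation -/
def tour : List H → List V
  | [] => []
  | h :: t => Lh h ++ (tour t).tail

/-- compatible -/
def cpt (ℓ : ℕ) (h g : H) : Prop :=
  (Lh h).getLast? = (Lh g).head? ∧
  ∀ p q, 1 ≤ p → 1 ≤ q → p + q ≤ ℓ → (Lh h).reverse[p]? ≠ (Lh g)[q]?

lemma tour_spec (R : V → V → Prop) (ℓ : ℕ) (hℓ : 1 ≤ ℓ) (hlen : ∀ h, ℓ + 1 ≤ (Lh h).length) (hnd : ∀ h, (Lh h).Nodup)
    (hch : ∀ h, (Lh h).IsChain R) : ∀ hs : List H, hs.IsChain (cpt Lh ℓ) →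
      WG ℓ (tour Lh hs) ∧ (tour Lh hs).IsChain R ∧ pe (tour Lh hs) = hs.flatMap (fun h => pe (Lh h)) := by
  intro hs
  induction hs with
  | nil => intro _; simp [tour, WG, pe]
  | cons h t ih =>
    intro hc
    cases t with
    | nil =>
      simp only [tour, List.tail_nil, List.append_nil, List.flatMap_cons, List.flatMap_nil]
      refine ⟨?_, hch h, trivial⟩
      intro i j hij _ hj
      exact (List.nodup_iff_getElem?_ne_getElem?.1 (hnd h)) i j hij hj
    | cons g t =>
      obtain ⟨⟨e1, e2⟩, hc2⟩ := List.isChain_cons_cons.1 hc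
      obtain ⟨w1, w2, w3⟩ := ih hc2
      set W := tour Lh (g :: t) with hW
      have hWg : W = Lh g ++ (tour Lh t).tail := rfl
      have hg0 := hlen g
      have hh0 := hlen h
      -- decompose
      obtain ⟨A, x, hA⟩ : ∃ A x, Lh h = A ++ [x] := by
        rcases List.eq_nil_or_concat (Lh h) with h0 | ⟨A, x, h0⟩
        · rw [h0] at hh0; simp at hh0
        · exact ⟨A, x, by simpa using h0⟩
      have hWx : W = x :: W.tail := by
        have h1 : (Lh g).head? = some x := by rw [← e1, hA]; simp
        cases hgl : Lh g with
        | nil => rw [hgl] at hg0; simp at hg0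
        | cons y l =>
          rw [hgl] at h1
          simp at h1
          rw [hWg, hgl, h1]; simp
      have htour : tour Lh (h :: g :: t) = A ++ W := by
        conv_rhs => rw [hWx]
        simp only [tour] at *
        rw [hA]; simp [hWg]
      rw [htour]
      have hAl : A.length + 1 = (Lh h).length := by rw [hA]; simp
      refine ⟨?_, ?_, ?_⟩
      · intro i j hij hjl hj
        rw [List.length_append] at hj
        by_cases c1 : j ≤ A.length
        · have := (List.nodup_iff_getElem?_ne_getElem?.1 (hnd h)) i j hij (by omega)
          have hk : ∀ k, k ≤ A.length → (A ++ W)[k]? = (Lh h)[k]? := by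
            intro k hk
            rw [hA, hWx]
            by_cases hk' : k < A.length
            · rw [List.getElem?_append_left hk', List.getElem?_append_left hk']
            · have : k = A.length := by omega
              subst this
              simp
          rw [hk i (by omega), hk j c1]
          exact this
        · by_cases c2 : A.length ≤ i
          · rw [List.getElem?_append_right c2, List.getElem?_append_right (by omega)]
            exact w1 _ _ (by omega) (by omega) (by omega)
          · have := e2 (A.length - i) (j - A.length) (by omega) (by omega) (by omega)
            rw [List.getElem?_append_left (by omega), List.getElem?_append_right (by omega)]
            have q1 : (Lh h).reverse[A.length - i]? = A[i]? := by
              rw [List.getElem?_reverse (by omega), hA, List.length_append, List.length_singleton,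
                show A.length + 1 - 1 - (A.length - i) = i by omega, List.getElem?_append_left (by omega)]
            have q2 : (Lh g)[j - A.length]? = W[j - A.length]? := by
              rw [hWg, List.getElem?_append_left (by omega)]
            rw [q1, q2] at this
            exact this
      · have hchh := hch h
        rw [hA] at hchh
        rw [hWx] at w2 ⊢
        rw [List.isChain_split]
        exact ⟨hchh, w2⟩
      · rw [List.flatMap_cons, ← w3, hA]
        conv_lhs => rw [hWx]
        rw [pe_append, ← hWx]

end tour

lemma list_walk {V : Type} (G : SimpleGraph V) : ∀ (l : List V), l.IsChain G.Adj → l ≠ [] →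
    ∃ p : Σ u : V, Σ v : V, G.Walk u v, p.2.2.support = l ∧ p.2.2.edges = pe l := by
  intro l
  induction l with
  | nil => intro _ h; exact absurd rfl h
  | cons x t ih =>
    intro hc _
    cases t with
    | nil => exact ⟨⟨x, x, SimpleGraph.Walk.nil⟩, by simp, by simp [pe]⟩
    | cons y t =>
      obtain ⟨h1, h2⟩ := List.isChain_cons_cons.1 hc
      obtain ⟨⟨u, v, p⟩, e1, e2⟩ := ih h2 (by simp)
      have hu : u = y := by
        have := p.cons_tail_support
        simp only at e1
        rw [e1] at this
        simp at this
        exact this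
      subst hu
      exact ⟨⟨x, v, SimpleGraph.Walk.cons h1 p⟩, by simpa using e1, by simpa [pe] using e2⟩

theorem final_lists {V : Type} (G : SimpleGraph V) (ℓ : ℕ) (LL : List (List V))
    (h1 : ∀ l ∈ LL, l.Nodup ∧ l.IsChain G.Adj ∧ 2 ≤ l.length ∧ l.length ≤ ℓ + 1)
    (h2 : (LL.filter (fun l => l.length ≠ ℓ + 1)).length ≤ 1)
    (h3 : (LL.flatMap pe).Nodup) (h4 : ∀ e, e ∈ G.edgeSet ↔ e ∈ LL.flatMap pe) :
    ∃ P : Finset (Σ u : V, Σ v : V, G.Walk u v),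
        (∀ p ∈ P, p.2.2.IsPath ∧ 1 ≤ p.2.2.length ∧ p.2.2.length ≤ ℓ) ∧
        ((P.filter (fun p => p.2.2.length ≠ ℓ)).card ≤ 1) ∧
        (∀ p ∈ P, ∀ q ∈ P, p ≠ q → ∀ e, e ∈ p.2.2.edges → e ∉ q.2.2.edges) ∧
        (∀ e : Sym2 V, e ∈ G.edgeSet ↔ ∃ p ∈ P, e ∈ p.2.2.edges) := by
  by_cases hV : Nonempty V
  swap
  · have : LL = [] := by
      cases LL with
      | nil => rfl
      | cons l LL =>
        have := (h1 l (by simp)).2.2.1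
        cases l with
        | nil => simp at this
        | cons x l => exact absurd ⟨x⟩ hV
    subst this
    refine ⟨∅, by simp, by simp, by simp, fun e => by rw [h4]; simp⟩
  obtain ⟨v0⟩ := hV
  have : ∀ l : List V, ∃ p : Σ u : V, Σ v : V, G.Walk u v, l ∈ LL → p.2.2.support = l ∧ p.2.2.edges = pe l := by
    intro l
    by_cases hl : l ∈ LL
    · obtain ⟨p, hp⟩ := list_walk G l (h1 l hl).2.1 (fun h => by have := (h1 l hl).2.2.1; rw [h] at this; simp at this)
      exact ⟨p, fun _ => hp⟩
    · exact ⟨⟨v0, v0, SimpleGraph.Walk.nil⟩, fun h => absurd h hl⟩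
  choose w hw using this
  have hlen : ∀ l ∈ LL, (w l).2.2.length + 1 = l.length := by
    intro l hl
    rw [← SimpleGraph.Walk.length_support, (hw l hl).1]
  refine ⟨(LL.map w).toFinset, ?_, ?_, ?_, ?_⟩
  · intro p hp
    simp only [List.mem_toFinset, List.mem_map] at hp
    obtain ⟨l, hl, rfl⟩ := hp
    have := hlen l hl
    obtain ⟨a1, a2, a3, a4⟩ := h1 l hl
    refine ⟨?_, by omega, by omega⟩
    rw [SimpleGraph.Walk.isPath_def, (hw l hl).1]
    exact a1
  · refine le_trans ?_ h2
    have hsub : (LL.map w).toFinset.filter (fun p => p.2.2.length ≠ ℓ) ⊆ ((LL.filter (fun l => l.length ≠ ℓ + 1)).map w).toFinset := by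
      intro p hp
      simp only [Finset.mem_filter, List.mem_toFinset, List.mem_map] at hp ⊢
      obtain ⟨⟨l, hl, rfl⟩, hp⟩ := hp
      refine ⟨l, ?_, rfl⟩
      have := hlen l hl
      simp only [List.mem_filter, decide_eq_true_eq]
      exact ⟨hl, by omega⟩
    refine (Finset.card_le_card hsub).trans ?_
    refine (List.toFinset_card_le _).trans ?_
    simp
  · intro p hp q hq hpq e he he'
    simp only [List.mem_toFinset, List.mem_map] at hp hq
    obtain ⟨l, hl, rfl⟩ := hp
    obtain ⟨l', hl', rfl⟩ := hq
    rw [(hw l hl).2] at he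
    rw [(hw l' hl').2] at he'
    have hne : l ≠ l' := fun h => hpq (by rw [h])
    rw [List.nodup_flatMap] at h3
    have hsy : Std.Symm (Function.onFun List.Disjoint (pe : List V → List (Sym2 V))) :=
      ⟨fun a b h x hx hx' => h hx' hx⟩
    exact h3.2.forall hl hl' hne he he'
  · intro e
    rw [h4]
    simp only [List.mem_flatMap, List.mem_toFinset, List.mem_map]
    constructor
    · rintro ⟨l, hl, he⟩
      exact ⟨w l, ⟨l, hl, rfl⟩, by rw [(hw l hl).2]; exact he⟩
    · rintro ⟨p, ⟨l, hl, rfl⟩, he⟩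
      exact ⟨l, hl, by rw [(hw l hl).2] at he; exact he⟩

/-- indicator in ZMod 2 -/
noncomputable def ind {V : Type} (u v : V) : ZMod 2 := if u = v then 1 else 0
/-- incidence in ZMod 2 -/
noncomputable def inc2 {V : Type} (v : V) (e : Sym2 V) : ZMod 2 := if v ∈ e then 1 else 0

lemma inc2_mk {V : Type} (v x y : V) (h : x ≠ y) : inc2 v s(x, y) = ind x v + ind y v := by
  unfold inc2 ind
  by_cases c1 : x = v
  · subst c1; simp [h.symm]
  · by_cases c2 : y = v
    · subst c2; simp [h]
    · simp [c1, c2, Ne.symm c1, Ne.symm c2]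

/-- parity contributions -/
lemma pe_par {V : Type} (v : V) : ∀ (l : List V) (hl : l ≠ []), l.IsChain (· ≠ ·) →
    ((pe l).map (inc2 v)).sum = ind (l.head hl) v + ind (l.getLast hl) v := by
  have hz : ∀ z : ZMod 2, z + z = 0 := CharTwo.add_self_eq_zero
  intro l
  induction l with
  | nil => intro h; exact absurd rfl h
  | cons x t ih =>
    intro _ hc
    cases t with
    | nil => simp only [pe, List.map_nil, List.sum_nil, List.head_cons, List.getLast_singleton, hz]
    | cons y t =>
      obtain ⟨h1, h2⟩ := List.isChain_cons_cons.1 hc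
      have := ih (by simp) h2
      simp only [pe, List.map_cons, List.sum_cons, this, List.head_cons, inc2_mk v x y h1,
        List.getLast_cons_cons]
      rw [show ind x v + ind y v + (ind y v + ind ((y :: t).getLast (by simp)) v) =
        ind x v + (ind y v + ind y v) + ind ((y :: t).getLast (by simp)) v by ring, hz, add_zero]

end PD

namespace PD

lemma mem_of_mem_pe {V : Type} : ∀ (l : List V) (e : Sym2 V), e ∈ pe l → ∀ v ∈ e, v ∈ l := by
  intro l
  induction l with
  | nil => intro e he; simp [pe] at he
  | cons x t ih =>
    intro e he v hv
    cases t with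
    | nil => simp [pe] at he
    | cons y t =>
      simp only [pe, List.mem_cons] at he
      rcases he with rfl | he
      · rw [Sym2.mem_iff] at hv
        rcases hv with rfl | rfl <;> simp
      · exact List.mem_cons_of_mem _ (ih e he v hv)

lemma pe_nodup {V : Type} : ∀ (l : List V), l.Nodup → (pe l).Nodup := by
  intro l
  induction l with
  | nil => intro _; simp [pe]
  | cons x t ih =>
    intro hn
    cases t with
    | nil => simp [pe]
    | cons y t =>
      simp only [pe, List.nodup_cons]
      rw [List.nodup_cons] at hn
      refine ⟨fun h => hn.1 (mem_of_mem_pe _ _ h x (by simp)), ih hn.2⟩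

theorem pool {V : Type} [Fintype V] (ℓ : ℕ) (hℓ : 1 ≤ ℓ) : ∀ (n : ℕ) (E : Finset (Sym2 V)), E.card ≤ n → (∀ e ∈ E, ¬ e.IsDiag) →
    ∃ (RR : List (List V)) (o : Sym2 V → V),
      (∀ l ∈ RR, l.Nodup ∧ l.length = ℓ + 1 ∧ ∀ e ∈ pe l, e ∈ E) ∧ (RR.flatMap pe).Nodup ∧
      (∀ e ∈ E, e ∉ RR.flatMap pe → o e ∈ e) ∧
      (∀ v, (E.filter (fun e => e ∉ RR.flatMap pe ∧ o e = v)).card ≤ ℓ) := by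
  intro n
  induction n with
  | zero =>
    intro E hE hd
    have : E = ∅ := by simpa using hE
    subst this
    refine ⟨[], fun e => e.out.1, by simp, by simp, by simp, by simp⟩
  | succ n ih =>
    intro E hE hd
    by_cases hsmall : ∃ v, 1 ≤ (E.filter (fun e => v ∈ e)).card ∧ (E.filter (fun e => v ∈ e)).card ≤ ℓ
    · obtain ⟨v, hv1, hv2⟩ := hsmall
      have hc := Finset.card_filter_add_card_filter_not (s := E) (fun e => v ∈ e)
      obtain ⟨RR, o, a1, a2, a3, a4⟩ := ih (E.filter (fun e => ¬ v ∈ e)) (by omega)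
        (fun e he => hd e (Finset.mem_of_mem_filter e he))
      have hnot : ∀ e, v ∈ e → e ∉ RR.flatMap pe := by
        intro e hve he
        obtain ⟨l, hl, hel⟩ := List.mem_flatMap.1 he
        have := (a1 l hl).2.2 e hel
        exact (Finset.mem_filter.1 this).2 hve
      refine ⟨RR, fun e => if v ∈ e then v else o e, ?_, a2, ?_, ?_⟩
      · intro l hl
        refine ⟨(a1 l hl).1, (a1 l hl).2.1, fun e he => Finset.mem_of_mem_filter e ((a1 l hl).2.2 e he)⟩
      · intro e he hne
        by_cases hve : v ∈ e
        · simp [hve]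
        · simp only [hve, if_false]
          exact a3 e (Finset.mem_filter.2 ⟨he, hve⟩) hne
      · intro w
        by_cases hw : w = v
        · subst hw
          refine le_trans (Finset.card_le_card ?_) hv2
          intro e he
          simp only [Finset.mem_filter] at he ⊢
          refine ⟨he.1, ?_⟩
          by_contra hwe
          have h2 := he.2.2
          simp only [hwe, if_false] at h2
          have := a3 e (Finset.mem_filter.2 ⟨he.1, hwe⟩) he.2.1
          rw [h2] at this
          exact hwe this
        · refine le_trans (Finset.card_le_card ?_) (a4 w)
          intro e he
          simp only [Finset.mem_filter] at he ⊢
          by_cases hve : v ∈ e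
          · have := he.2.2; simp only [hve, if_true] at this; exact absurd this.symm hw
          · have := he.2.2; simp only [hve, if_false] at this
            exact ⟨⟨he.1, hve⟩, he.2.1, this⟩
    · push Not at hsmall
      by_cases hE0 : E = ∅
      · subst hE0
        refine ⟨[], fun e => e.out.1, by simp, by simp, by simp, by simp⟩
      obtain ⟨e0, he0⟩ := Finset.nonempty_iff_ne_empty.2 hE0
      have hpath : ∀ k ≤ ℓ, ∃ (x : V) (l : List V), (x :: l).Nodup ∧ (x :: l).length = k + 1 ∧ (∀ e ∈ pe (x :: l), e ∈ E) ∧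
          1 ≤ (E.filter (fun e => x ∈ e)).card := by
        intro k
        induction k with
        | zero =>
          intro _
          refine ⟨e0.out.1, [], by simp, by simp, by simp [pe], ?_⟩
          rw [Nat.one_le_iff_ne_zero, ← Nat.pos_iff_ne_zero, Finset.card_pos]
          exact ⟨e0, Finset.mem_filter.2 ⟨he0, Sym2.out_fst_mem e0⟩⟩
        | succ k ihk =>
          intro hk
          obtain ⟨x, l, b1, b2, b3, b4⟩ := ihk (by omega)
          have hbig := hsmall x b4
          obtain ⟨y, hy, hyl⟩ : ∃ y, s(x, y) ∈ E ∧ y ∉ x :: l := by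
            by_contra hcon
            push Not at hcon
            have hsub : E.filter (fun e => x ∈ e) ⊆ ((x :: l).toFinset).image (fun y => s(x, y)) := by
              intro e he
              obtain ⟨h1, h2⟩ := Finset.mem_filter.1 he
              obtain ⟨y, rfl⟩ := h2
              rw [Finset.mem_image]
              exact ⟨y, by rw [List.mem_toFinset]; exact hcon y h1, rfl⟩
            have h1 := Finset.card_le_card hsub
            have h2 : (((x :: l).toFinset).image (fun y => s(x, y))).card ≤ ((x :: l).toFinset).card := Finset.card_image_le
            have h3 := List.toFinset_card_le (x :: l)
            omega
          refine ⟨y, x :: l, List.nodup_cons.2 ⟨hyl, b1⟩, by simp at b2 ⊢; omega, ?_, ?_⟩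
          · intro e he
            simp only [pe, List.mem_cons] at he
            rcases he with rfl | he
            · rw [Sym2.eq_swap]; exact hy
            · exact b3 e he
          · rw [Nat.one_le_iff_ne_zero, ← Nat.pos_iff_ne_zero, Finset.card_pos]
            exact ⟨s(x, y), Finset.mem_filter.2 ⟨hy, by simp⟩⟩
      obtain ⟨x, l, b1, b2, b3, b4⟩ := hpath ℓ le_rfl
      have hmem : ∃ e, e ∈ pe (x :: l) := by
        cases l with
        | nil => simp at b2; omega
        | cons y l => exact ⟨s(x, y), by simp [pe]⟩
      obtain ⟨e1, he1⟩ := hmem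
      obtain ⟨RR, o, a1, a2, a3, a4⟩ := ih (E.filter (fun e => ¬ e ∈ pe (x :: l))) (by
          have : (E.filter (fun e => ¬ e ∈ pe (x :: l))).card < E.card := by
            apply Finset.card_lt_card
            rw [Finset.ssubset_iff_of_subset (Finset.filter_subset _ _)]
            exact ⟨e1, b3 e1 he1, fun h => (Finset.mem_filter.1 h).2 he1⟩
          omega)
        (fun e he => hd e (Finset.mem_of_mem_filter e he))
      refine ⟨(x :: l) :: RR, o, ?_, ?_, ?_, ?_⟩
      · intro l' hl'
        rcases List.mem_cons.1 hl' with rfl | hl'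
        · exact ⟨b1, b2, b3⟩
        · exact ⟨(a1 l' hl').1, (a1 l' hl').2.1, fun e he => Finset.mem_of_mem_filter e ((a1 l' hl').2.2 e he)⟩
      · rw [List.flatMap_cons, List.nodup_append]
        refine ⟨pe_nodup _ b1, a2, ?_⟩
        rintro e he e' he' rfl
        obtain ⟨l', hl', hel⟩ := List.mem_flatMap.1 he'
        exact (Finset.mem_filter.1 ((a1 l' hl').2.2 e hel)).2 he
      · intro e he hne
        rw [List.flatMap_cons, List.mem_append] at hne
        push Not at hne
        exact a3 e (Finset.mem_filter.2 ⟨he, hne.1⟩) hne.2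
      · intro v
        refine le_trans (Finset.card_le_card ?_) (a4 v)
        intro e he
        simp only [Finset.mem_filter] at he ⊢
        obtain ⟨h1, h2, h3⟩ := he
        rw [List.flatMap_cons, List.mem_append] at h2
        push Not at h2
        exact ⟨⟨h1, h2.1⟩, h2.2, h3⟩

end PD

namespace PD

lemma pe_reverse {V : Type} : ∀ l : List V, pe l.reverse = (pe l).reverse := by
  intro l
  induction l with
  | nil => simp [pe]
  | cons x t ih =>
    cases t with
    | nil => simp [pe]
    | cons y t =>
      rw [List.reverse_cons, List.reverse_cons, List.append_assoc]
      simp only [List.singleton_append]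
      rw [pe_append, ← List.reverse_cons, ih]
      simp [pe, Sym2.eq_swap]

/-- oriented list -/
def orl {I V : Type} (L : I → List V) (h : I × Bool) : List V := if h.2 then (L h.1).reverse else L h.1

/-- conflict -/
def cfl {I V : Type} (ℓ : ℕ) (L : I → List V) (g h : I × Bool) : Prop :=
  ∃ p q, 1 ≤ p ∧ 1 ≤ q ∧ p + q ≤ ℓ ∧ (orl L g)[p]? = (orl L h)[q]?

set_option maxHeartbeats 400000 in
theorem tour_thm {V I Dm : Type} [Fintype V] [Fintype I] [Fintype Dm] [Subsingleton Dm] (R : V → V → Prop)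
    (hR : ∀ a b, R a b → R b a) (ℓ : ℕ) (hℓ : 1 ≤ ℓ)
    (L : I → List V) (hlen : ∀ i, ℓ + 1 ≤ (L i).length) (hnd : ∀ i, (L i).Nodup) (hch : ∀ i, (L i).IsChain R)
    (hd tl : I → V) (hhd : ∀ i, (L i).head? = some (hd i)) (htl : ∀ i, (L i).getLast? = some (tl i))
    (da db : V) (heven : ∀ v, ∑ i, (ind (hd i) v + ind (tl i) v) + ∑ _d : Dm, (ind da v + ind db v) = 0)
    (hcn : Cn hd tl) (K : V → ℕ)
    (hK : ∀ g : I × Bool, (Finset.univ.filter (fun h : I × Bool =>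
      (orl L h).head? = (orl L g).head? ∧ cfl ℓ L g h)).card ≤ K (if g.2 then tl g.1 else hd g.1))
    (hdeg : ∀ v, 4 * K v + 2 < (Finset.univ.filter (fun i => hd i = v)).card) :
    ∃ LL : List (List V), (∀ l ∈ LL, l.Nodup ∧ l.IsChain R ∧ 2 ≤ l.length ∧ l.length ≤ ℓ + 1) ∧
      (LL.filter (fun l => l.length ≠ ℓ + 1)).length ≤ 1 ∧
      (LL.flatMap pe).Perm ((Finset.univ : Finset I).toList.flatMap (fun i => pe (L i))) := by
  by_cases hI : IsEmpty I
  · exact ⟨[], by simp, by simp, by simp⟩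
  rw [not_isEmpty_iff] at hI
  obtain ⟨i0⟩ := hI
  let H := (I ⊕ Dm) × Bool
  let x : H → V := fun h => match h with
    | (.inl i, b) => if b then tl i else hd i
    | (.inr _, b) => if b then db else da
  let σ : H → H := fun h => (h.1, !h.2)
  obtain ⟨cf, hcf1, hcf2⟩ : ∃ cf : H → H → Prop, (∀ i b j c, cf (.inl i, b) (.inl j, c) ↔ cfl ℓ L (i, b) (j, c)) ∧
      (∀ g h, cf g h → (∃ i, g.1 = .inl i) ∧ (∃ i, h.1 = .inl i)) := by
    refine ⟨fun g h => ∃ i j, g.1 = .inl i ∧ h.1 = .inl j ∧ cfl ℓ L (i, g.2) (j, h.2), ?_, ?_⟩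
    · intro i b j c
      constructor
      · rintro ⟨i', j', h1, h2, h3⟩
        simp at h1 h2
        subst h1; subst h2
        exact h3
      · intro h; exact ⟨i, j, rfl, rfl, h⟩
    · rintro g h ⟨i, j, h1, h2, _⟩
      exact ⟨⟨i, h1⟩, ⟨j, h2⟩⟩
  have hhead : ∀ i b, (orl L (i, b)).head? = some (x (.inl i, b)) := by
    intro i b
    cases b
    · simpa [orl, x] using hhd i
    · simpa [orl, x] using htl i
  have heven' : ∀ v, Even (Finset.univ.filter (fun h => x h = v)).card := by
    intro v
    rw [← ZMod.natCast_eq_zero_iff_even, Finset.natCast_card_filter, Fintype.sum_prod_type, Fintype.sum_sum_type]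
    refine Eq.trans ?_ (heven v)
    congr 1
    · apply Finset.sum_congr rfl
      intro i _
      rw [Fintype.sum_bool]
      exact add_comm _ _
    · apply Finset.sum_congr rfl
      intro i _
      rw [Fintype.sum_bool]
      exact add_comm _ _
  have hconn' : ∀ S : V → Prop, (∀ h, S (x h) ↔ S (x (σ h))) → ∀ g g', S (x g) → S (x g') := by
    intro S hS g g' hg
    exact hcn S (fun i => hS (.inl i, false)) _ _ hg
  have hdeg' : ∀ g, 4 * K (x g) + 2 < (Finset.univ.filter (fun h => x h = x g)).card := by
    intro g
    refine lt_of_lt_of_le (hdeg (x g)) ?_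
    apply Finset.card_le_card_of_injOn (fun i => ((.inl i, false) : H))
    · intro i hi
      exact Finset.mem_filter.2 ⟨Finset.mem_univ _, (Finset.mem_filter.1 hi).2⟩
    · intro i _ j _ h; simpa using h
  have hK' : ∀ g, (Finset.univ.filter (fun h => x h = x g ∧ cf g h)).card ≤ K (x g) := by
    rintro ⟨i | d, b⟩
    · refine le_trans ?_ (hK (i, b))
      apply Finset.card_le_card_of_injOn (fun h : H => match h with
        | (.inl j, c) => ((j, c) : I × Bool)
        | (.inr _, c) => (i0, c))
      · rintro ⟨j | d, c⟩ hh
        · have hh := (Finset.mem_filter.1 hh).2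
          refine Finset.mem_filter.2 ⟨Finset.mem_univ _, ?_, ?_⟩
          · rw [hhead, hhead, hh.1]
          · exact (hcf1 _ _ _ _).1 hh.2
        · have hh := (Finset.mem_filter.1 hh).2
          obtain ⟨_, ⟨j, hj⟩⟩ := hcf2 _ _ hh.2
          simp at hj
      · rintro ⟨j | d, c⟩ hh ⟨j' | d', c'⟩ hh' he
        · simp at he; simp [he]
        · obtain ⟨_, ⟨j, hj⟩⟩ := hcf2 _ _ (Finset.mem_filter.1 hh').2.2
          simp at hj
        · obtain ⟨_, ⟨j, hj⟩⟩ := hcf2 _ _ (Finset.mem_filter.1 hh).2.2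
          simp at hj
        · obtain ⟨_, ⟨j, hj⟩⟩ := hcf2 _ _ (Finset.mem_filter.1 hh).2.2
          simp at hj
    · rw [Finset.card_eq_zero.2]
      · exact Nat.zero_le _
      · rw [Finset.filter_eq_empty_iff]
        rintro h _ ⟨_, hc⟩
        obtain ⟨⟨j, hj⟩, _⟩ := hcf2 _ _ hc
        simp at hj
  have hsymm : ∀ g h, cf g h → cf h g := by
    rintro ⟨g, b⟩ ⟨h, c⟩ hc
    obtain ⟨⟨i, hi⟩, ⟨j, hj⟩⟩ := hcf2 _ _ hc
    simp only at hi hj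
    subst hi; subst hj
    rw [hcf1] at hc ⊢
    obtain ⟨p, q, h1, h2, h3, h4⟩ := hc
    exact ⟨q, p, h2, h1, by omega, h4.symm⟩
  let h0 : H := if h : Nonempty Dm then (.inr h.some, false) else (.inl i0, false)
  obtain ⟨n, q, q0, qn, npos, q1, q2, qinj, qσ, qall⟩ := circuit x σ (fun p => by simp [σ])
    (fun p => by intro h; have := congrArg Prod.snd h; simp [σ] at this) heven'
    hconn' cf hsymm K hK' (Or.inr hdeg') h0
  have qinj' : ∀ j < n, ∀ k < n, (q j).1 = (q k).1 → j = k := by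
    intro j hj k hk h1
    apply qinj j hj k hk
    have h2 := qσ j k
    by_contra hne
    apply h2
    refine Prod.ext h1 ?_
    have : (q j).2 ≠ (q k).2 := fun h => hne (Prod.ext h1 h)
    simp only [σ]
    revert this
    cases (q j).2 <;> cases (q k).2 <;> simp
  have qall' : ∀ m, ∃ k < n, (q k).1 = m := by
    intro m
    obtain ⟨k, hk, h | h⟩ := qall (m, false)
    · exact ⟨k, hk, by rw [h]⟩
    · exact ⟨k, hk, by rw [h]⟩
  obtain ⟨s, hsn, hs1, hs2⟩ : ∃ s, s ≤ n ∧ (∀ k, s ≤ k → k < n → ∃ i, (q k).1 = .inl i) ∧ (∀ i, ∃ k, s ≤ k ∧ k < n ∧ (q k).1 = .inl i) := by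
    by_cases hD : Nonempty Dm
    · have hq0 : q 0 = (.inr hD.some, false) := by rw [q0]; simp [h0, hD]
      refine ⟨1, npos, ?_, ?_⟩
      · intro k hk hkn
        rcases hqk : (q k).1 with i | d
        · exact ⟨i, rfl⟩
        · have := qinj' 0 npos k hkn (by rw [hq0, hqk, Subsingleton.elim d hD.some])
          omega
      · intro i
        obtain ⟨k, hk, hki⟩ := qall' (.inl i)
        refine ⟨k, ?_, hk, hki⟩
        by_contra hk0
        have : k = 0 := by omega
        subst this
        rw [hq0] at hki
        simp at hki
    · refine ⟨0, Nat.zero_le _, ?_, ?_⟩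
      · intro k _ _
        rcases hqk : (q k).1 with i | d
        · exact ⟨i, rfl⟩
        · exact absurd ⟨d⟩ hD
      · intro i
        obtain ⟨k, hk, hki⟩ := qall' (.inl i)
        exact ⟨k, Nat.zero_le _, hk, hki⟩
  have : ∀ k, ∃ g : I × Bool, s ≤ k → k < n → q k = (.inl g.1, g.2) := by
    intro k
    by_cases hk : s ≤ k ∧ k < n
    · obtain ⟨i, hi⟩ := hs1 k hk.1 hk.2
      exact ⟨(i, (q k).2), fun _ _ => Prod.ext hi rfl⟩
    · exact ⟨(i0, false), fun h1 h2 => absurd ⟨h1, h2⟩ hk⟩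
  choose g hg using this
  let hs : List (I × Bool) := (List.range' s (n - s)).map g
  have hchain : hs.IsChain (cpt (orl L) ℓ) := by
    rw [List.isChain_iff_getElem]
    intro k hk
    simp only [hs, List.length_map, List.length_range'] at hk
    simp only [hs, List.getElem_map, List.getElem_range', one_mul]
    have e1 := hg (s + k) (by omega) (by omega)
    have e2 := hg (s + (k + 1)) (by omega) (by omega)
    have hx := q1 (s + k)
    have hc := q2 (s + k)
    rw [add_assoc, e1, e2] at hx hc
    generalize g (s + k) = g1 at *
    generalize g (s + (k + 1)) = g2 at *
    obtain ⟨i1, b1⟩ := g1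
    obtain ⟨i2, b2⟩ := g2
    have hrev : (orl L (i1, b1)).reverse = orl L (i1, !b1) := by
      cases b1 <;> simp [orl]
    refine ⟨?_, ?_⟩
    · rw [← List.head?_reverse, hrev, hhead, hhead]
      exact congrArg some hx.symm
    · intro p r hp hr hpr he
      apply hc
      show cf (.inl i1, !b1) (.inl i2, b2)
      rw [hcf1]
      exact ⟨p, r, hp, hr, hpr, by rw [← hrev]; exact he⟩
  obtain ⟨w1, w2, w3⟩ := tour_spec (orl L) R ℓ hℓ (by rintro ⟨i, b⟩; cases b <;> simpa [orl] using hlen i)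
    (by rintro ⟨i, b⟩; cases b <;> simpa [orl] using hnd i)
    (by
      rintro ⟨i, b⟩
      cases b
      · simpa [orl] using hch i
      · simp only [orl, if_true]
        rw [List.isChain_reverse]
        exact (hch i).imp (fun a b h => hR _ _ h)) hs hchain
  obtain ⟨LL, a1, a2, a3⟩ := chop R ℓ hℓ _ _ le_rfl w1 w2
  refine ⟨LL, a1, a2, ?_⟩
  rw [a3, w3]
  have hperm1 : ∀ hs : List (I × Bool), (hs.flatMap (fun h => pe (orl L h))).Perm ((hs.map Prod.fst).flatMap (fun i => pe (L i))) := by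
    intro hs
    rw [List.flatMap_map]
    apply List.Perm.flatMap_left
    rintro ⟨i, b⟩ _
    cases b
    · simp [orl]
    · simp only [orl, if_true, pe_reverse]
      exact List.reverse_perm _
  refine (hperm1 hs).trans ?_
  apply List.Perm.flatMap_right
  rw [List.perm_ext_iff_of_nodup]
  · intro i
    simp only [Finset.mem_toList, Finset.mem_univ, iff_true]
    obtain ⟨k, hk1, hk2, hk3⟩ := hs2 i
    simp only [hs, List.map_map, List.mem_map, Function.comp]
    refine ⟨k, ?_, ?_⟩
    · rw [List.mem_range'_1]; omega
    · rw [hg k hk1 hk2] at hk3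
      simpa using hk3
  · simp only [hs, List.map_map]
    apply List.Nodup.map_on
    · intro j hj k hk h
      rw [List.mem_range'_1] at hj hk
      apply qinj' j (by omega) k (by omega)
      rw [hg j (by omega) (by omega), hg k (by omega) (by omega)]
      simp only [Function.comp] at h
      simp [h]
    · exact List.nodup_range'
  · exact Finset.nodup_toList _

end PD

namespace PD

theorem assign {V I X : Type} [Fintype V] [Fintype I] [Fintype X] (ℓ B : ℕ) (y xx : X → V) (p : I → ℕ → V)
    (D θ : V → ℕ) (hθ : ∀ v, 0 < θ v)
    (h1 : ∀ u v k, 1 ≤ k → k ≤ ℓ → (Finset.univ.filter (fun i => p i 0 = u ∧ p i k = v)).card ≤ D u)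
    (h2 : ∀ x, ℓ * (Finset.univ.filter (fun e => xx e = x)).card ≤ B * θ x)
    (h3 : ∀ v, (Finset.univ.filter (fun e => y e = v)).card + ℓ * ((B + 1) * D v) <
      (Finset.univ.filter (fun i => p i 0 = v)).card) :
    ∃ π : X → I, Function.Injective π ∧ (∀ e, p (π e) 0 = y e) ∧ (∀ e k, 1 ≤ k → k ≤ ℓ → xx e ≠ p (π e) k) ∧
      (∀ x w, (Finset.univ.filter (fun e => xx e = x ∧ ∃ k, 1 ≤ k ∧ k ≤ ℓ ∧ p (π e) k = w)).card ≤ θ x) := by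
  suffices H : ∀ s : Finset X, ∃ π : X → I, Set.InjOn π s ∧ (∀ e ∈ s, p (π e) 0 = y e) ∧
      (∀ e ∈ s, ∀ k, 1 ≤ k → k ≤ ℓ → xx e ≠ p (π e) k) ∧
      (∀ x w, (s.filter (fun e => xx e = x ∧ ∃ k, 1 ≤ k ∧ k ≤ ℓ ∧ p (π e) k = w)).card ≤ θ x) by
    obtain ⟨π, a, b, c, d⟩ := H Finset.univ
    exact ⟨π, fun e e' h => a (by simp) (by simp) h, fun e => b e (by simp), fun e => c e (by simp), d⟩
  intro s
  induction s using Finset.induction_on with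
  | empty =>
    have : ∀ e : X, ∃ i : I, True := by
      intro e
      have := h3 (y e)
      obtain ⟨i, hi⟩ := Finset.card_pos.1 (lt_of_le_of_lt (Nat.zero_le _) this)
      exact ⟨i, trivial⟩
    choose π hπ using this
    exact ⟨π, by simp, by simp, by simp, by simp⟩
  | insert e0 s he0 ih =>
    obtain ⟨π, a, b, c, d⟩ := ih
    obtain ⟨Sat, hSat⟩ : ∃ Sat : Finset V, ∀ w, w ∈ Sat ↔ θ (xx e0) ≤
        (s.filter (fun e => xx e = xx e0 ∧ ∃ k, 1 ≤ k ∧ k ≤ ℓ ∧ p (π e) k = w)).card :=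
      ⟨Finset.univ.filter (fun w => θ (xx e0) ≤
        (s.filter (fun e => xx e = xx e0 ∧ ∃ k, 1 ≤ k ∧ k ≤ ℓ ∧ p (π e) k = w)).card), by simp⟩
    have hSc : Sat.card ≤ B := by
      have e1 : Sat.card * θ (xx e0) ≤ ∑ w ∈ Sat, (s.filter (fun e => xx e = xx e0 ∧ ∃ k, 1 ≤ k ∧ k ≤ ℓ ∧ p (π e) k = w)).card := by
        rw [← smul_eq_mul, ← Finset.sum_const]
        exact Finset.sum_le_sum (fun w hw => (hSat w).1 hw)
      have e2 : ∑ w ∈ Sat, (s.filter (fun e => xx e = xx e0 ∧ ∃ k, 1 ≤ k ∧ k ≤ ℓ ∧ p (π e) k = w)).card ≤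
          ((Finset.univ.filter (fun e => xx e = xx e0)) ×ˢ (Finset.Icc 1 ℓ)).card := by
        rw [← Finset.card_sigma]
        have hch : ∀ z : (Σ _ : V, X), ∃ k, z ∈ Sat.sigma (fun w => s.filter (fun e => xx e = xx e0 ∧ ∃ k, 1 ≤ k ∧ k ≤ ℓ ∧ p (π e) k = w)) →
            1 ≤ k ∧ k ≤ ℓ ∧ p (π z.2) k = z.1 := by
          intro z
          by_cases hz : z ∈ Sat.sigma (fun w => s.filter (fun e => xx e = xx e0 ∧ ∃ k, 1 ≤ k ∧ k ≤ ℓ ∧ p (π e) k = w))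
          · rw [Finset.mem_sigma, Finset.mem_filter] at hz
            obtain ⟨k, hk⟩ := hz.2.2.2
            exact ⟨k, fun _ => hk⟩
          · exact ⟨0, fun h => absurd h hz⟩
        choose kk hkk using hch
        apply Finset.card_le_card_of_injOn (fun z => (z.2, kk z))
        · intro z hz
          have := hkk z hz
          have hz := (Finset.mem_filter.1 (Finset.mem_sigma.1 hz).2).2.1
          exact Finset.mem_coe.2 (Finset.mem_product.2 ⟨by simpa using hz, by simp [this.1, this.2.1]⟩)
        · rintro ⟨w, e⟩ hz ⟨w', e'⟩ hz' h
          have a1 := (hkk _ hz).2.2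
          have a2 := (hkk _ hz').2.2
          simp only [Prod.mk.injEq] at h
          obtain ⟨h', h''⟩ := h
          subst h'
          rw [h''] at a1
          simp only at a1 a2
          have : w = w' := a1.symm.trans a2
          subst this; rfl
      rw [Finset.card_product, Nat.card_Icc] at e2
      have e3 := h2 (xx e0)
      have : Sat.card * θ (xx e0) ≤ B * θ (xx e0) := by
        refine (e1.trans e2).trans (le_trans (le_of_eq ?_) e3)
        rw [Nat.add_sub_cancel, mul_comm]
      exact Nat.le_of_mul_le_mul_right this (hθ _)
    obtain ⟨i, hi0, hi1, hi2⟩ : ∃ i, p i 0 = y e0 ∧ i ∉ (s.filter (fun e => y e = y e0)).image π ∧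
        ∀ k, 1 ≤ k → k ≤ ℓ → ∀ w ∈ insert (xx e0) Sat, p i k ≠ w := by
      by_contra hcon
      push Not at hcon
      have : Finset.univ.filter (fun i => p i 0 = y e0) ⊆ (s.filter (fun e => y e = y e0)).image π ∪
          (Finset.Icc 1 ℓ).biUnion (fun k => (insert (xx e0) Sat).biUnion (fun w =>
            Finset.univ.filter (fun i => p i 0 = y e0 ∧ p i k = w))) := by
        intro i hi
        rw [Finset.mem_filter] at hi
        rw [Finset.mem_union]
        by_cases hu : i ∈ (s.filter (fun e => y e = y e0)).image π
        · exact Or.inl hu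
        · right
          obtain ⟨k, k1, k2, w, hw, hk⟩ := hcon i hi.2 hu
          rw [Finset.mem_biUnion]
          refine ⟨k, by simp [k1, k2], ?_⟩
          rw [Finset.mem_biUnion]
          exact ⟨w, hw, by simp [hi.2, hk]⟩
      have hc := Finset.card_le_card this
      have hc1 := hc.trans (Finset.card_union_le _ _)
      have b1 : ((s.filter (fun e => y e = y e0)).image π).card ≤ (Finset.univ.filter (fun e => y e = y e0)).card :=
        Finset.card_image_le.trans (Finset.card_le_card (Finset.filter_subset_filter _ (Finset.subset_univ _)))
      have b2 : ((Finset.Icc 1 ℓ).biUnion (fun k => (insert (xx e0) Sat).biUnion (fun w =>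
            Finset.univ.filter (fun i => p i 0 = y e0 ∧ p i k = w)))).card ≤ ℓ * ((B + 1) * D (y e0)) := by
        refine (Finset.card_biUnion_le_card_mul _ _ ((B + 1) * D (y e0)) ?_).trans (by simp)
        intro k hk
        rw [Finset.mem_Icc] at hk
        refine (Finset.card_biUnion_le_card_mul _ _ (D (y e0)) ?_).trans ?_
        · intro w _
          exact h1 _ _ k hk.1 hk.2
        · exact Nat.mul_le_mul_right _ ((Finset.card_insert_le _ _).trans (by omega))
      have := h3 (y e0)
      omega
    have hpe : ∀ e ∈ s, Function.update π e0 i e = π e := by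
      intro e he
      exact Function.update_of_ne (by rintro rfl; exact he0 he) _ _
    have hp0 : Function.update π e0 i e0 = i := Function.update_self _ _ _
    have hnot : ∀ e ∈ s, π e ≠ i := by
      intro e he h
      apply hi1
      rw [Finset.mem_image]
      refine ⟨e, ?_, h⟩
      rw [Finset.mem_filter]
      refine ⟨he, ?_⟩
      rw [← b e he, h, hi0]
    refine ⟨Function.update π e0 i, ?_, ?_, ?_, ?_⟩
    · intro e he e' he' h
      rw [Finset.mem_coe, Finset.mem_insert] at he he'
      rcases he with rfl | he <;> rcases he' with rfl | he'
      · rfl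
      · rw [hp0, hpe _ he'] at h
        exact absurd h.symm (hnot _ he')
      · rw [hp0, hpe _ he] at h
        exact absurd h (hnot _ he)
      · rw [hpe _ he, hpe _ he'] at h
        exact a he he' h
    · intro e he
      rw [Finset.mem_insert] at he
      rcases he with rfl | he
      · rw [hp0, hi0]
      · rw [hpe _ he, b e he]
    · intro e he k k1 k2
      rw [Finset.mem_insert] at he
      rcases he with rfl | he
      · rw [hp0]
        exact (hi2 k k1 k2 _ (Finset.mem_insert_self _ _)).symm
      · rw [hpe _ he]; exact c e he k k1 k2
    · intro x w
      have hold : (s.filter (fun e => xx e = x ∧ ∃ k, 1 ≤ k ∧ k ≤ ℓ ∧ p (Function.update π e0 i e) k = w)) =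
          (s.filter (fun e => xx e = x ∧ ∃ k, 1 ≤ k ∧ k ≤ ℓ ∧ p (π e) k = w)) := by
        apply Finset.filter_congr
        intro e he
        rw [hpe e he]
      rw [Finset.filter_insert]
      split_ifs with hif
      · rw [hp0] at hif
        obtain ⟨rfl, k, k1, k2, rfl⟩ := hif
        refine (Finset.card_insert_le _ _).trans ?_
        rw [hold]
        have : p i k ∉ Sat := fun h => hi2 k k1 k2 _ (Finset.mem_insert_of_mem h) rfl
        rw [hSat] at this
        omega
      · rw [hold]; exact d x w

end PD

namespace PD

/-- the vertex list of a walk of length `ℓ` -/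
def wl {V : Type} (ℓ : ℕ) (p : ℕ → V) : List V := (List.range (ℓ + 1)).map p

lemma wl_get {V : Type} (ℓ : ℕ) (p : ℕ → V) (q : ℕ) (hq : q ≤ ℓ) : (wl ℓ p)[q]? = some (p q) := by
  simp [wl, Nat.lt_succ_of_le hq]

lemma wl_len {V : Type} (ℓ : ℕ) (p : ℕ → V) : (wl ℓ p).length = ℓ + 1 := by simp [wl]

lemma wl_cons {V : Type} (ℓ : ℕ) (p : ℕ → V) : wl ℓ p = p 0 :: (List.range ℓ).map (fun k => p (k + 1)) := by
  simp [wl, List.range_succ_eq_map, Function.comp_def]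

lemma wl_last {V : Type} (ℓ : ℕ) (p : ℕ → V) : (wl ℓ p).getLast? = some (p ℓ) := by
  simp [wl, List.range_succ]

lemma wl_rev {V : Type} (ℓ : ℕ) (p : ℕ → V) (q : ℕ) (hq : q ≤ ℓ) : (wl ℓ p).reverse[q]? = some (p (ℓ - q)) := by
  rw [List.getElem?_reverse (by rw [wl_len]; omega), wl_len, wl_get _ _ _ (by omega)]
  congr 2

lemma wl_nodup {V : Type} (ℓ : ℕ) (p : ℕ → V) (h : ∀ j ≤ ℓ, ∀ k ≤ ℓ, p j = p k → j = k) : (wl ℓ p).Nodup := by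
  apply List.Nodup.map_on
  · intro j hj k hk
    rw [List.mem_range] at hj hk
    exact h j (by omega) k (by omega)
  · exact List.nodup_range

lemma wl_chain {V : Type} (ℓ : ℕ) (p : ℕ → V) (R : V → V → Prop) (h : ∀ k < ℓ, R (p k) (p (k + 1))) :
    (wl ℓ p).IsChain R := by
  rw [List.isChain_iff_getElem]
  intro k hk
  rw [wl_len] at hk
  simpa [wl] using h k (by omega)

lemma wl_mem {V : Type} (ℓ : ℕ) (p : ℕ → V) (x : V) : x ∈ wl ℓ p ↔ ∃ k ≤ ℓ, p k = x := by
  simp [wl]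

lemma pe_wl {V : Type} (ℓ : ℕ) : ∀ (p : ℕ → V), pe (wl ℓ p) = (List.range ℓ).map (fun k => s(p k, p (k + 1))) := by
  induction ℓ with
  | zero => intro p; simp [wl, pe]
  | succ n ih =>
    intro p
    have h := ih (fun k => p (k + 1))
    have e1 : (List.range (n + 1)).map (fun k => p (k + 1)) = wl n (fun k => p (k + 1)) := rfl
    rw [wl_cons, e1, List.range_succ_eq_map, List.map_cons, List.map_map]
    have e2 := h
    rw [wl_cons] at e2 ⊢
    simp only [pe]
    rw [e2]
    rfl

lemma perm_fm {I X E : Type} [Fintype I] [Fintype X] (π : X → I) (hπ : Function.Injective π) (g : X → E) (o : I → List E)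
    (h1 : ∀ e, o (π e) = [g e]) (h2 : ∀ i, (∀ e, π e ≠ i) → o i = []) :
    ((Finset.univ : Finset I).toList.flatMap o).Perm ((Finset.univ : Finset X).toList.map g) := by
  have hp : (Finset.univ : Finset I).toList.Perm ((Finset.univ : Finset X).toList.map π ++
      (Finset.univ.filter (fun i => ∀ e, π e ≠ i)).toList) := by
    rw [List.perm_ext_iff_of_nodup (Finset.nodup_toList _)]
    · intro i
      simp only [Finset.mem_toList, Finset.mem_univ, true_iff, List.mem_append, List.mem_map, true_and, Finset.mem_filter]
      by_cases h : ∃ e, π e = i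
      · exact Or.inl h
      · push Not at h; exact Or.inr h
    · rw [List.nodup_append]
      refine ⟨(Finset.nodup_toList _).map hπ, Finset.nodup_toList _, ?_⟩
      intro a ha b hb hab
      simp only [List.mem_map, Finset.mem_toList, Finset.mem_univ, true_and, Finset.mem_filter] at ha hb
      obtain ⟨e, rfl⟩ := ha
      exact hb e hab
  refine (hp.flatMap_right o).trans ?_
  rw [List.flatMap_append]
  have e1 : (Finset.univ.filter (fun i => ∀ e, π e ≠ i)).toList.flatMap o = [] := by
    rw [List.flatMap_eq_nil_iff]
    intro i hi
    simp only [Finset.mem_toList, Finset.mem_univ, true_and, Finset.mem_filter] at hi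
    exact h2 i hi
  rw [e1, List.append_nil, List.flatMap_map]
  simp only [h1]
  rw [List.map_eq_flatMap]

theorem end1 {V I X Dm : Type} [Fintype V] [Fintype I] [Fintype X] [Fintype Dm] [Subsingleton Dm] (R : V → V → Prop)
    (hR : ∀ a b, R a b → R b a) (ℓ : ℕ) (hℓ : 2 ≤ ℓ) (p : I → ℕ → V)
    (pinj : ∀ i, ∀ j ≤ ℓ, ∀ k ≤ ℓ, p i j = p i k → j = k) (pR : ∀ i, ∀ k < ℓ, R (p i k) (p i (k + 1)))
    (π : X → I) (πinj : Function.Injective π) (xx : X → V) (hxR : ∀ e, R (xx e) (p (π e) 0))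
    (hx0 : ∀ e, xx e ≠ p (π e) 0)
    (hxne : ∀ e k, 1 ≤ k → k ≤ ℓ → xx e ≠ p (π e) k) (D θ Bk : V → ℕ)
    (hload : ∀ x w, (Finset.univ.filter (fun e => xx e = x ∧ ∃ k, 1 ≤ k ∧ k ≤ ℓ ∧ p (π e) k = w)).card ≤ θ x)
    (hxinj : ∀ e e', xx e = xx e' → p (π e) 0 = p (π e') 0 → e = e')
    (hD : ∀ u v k, 1 ≤ k → k ≤ ℓ → (Finset.univ.filter (fun i => p i 0 = u ∧ p i k = v)).card ≤ D u)
    (hBk : ∀ w v j, 1 ≤ j → j < ℓ → (Finset.univ.filter (fun i => p i j = w ∧ p i ℓ = v)).card ≤ Bk v)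
    (da db : V) (heven : ∀ v, ∑ e, (ind (xx e) v + ind (p (π e) 0) v) + ∑ i, (ind (p i 0) v + ind (p i ℓ) v)
      + ∑ _d : Dm, (ind da v + ind db v) = 0)
    (hd : I → V) (hd1 : ∀ e, hd (π e) = xx e) (hd2 : ∀ i, (∀ e, π e ≠ i) → hd i = p i 0)
    (hcn : Cn hd (fun i => p i ℓ))
    (hdeg : ∀ v, 4 * (ℓ * (ℓ * Bk v + ℓ * D v + θ v + 1)) + 2 + (Finset.univ.filter (fun e => p (π e) 0 = v)).card <
      (Finset.univ.filter (fun i => p i 0 = v)).card) :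
    ∃ LL : List (List V), (∀ l ∈ LL, l.Nodup ∧ l.IsChain R ∧ 2 ≤ l.length ∧ l.length ≤ ℓ + 1) ∧
      (LL.filter (fun l => l.length ≠ ℓ + 1)).length ≤ 1 ∧
      (LL.flatMap pe).Perm ((Finset.univ : Finset X).toList.map (fun e => s(xx e, p (π e) 0)) ++
        (Finset.univ : Finset I).toList.flatMap (fun i => pe (wl ℓ (p i)))) := by
  obtain ⟨L, hL1, hL2⟩ : ∃ L : I → List V, (∀ e, L (π e) = xx e :: wl ℓ (p (π e))) ∧
      (∀ i, (∀ e, π e ≠ i) → L i = wl ℓ (p i)) := by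
    refine ⟨fun i => if h : ∃ e, π e = i then xx h.choose :: wl ℓ (p i) else wl ℓ (p i), ?_, ?_⟩
    · intro e
      have h : ∃ e', π e' = π e := ⟨e, rfl⟩
      have := πinj h.choose_spec
      simp only [h, dif_pos]
      rw [this]
    · intro i hi
      apply dif_neg
      push Not; exact hi
  have hcase : ∀ i, (∃ e, π e = i) ∨ (∀ e, π e ≠ i) := by
    intro i
    by_cases h : ∃ e, π e = i
    · exact Or.inl h
    · push Not at h; exact Or.inr h
  have hrev : ∀ i q, q ≤ ℓ → (L i).reverse[q]? = some (p i (ℓ - q)) := by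
    intro i q hq
    rcases hcase i with ⟨e, rfl⟩ | h
    · rw [hL1, List.reverse_cons, List.getElem?_append_left (by rw [List.length_reverse, wl_len]; omega), wl_rev _ _ _ hq]
    · rw [hL2 _ h, wl_rev _ _ _ hq]
  have hhead : ∀ i, (L i).head? = some (hd i) := by
    intro i
    rcases hcase i with ⟨e, rfl⟩ | h
    · rw [hL1, hd1]; rfl
    · rw [hL2 _ h, hd2 _ h, wl_cons]; rfl
  have hlast : ∀ i, (L i).getLast? = some (p i ℓ) := by
    intro i
    rw [← List.head?_reverse, List.head?_eq_getElem?, hrev i 0 (Nat.zero_le _)]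
    rfl
  have hpe1 : ∀ e, pe (L (π e)) = s(xx e, p (π e) 0) :: pe (wl ℓ (p (π e))) := by
    intro e
    rw [hL1, wl_cons]; rfl
  obtain ⟨LL, a1, a2, a3⟩ := tour_thm (Dm := Dm) R hR ℓ (by omega) L
    (by
      intro i
      rcases hcase i with ⟨e, rfl⟩ | h
      · rw [hL1, List.length_cons, wl_len]; omega
      · rw [hL2 _ h, wl_len])
    (by
      intro i
      have := wl_nodup ℓ (p i) (pinj i)
      rcases hcase i with ⟨e, rfl⟩ | h
      · rw [hL1, List.nodup_cons]
        refine ⟨?_, this⟩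
        rw [wl_mem]
        rintro ⟨k, hk, he⟩
        by_cases hk0 : k = 0
        · subst hk0; exact hx0 e he.symm
        · exact hxne e k (by omega) hk he.symm
      · rwa [hL2 _ h])
    (by
      intro i
      have := wl_chain ℓ (p i) R (pR i)
      rcases hcase i with ⟨e, rfl⟩ | h
      · rw [hL1]
        rw [wl_cons] at this ⊢
        exact List.IsChain.cons_cons (hxR e) this
      · rwa [hL2 _ h])
    hd (fun i => p i ℓ) hhead hlast da db
    (by
      intro v
      rw [← heven v]
      congr 1
      have e1 : ∑ e, (ind (xx e) v + ind (p (π e) 0) v) = ∑ i, (ind (hd i) v + ind (p i 0) v) := by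
        apply Finset.sum_of_injOn π
        · exact fun a _ b _ h => πinj h
        · intro a _; simp
        · intro i _ hi
          rw [hd2 i (by intro e he; exact hi ⟨e, by simp, he⟩)]
          exact CharTwo.add_self_eq_zero _
        · intro e _; rw [hd1]
      rw [e1, ← Finset.sum_add_distrib]
      apply Finset.sum_congr rfl
      intro i _
      generalize ind (hd i) v = A
      generalize ind (p i 0) v = B
      generalize ind (p i ℓ) v = C
      revert A B C; decide)
    hcn (fun v => ℓ * (ℓ * Bk v + ℓ * D v + θ v + 1))
    (by
      intro g
      obtain ⟨v, hv⟩ : ∃ v, v = (if g.2 then p g.1 ℓ else hd g.1) := ⟨_, rfl⟩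
      have hgv : (orl L g).head? = some v := by
        rw [hv]
        obtain ⟨i, b⟩ := g
        cases b
        · simpa [orl] using hhead i
        · simpa [orl] using hlast i
      show _ ≤ ℓ * (ℓ * Bk (if g.2 then p g.1 ℓ else hd g.1) + ℓ * D (if g.2 then p g.1 ℓ else hd g.1) + θ (if g.2 then p g.1 ℓ else hd g.1) + 1)
      rw [← hv, hgv]
      have hsub : Finset.univ.filter (fun h : I × Bool => (orl L h).head? = some v ∧ cfl ℓ L g h) ⊆
          (Finset.range ℓ).biUnion (fun pp => Finset.univ.filter (fun h : I × Bool => (orl L h).head? = some v ∧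
            ∃ q, 1 ≤ q ∧ q < ℓ ∧ (orl L h)[q]? = some (((orl L g)[pp]?).getD v))) := by
        intro h hh
        rw [Finset.mem_filter] at hh
        obtain ⟨_, hh1, pp, q, h1, h2, h3, h4⟩ := hh
        rw [Finset.mem_biUnion]
        refine ⟨pp, by rw [Finset.mem_range]; omega, ?_⟩
        rw [Finset.mem_filter]
        refine ⟨Finset.mem_univ _, hh1, q, h2, by omega, ?_⟩
        have : pp < (orl L g).length := by
          have : (orl L g).length = (L g.1).length := by
            unfold orl; split_ifs <;> simp
          rw [this]
          rcases hcase g.1 with ⟨e, he⟩ | h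
          · rw [← he, hL1, List.length_cons, wl_len]; omega
          · rw [hL2 _ h, wl_len]; omega
        rw [← h4, List.getElem?_eq_getElem this]
        rfl
      refine (Finset.card_le_card hsub).trans ?_
      refine (Finset.card_biUnion_le_card_mul _ _ (ℓ * Bk v + ℓ * D v + θ v + 1) ?_).trans (by rw [Finset.card_range])
      intro pp _
      generalize ((orl L g)[pp]?).getD v = w
      have hsub2 : Finset.univ.filter (fun h : I × Bool => (orl L h).head? = some v ∧
            ∃ q, 1 ≤ q ∧ q < ℓ ∧ (orl L h)[q]? = some w) ⊆
          ((((Finset.Ico 1 ℓ).biUnion (fun j => Finset.univ.filter (fun i => p i j = w ∧ p i ℓ = v))).image (fun i => (i, true)) ∪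
          ((Finset.Ico 1 ℓ).biUnion (fun k => Finset.univ.filter (fun i => p i 0 = v ∧ p i k = w))).image (fun i => (i, false))) ∪
          (Finset.univ.filter (fun e => xx e = v ∧ ∃ k, 1 ≤ k ∧ k ≤ ℓ ∧ p (π e) k = w)).image (fun e => (π e, false))) ∪
          (Finset.univ.filter (fun e => xx e = v ∧ p (π e) 0 = w)).image (fun e => (π e, false)) := by
        rintro ⟨i, b⟩ hh
        rw [Finset.mem_filter] at hh
        obtain ⟨_, hh1, q, q1, q2, hq⟩ := hh
        cases b with
        | true =>
          have e1 : orl L (i, true) = (L i).reverse := by simp [orl]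
          rw [e1] at hh1 hq
          rw [List.head?_reverse, hlast] at hh1
          rw [hrev i q (by omega)] at hq
          refine Finset.mem_union_left _ (Finset.mem_union_left _ (Finset.mem_union_left _ ?_))
          refine Finset.mem_image_of_mem _ ?_
          rw [Finset.mem_biUnion]
          refine ⟨ℓ - q, by rw [Finset.mem_Ico]; omega, ?_⟩
          rw [Finset.mem_filter]
          exact ⟨Finset.mem_univ _, Option.some.inj hq, Option.some.inj hh1⟩
        | false =>
          have e1 : orl L (i, false) = L i := by simp [orl]
          rw [e1] at hh1 hq
          rw [hhead] at hh1
          rcases hcase i with ⟨e, rfl⟩ | h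
          · rw [hd1] at hh1
            have hh1 := Option.some.inj hh1
            rw [hL1] at hq
            obtain ⟨q', rfl⟩ : ∃ q', q = q' + 1 := ⟨q - 1, by omega⟩
            rw [List.getElem?_cons_succ, wl_get _ _ _ (by omega)] at hq
            have hq := Option.some.inj hq
            by_cases h0 : q' = 0
            · subst h0
              refine Finset.mem_union_right _ (Finset.mem_image.2 ⟨e, ?_, rfl⟩)
              rw [Finset.mem_filter]
              exact ⟨Finset.mem_univ _, hh1, hq⟩
            · refine Finset.mem_union_left _ (Finset.mem_union_right _ (Finset.mem_image.2 ⟨e, ?_, rfl⟩))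
              rw [Finset.mem_filter]
              exact ⟨Finset.mem_univ _, hh1, q', by omega, by omega, hq⟩
          · rw [hd2 _ h] at hh1
            rw [hL2 _ h, wl_get _ _ _ (by omega)] at hq
            refine Finset.mem_union_left _ (Finset.mem_union_left _ (Finset.mem_union_right _ ?_))
            refine Finset.mem_image_of_mem _ ?_
            rw [Finset.mem_biUnion]
            refine ⟨q, by rw [Finset.mem_Ico]; omega, ?_⟩
            rw [Finset.mem_filter]
            exact ⟨Finset.mem_univ _, Option.some.inj hh1, Option.some.inj hq⟩
      refine (Finset.card_le_card hsub2).trans ?_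
      refine (Finset.card_union_le _ _).trans (Nat.add_le_add ?_ ?_)
      · refine (Finset.card_union_le _ _).trans (Nat.add_le_add ?_ ?_)
        · refine (Finset.card_union_le _ _).trans (Nat.add_le_add ?_ ?_)
          · refine Finset.card_image_le.trans ((Finset.card_biUnion_le_card_mul _ _ (Bk v) ?_).trans ?_)
            · intro j hj
              rw [Finset.mem_Ico] at hj
              exact hBk w v j hj.1 hj.2
            · rw [Nat.card_Ico]; exact Nat.mul_le_mul_right _ (by omega)
          · refine Finset.card_image_le.trans ((Finset.card_biUnion_le_card_mul _ _ (D v) ?_).trans ?_)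
            · intro j hj
              rw [Finset.mem_Ico] at hj
              exact hD v w j hj.1 hj.2.le
            · rw [Nat.card_Ico]; exact Nat.mul_le_mul_right _ (by omega)
        · exact Finset.card_image_le.trans (hload v w)
      · refine Finset.card_image_le.trans ?_
        rw [Finset.card_le_one]
        intro e he e' he'
        rw [Finset.mem_filter] at he he'
        exact hxinj e e' (he.2.1.trans he'.2.1.symm) (he.2.2.trans he'.2.2.symm))
    (by
      intro v
      have hsub : Finset.univ.filter (fun i => p i 0 = v) ⊆ Finset.univ.filter (fun i => hd i = v) ∪
          (Finset.univ.filter (fun e => p (π e) 0 = v)).image π := by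
        intro i hi
        rw [Finset.mem_filter] at hi
        rw [Finset.mem_union]
        rcases hcase i with ⟨e, rfl⟩ | h
        · right
          refine Finset.mem_image_of_mem _ ?_
          simp [hi.2]
        · left
          simp [hd2 _ h, hi.2]
      have h1 := (Finset.card_le_card hsub).trans (Finset.card_union_le _ _)
      have h2 : ((Finset.univ.filter (fun e => p (π e) 0 = v)).image π).card ≤ _ := Finset.card_image_le
      have h3 := hdeg v
      show 4 * (ℓ * (ℓ * Bk v + ℓ * D v + θ v + 1)) + 2 < _
      omega)
  refine ⟨LL, a1, a2, a3.trans ?_⟩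
  obtain ⟨o, ho1, ho2⟩ : ∃ o : I → List (Sym2 V), (∀ e, o (π e) = [s(xx e, p (π e) 0)]) ∧ (∀ i, (∀ e, π e ≠ i) → o i = []) := by
    refine ⟨fun i => if ∃ e, π e = i then [s(hd i, p i 0)] else [], ?_, ?_⟩
    · intro e
      simp [hd1]
    · intro i hi
      simp [hi]
  have hL3 : ∀ i, pe (L i) = o i ++ pe (wl ℓ (p i)) := by
    intro i
    rcases hcase i with ⟨e, rfl⟩ | h
    · rw [hpe1, ho1]; rfl
    · rw [hL2 _ h, ho2 _ h]; rfl
  simp only [hL3]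
  refine (List.flatMap_append_perm _ _ _).symm.trans ?_
  exact (perm_fm π πinj _ o ho1 ho2).append_right _
end PD

namespace PD

theorem end2 {V I Y Dm : Type} [Fintype V] [Fintype I] [Fintype Y] [Fintype Dm] [Subsingleton Dm] (R : V → V → Prop)
    (hR : ∀ a b, R a b → R b a) (hirr : ∀ a, ¬ R a a) (ℓ : ℕ) (hℓ : 2 ≤ ℓ) (p : I → ℕ → V)
    (pinj : ∀ i, ∀ j ≤ ℓ, ∀ k ≤ ℓ, p i j = p i k → j = k) (pR : ∀ i, ∀ k < ℓ, R (p i k) (p i (k + 1)))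
    (ox oy : Y → V) (hY : ∀ e, R (ox e) (oy e)) (f : V → V) (h : V → ℕ) (r : V)
    (hf : ∀ v, v ≠ r → R v (f v) ∧ h (f v) < h v)
    (inj1 : ∀ e e', s(ox e, oy e) = s(ox e', oy e') → e = e')
    (inj2 : ∀ v w, v ≠ r → w ≠ r → s(v, f v) = s(w, f w) → v = w)
    (inj3 : ∀ e v, v ≠ r → s(ox e, oy e) ≠ s(v, f v))
    (D θ Bk : V → ℕ) (B : ℕ) (hθ : ∀ v, 0 < θ v)
    (hD : ∀ u v k, 1 ≤ k → k ≤ ℓ → (Finset.univ.filter (fun i => p i 0 = u ∧ p i k = v)).card ≤ D u)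
    (hBk : ∀ w v j, 1 ≤ j → j < ℓ → (Finset.univ.filter (fun i => p i j = w ∧ p i ℓ = v)).card ≤ Bk v)
    (hload : ∀ x, ℓ * ((Finset.univ.filter (fun e => ox e = x)).card +
      2 * (Finset.univ.filter (fun v : {v // v ≠ r} => f v.1 = x)).card) ≤ B * θ x)
    (h3 : ∀ v, (Finset.univ.filter (fun e => oy e = v)).card + 2 + ℓ * ((B + 1) * D v) <
      (Finset.univ.filter (fun i => p i 0 = v)).card)
    (hdeg : ∀ v, 4 * (ℓ * (ℓ * Bk v + ℓ * D v + θ v + 1)) + 2 + ((Finset.univ.filter (fun e => oy e = v)).card + 2) <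
      (Finset.univ.filter (fun i => p i 0 = v)).card)
    (da db : V) (heven : ∀ v, ∑ e, (ind (ox e) v + ind (oy e) v) + ∑ z : {v // v ≠ r}, (ind z.1 v + ind (f z.1) v)
      + ∑ i, (ind (p i 0) v + ind (p i ℓ) v) + ∑ _d : Dm, (ind da v + ind db v) = 0) :
    ∃ LL : List (List V), (∀ l ∈ LL, l.Nodup ∧ l.IsChain R ∧ 2 ≤ l.length ∧ l.length ≤ ℓ + 1) ∧
      (LL.filter (fun l => l.length ≠ ℓ + 1)).length ≤ 1 ∧
      (LL.flatMap pe).Perm (((Finset.univ : Finset Y).toList.map (fun e => s(ox e, oy e)) ++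
        (Finset.univ : Finset {v // v ≠ r}).toList.map (fun z => s(z.1, f z.1))) ++
        (Finset.univ : Finset I).toList.flatMap (fun i => pe (wl ℓ (p i)))) := by
  obtain ⟨y, hy1, hy2⟩ : ∃ y : Y ⊕ {v // v ≠ r} × Bool → V, (∀ e, y (.inl e) = oy e) ∧ ∀ z, y (.inr z) = z.1.1 :=
    ⟨fun e => match e with | .inl e => oy e | .inr z => z.1.1, fun _ => rfl, fun _ => rfl⟩
  obtain ⟨xx, hx1, hx2⟩ : ∃ y : Y ⊕ {v // v ≠ r} × Bool → V, (∀ e, y (.inl e) = ox e) ∧ ∀ z, y (.inr z) = f z.1.1 :=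
    ⟨fun e => match e with | .inl e => ox e | .inr z => f z.1.1, fun _ => rfl, fun _ => rfl⟩
  have hyc : ∀ v, (Finset.univ.filter (fun e => y e = v)).card ≤ (Finset.univ.filter (fun e => oy e = v)).card + 2 := by
    intro v
    simp only [Finset.card_filter, Fintype.sum_sum_type, Fintype.sum_prod_type, Fintype.sum_bool, hy1, hy2]
    apply Nat.add_le_add_left
    have : ∀ z : {v // v ≠ r}, (if z.1 = v then 1 else 0) + (if z.1 = v then 1 else 0) = 2 * (if z.1 = v then 1 else 0) := by
      intro z; ring
    simp only [this]
    rw [← Finset.mul_sum, ← Finset.card_filter]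
    have : (Finset.univ.filter (fun z : {v // v ≠ r} => z.1 = v)).card ≤ 1 := by
      rw [Finset.card_le_one]
      intro a ha b hb
      simp at ha hb
      exact Subtype.ext (ha.trans hb.symm)
    omega
  have hxc : ∀ x, (Finset.univ.filter (fun e => xx e = x)).card = (Finset.univ.filter (fun e => ox e = x)).card +
      2 * (Finset.univ.filter (fun v : {v // v ≠ r} => f v.1 = x)).card := by
    intro v
    simp only [Finset.card_filter, Fintype.sum_sum_type, Fintype.sum_prod_type, Fintype.sum_bool, hx1, hx2, Finset.mul_sum]
    congr 1
    apply Finset.sum_congr rfl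
    intro z _; ring
  obtain ⟨π0, πinj, π1, π2, π3⟩ := assign ℓ B y xx p D θ hθ hD (fun x => by rw [hxc]; exact hload x)
    (fun v => lt_of_le_of_lt (Nat.add_le_add_right (hyc v) _) (h3 v))
  have hcn0 : Cn (fun v : {v // v ≠ r} => f v.1) (fun v => v.1) := by
    have := tree_cn f h r (fun v hv => (hf v hv).2)
    intro S hS
    exact this S (fun i => (hS i).symm)
  obtain ⟨c, hc1, hc2⟩ := te (fun v : {v // v ≠ r} => f v.1) (fun v => v.1) (fun v => p (π0 (.inr (v, false))) ℓ) hcn0 Finset.univ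
  obtain ⟨ι, hι1, hι2, hι3⟩ : ∃ ι : Y ⊕ {v // v ≠ r} → Y ⊕ {v // v ≠ r} × Bool, (∀ e, ι (.inl e) = .inl e) ∧
      (∀ z, c z = f z.1 → ι (.inr z) = .inr (z, false)) ∧ (∀ z, c z ≠ f z.1 → ι (.inr z) = .inr (z, true)) := by
    refine ⟨fun e => match e with | .inl e => .inl e | .inr z => if c z = f z.1 then .inr (z, false) else .inr (z, true), fun _ => rfl, ?_, ?_⟩
    · intro z hz; simp [hz]
    · intro z hz; simp [hz]
  have hι4 : ∀ z, ∃ b, ι (.inr z) = .inr (z, b) := by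
    intro z
    by_cases hz : c z = f z.1
    · exact ⟨_, hι2 z hz⟩
    · exact ⟨_, hι3 z hz⟩
  have ιinj : Function.Injective ι := by
    rintro (e | z) (e' | z') hh
    · rw [hι1, hι1] at hh; simpa using hh
    · obtain ⟨b, hb⟩ := hι4 z'; rw [hι1, hb] at hh; simp at hh
    · obtain ⟨b, hb⟩ := hι4 z; rw [hι1, hb] at hh; simp at hh
    · obtain ⟨b, hb⟩ := hι4 z
      obtain ⟨b', hb'⟩ := hι4 z'
      rw [hb, hb'] at hh
      simp at hh; simp [hh.1]
  have hxι1 : ∀ e, xx (ι (.inl e)) = ox e := fun e => by rw [hι1, hx1]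
  have hxι2 : ∀ z, xx (ι (.inr z)) = f z.1 := fun z => by obtain ⟨b, hb⟩ := hι4 z; rw [hb, hx2]
  have hyι1 : ∀ e, y (ι (.inl e)) = oy e := fun e => by rw [hι1, hy1]
  have hyι2 : ∀ z, y (ι (.inr z)) = z.1 := fun z => by obtain ⟨b, hb⟩ := hι4 z; rw [hb, hy2]
  have hxR : ∀ e, R (xx (ι e)) (y (ι e)) := by
    rintro (e | z)
    · rw [hxι1, hyι1]; exact hY e
    · rw [hxι2, hyι2]; exact hR _ _ (hf _ z.2).1
  have hcard : ∀ P : Y ⊕ {v // v ≠ r} × Bool → Prop, (Finset.univ.filter (fun e => P (ι e))).card ≤ (Finset.univ.filter P).card := by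
    intro P
    apply Finset.card_le_card_of_injOn ι
    · intro e he; simpa using he
    · exact fun a _ b _ h => ιinj h
  obtain ⟨hd, hd1, hd2⟩ : ∃ hd : I → V, (∀ e, hd (π0 (ι e)) = xx (ι e)) ∧ (∀ i, (∀ e, π0 (ι e) ≠ i) → hd i = p i 0) := by
    refine ⟨fun i => if h : ∃ e, π0 (ι e) = i then xx (ι h.choose) else p i 0, ?_, ?_⟩
    · intro e
      have h : ∃ e', π0 (ι e') = π0 (ι e) := ⟨e, rfl⟩
      have := ιinj (πinj h.choose_spec)
      simp only [h, dif_pos]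
      rw [this]
    · intro i hi
      apply dif_neg
      push Not; exact hi
  obtain ⟨LL, a1, a2, a3⟩ := end1 (Dm := Dm) (X := Y ⊕ {v // v ≠ r}) R hR ℓ hℓ p pinj pR (fun e => π0 (ι e)) (πinj.comp ιinj) (fun e => xx (ι e))
    (by intro e; rw [π1]; exact hxR e)
    (by intro e he; rw [π1] at he; have := hxR e; rw [he] at this; exact hirr _ this)
    (fun e => π2 (ι e)) D θ Bk
    (by
      intro x w
      refine le_trans ?_ (π3 x w)
      apply Finset.card_le_card_of_injOn ι
      · intro e he
        exact Finset.mem_coe.2 (Finset.mem_filter.2 ⟨Finset.mem_univ _, (Finset.mem_filter.1 he).2⟩)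
      · exact fun a _ b _ h => ιinj h)
    (by
      intro e e' h1 h2
      rw [π1, π1] at h2
      have h3 : s(xx (ι e), y (ι e)) = s(xx (ι e'), y (ι e')) := by rw [h1, h2]
      rcases e with e | z <;> rcases e' with e' | z' <;> simp only [hxι1, hxι2, hyι1, hyι2] at h3
      · rw [inj1 _ _ h3]
      · exact absurd (h3.trans Sym2.eq_swap) (inj3 e _ z'.2)
      · exact absurd (h3.symm.trans Sym2.eq_swap) (inj3 e' _ z.2)
      · rw [Subtype.ext (inj2 _ _ z.2 z'.2 (Sym2.eq_swap.trans (h3.trans Sym2.eq_swap)))])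
    hD hBk da db
    (by
      intro v
      refine Eq.trans ?_ (heven v)
      congr 2
      rw [Fintype.sum_sum_type]
      simp only [π1, hxι1, hxι2, hyι1, hyι2]
      congr 1
      apply Finset.sum_congr rfl
      intro z _
      exact add_comm _ _)
    hd hd1 hd2
    (by
      intro S hS
      apply hc2 S
      intro z
      simp only [Finset.mem_univ, if_true]
      have := hS (π0 (.inr (z, false)))
      by_cases hz : c z = f z.1
      · rw [hz]
        rw [← hι2 z hz, hd1, hxι2] at this
        rw [this, hι2 z hz]
      · have hz' := (hc1 z (Finset.mem_univ _)).resolve_left hz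
        rw [hz']
        rw [hd2, π1, hy2] at this
        · exact this
        · intro e he
          have he := πinj he
          rcases e with e | z'
          · rw [hι1] at he; simp at he
          · by_cases hzz : z' = z
            · subst hzz
              rw [hι3 _ hz] at he; simp at he
            · obtain ⟨b, hb⟩ := hι4 z'
              rw [hb] at he; simp at he
              exact hzz he.1)
    (by
      intro v
      refine lt_of_le_of_lt (Nat.add_le_add_left ?_ _) (hdeg v)
      simp only [π1]
      exact (hcard (fun e => y e = v)).trans (hyc v))
  refine ⟨LL, a1, a2, a3.trans ?_⟩
  apply List.Perm.append_right
  simp only [π1]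
  have hp : (Finset.univ : Finset (Y ⊕ {v // v ≠ r})).toList.Perm ((Finset.univ : Finset Y).toList.map Sum.inl ++
      (Finset.univ : Finset {v // v ≠ r}).toList.map Sum.inr) := by
    rw [List.perm_ext_iff_of_nodup (Finset.nodup_toList _)]
    · rintro (e | z) <;> simp
    · rw [List.nodup_append]
      refine ⟨(Finset.nodup_toList _).map Sum.inl_injective, (Finset.nodup_toList _).map Sum.inr_injective, ?_⟩
      intro a ha b hb hab
      simp only [List.mem_map] at ha hb
      obtain ⟨e, _, rfl⟩ := ha
      obtain ⟨z, _, rfl⟩ := hb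
      simp at hab
  refine (hp.map _).trans ?_
  rw [List.map_append, List.map_map, List.map_map]
  apply List.Perm.append
  · apply List.Perm.of_eq
    apply List.map_congr_left
    intro e _
    simp only [Function.comp, hxι1, hyι1]
  · apply List.Perm.of_eq
    apply List.map_congr_left
    intro e _
    simp only [Function.comp, hxι2, hyι2]
    exact Sym2.eq_swap

end PD

namespace PD

/-- edges of the first four trees -/
def TEdge {V : Type} (f : Fin 5 → V → V) (root : Fin 5 → V) (e : Sym2 V) : Prop :=
  ∃ i : Fin 5, i ≠ 4 ∧ ∃ v, v ≠ root i ∧ e = s(v, f i v)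

theorem parents {V : Type} [Fintype V] [Nontrivial V] (col : V → Bool) (f : Fin 5 → V → V) (h : Fin 5 → V → ℕ) (root : Fin 5 → V)
    (hf : ∀ i v, v ≠ root i → col v ≠ col (f i v) ∧ h i (f i v) < h i v)
    (hdis : ∀ i j v w, i ≠ j → v ≠ root i → w ≠ root j → s(v, f i v) ≠ s(w, f j w)) :
    ∃ (a b : V) (par z : V → V), a ≠ b ∧
      (∀ y, y ≠ a → y ≠ b → par y ≠ y ∧ z y ≠ y ∧ z y ≠ par y ∧ TEdge f root s(par y, z y) ∧ TEdge f root s(z y, y)) ∧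
      (∀ y y' e, y ≠ a → y ≠ b → y' ≠ a → y' ≠ b → (e = s(par y, z y) ∨ e = s(z y, y)) →
        (e = s(par y', z y') ∨ e = s(z y', y')) → y = y') ∧
      Cn (Sum.elim (fun y : {y // y ≠ a ∧ y ≠ b} => par y.1) (fun _ : Unit => a)) (Sum.elim (fun y : {y // y ≠ a ∧ y ≠ b} => y.1) (fun _ : Unit => b)) := by
  obtain ⟨a, ha⟩ := exists_ne (root 0)
  have hcab := (hf 0 a ha).1
  generalize f 0 a = b at hcab
  have hcolor : ∀ y, col y ≠ col a → col y = col b := by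
    intro y; revert hcab; cases col y <;> cases col a <;> cases col b <;> simp
  have hcolor' : ∀ y, col y ≠ col b → col y = col a := by
    intro y; revert hcab; cases col y <;> cases col a <;> cases col b <;> simp
  obtain ⟨pa, za, ra, hA1, hA2⟩ := twopath col (fun i : Fin 2 => if i = 0 then f 0 else f 1) (fun i => if i = 0 then h 0 else h 1)
    (fun i => if i = 0 then root 0 else root 1) (by
      intro i v hv
      fin_cases i
      · exact hf 0 v hv
      · exact hf 1 v hv)
    (fun v w hv hw => hdis 0 1 v w (by decide) hv hw) a
  obtain ⟨pb, zb, rb, hB1, hB2⟩ := twopath col (fun i : Fin 2 => if i = 0 then f 2 else f 3) (fun i => if i = 0 then h 2 else h 3)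
    (fun i => if i = 0 then root 2 else root 3) (by
      intro i v hv
      fin_cases i
      · exact hf 2 v hv
      · exact hf 3 v hv)
    (fun v w hv hw => hdis 2 3 v w (by decide) hv hw) b
  have tA : ∀ e : Sym2 V, (∃ (i : Fin 2) (v : V), v ≠ (if i = 0 then root 0 else root 1) ∧ e = s(v, (if i = 0 then f 0 else f 1) v)) →
      ∃ i : Fin 5, (i = 0 ∨ i = 1) ∧ ∃ v, v ≠ root i ∧ e = s(v, f i v) := by
    rintro e ⟨i, v, hv, he⟩
    fin_cases i
    · exact ⟨0, Or.inl rfl, v, hv, he⟩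
    · exact ⟨1, Or.inr rfl, v, hv, he⟩
  have tB : ∀ e : Sym2 V, (∃ (i : Fin 2) (v : V), v ≠ (if i = 0 then root 2 else root 3) ∧ e = s(v, (if i = 0 then f 2 else f 3) v)) →
      ∃ i : Fin 5, (i = 2 ∨ i = 3) ∧ ∃ v, v ≠ root i ∧ e = s(v, f i v) := by
    rintro e ⟨i, v, hv, he⟩
    fin_cases i
    · exact ⟨2, Or.inl rfl, v, hv, he⟩
    · exact ⟨3, Or.inr rfl, v, hv, he⟩
  have tAB : ∀ e : Sym2 V, (∃ i : Fin 5, (i = 0 ∨ i = 1) ∧ ∃ v, v ≠ root i ∧ e = s(v, f i v)) →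
      (∃ i : Fin 5, (i = 2 ∨ i = 3) ∧ ∃ v, v ≠ root i ∧ e = s(v, f i v)) → False := by
    rintro e ⟨i, hi, v, hv, rfl⟩ ⟨j, hj, w, hw, he⟩
    refine hdis i j v w ?_ hv hw he
    rcases hi with rfl | rfl <;> rcases hj with rfl | rfl <;> decide
  obtain ⟨par, hpa, hpb⟩ : ∃ par : V → V, (∀ y, col y = col a → par y = pa y) ∧ (∀ y, col y = col b → par y = pb y) :=
    ⟨fun y => if col y = col a then pa y else pb y, fun y hy => by simp [hy], fun y hy => by simp [hy, Ne.symm hcab]⟩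
  obtain ⟨z, hza, hzb⟩ : ∃ z : V → V, (∀ y, col y = col a → z y = za y) ∧ (∀ y, col y = col b → z y = zb y) :=
    ⟨fun y => if col y = col a then za y else zb y, fun y hy => by simp [hy], fun y hy => by simp [hy, Ne.symm hcab]⟩
  have hcc : ∀ y, col y = col a ∨ col y = col b := by
    intro y
    by_cases hy : col y = col a
    · exact Or.inl hy
    · exact Or.inr (hcolor y hy)
  have EA : ∀ y e, col y = col a → y ≠ a → (e = s(par y, z y) ∨ e = s(z y, y)) →
      ∃ i : Fin 5, (i = 0 ∨ i = 1) ∧ ∃ v, v ≠ root i ∧ e = s(v, f i v) := by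
    intro y e hy hya he
    rw [hpa y hy, hza y hy] at he
    obtain ⟨_, _, _, _, h5, h6⟩ := hA1 y hy hya
    rcases he with rfl | rfl
    · exact tA _ h5
    · exact tA _ h6
  have EB : ∀ y e, col y = col b → y ≠ b → (e = s(par y, z y) ∨ e = s(z y, y)) →
      ∃ i : Fin 5, (i = 2 ∨ i = 3) ∧ ∃ v, v ≠ root i ∧ e = s(v, f i v) := by
    intro y e hy hya he
    rw [hpb y hy, hzb y hy] at he
    obtain ⟨_, _, _, _, h5, h6⟩ := hB1 y hy hya
    rcases he with rfl | rfl
    · exact tB _ h5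
    · exact tB _ h6
  have TA : ∀ e : Sym2 V, (∃ i : Fin 5, (i = 0 ∨ i = 1) ∧ ∃ v, v ≠ root i ∧ e = s(v, f i v)) → TEdge f root e := by
    rintro e ⟨i, hi, h⟩
    exact ⟨i, by rcases hi with rfl | rfl <;> decide, h⟩
  have TB : ∀ e : Sym2 V, (∃ i : Fin 5, (i = 2 ∨ i = 3) ∧ ∃ v, v ≠ root i ∧ e = s(v, f i v)) → TEdge f root e := by
    rintro e ⟨i, hi, h⟩
    exact ⟨i, by rcases hi with rfl | rfl <;> decide, h⟩
  refine ⟨a, b, par, z, fun h => hcab (by rw [h]), ?_, ?_, ?_⟩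
  · intro y hya hyb
    rcases hcc y with hy | hy
    · have e1 := EA y _ hy hya (Or.inl rfl)
      have e2 := EA y _ hy hya (Or.inr rfl)
      obtain ⟨h1, h2, h3, _⟩ := hA1 y hy hya
      rw [← hza y hy] at h2
      rw [← hpa y hy] at h1 h3
      exact ⟨h3, fun h => h2 (by rw [h, hy]), fun h => h2 (by rw [h, h1]), TA _ e1, TA _ e2⟩
    · have e1 := EB y _ hy hyb (Or.inl rfl)
      have e2 := EB y _ hy hyb (Or.inr rfl)
      obtain ⟨h1, h2, h3, _⟩ := hB1 y hy hyb
      rw [← hzb y hy] at h2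
      rw [← hpb y hy] at h1 h3
      exact ⟨h3, fun h => h2 (by rw [h, hy]), fun h => h2 (by rw [h, h1]), TB _ e1, TB _ e2⟩
  · intro y y' e hya hyb hya' hyb' he he'
    rcases hcc y with hy | hy <;> rcases hcc y' with hy' | hy'
    · obtain ⟨u1, u2, u3⟩ := hA2 y y' hy hya hy' hya'
      obtain ⟨u1', _, _⟩ := hA2 y' y hy' hya' hy hya
      rw [hpa y hy, hza y hy] at he
      rw [hpa y' hy', hza y' hy'] at he'
      rcases he with he | he <;> rcases he' with he' | he' <;> rw [he] at he'
      · exact u2 he'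
      · exact absurd he' u1
      · exact absurd he'.symm u1'
      · exact u3 he'
    · exact (tAB e (EA y e hy hya he) (EB y' e hy' hyb' he')).elim
    · exact (tAB e (EA y' e hy' hya' he') (EB y e hy hyb he)).elim
    · obtain ⟨u1, u2, u3⟩ := hB2 y y' hy hyb hy' hyb'
      obtain ⟨u1', _, _⟩ := hB2 y' y hy' hyb' hy hyb
      rw [hpb y hy, hzb y hy] at he
      rw [hpb y' hy', hzb y' hy'] at he'
      rcases he with he | he <;> rcases he' with he' | he' <;> rw [he] at he'
      · exact u2 he'
      · exact absurd he' u1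
      · exact absurd he'.symm u1'
      · exact u3 he'
  · intro S hS
    have hab : S a ↔ S b := hS (.inr ())
    have hy : ∀ y, y ≠ a → y ≠ b → (S (par y) ↔ S y) := fun y h1 h2 => hS (.inl ⟨y, h1, h2⟩)
    have key : ∀ n y, ((col y = col a ∧ ra y < n) ∨ (col y = col b ∧ rb y < n)) → (S y ↔ S a) := by
      intro n
      induction n with
      | zero => intro y hh; omega
      | succ n ih =>
        intro y hh
        by_cases hya : y = a
        · rw [hya]
        by_cases hyb : y = b
        · rw [hyb, hab]
        rw [← hy y hya hyb]
        apply ih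
        rcases hh with ⟨h1, h2⟩ | ⟨h1, h2⟩
        · obtain ⟨g1, _, _, g4, _⟩ := hA1 y h1 hya
          left
          rw [hpa y h1]
          exact ⟨g1, by omega⟩
        · obtain ⟨g1, _, _, g4, _⟩ := hB1 y h1 hyb
          right
          rw [hpb y h1]
          exact ⟨g1, by omega⟩
    have key2 : ∀ y, S y ↔ S a := by
      intro y
      rcases hcc y with h | h
      · exact key (ra y + 1) y (Or.inl ⟨h, by omega⟩)
      · exact key (rb y + 1) y (Or.inr ⟨h, by omega⟩)
    intro u v hu
    rw [key2] at hu ⊢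
    exact hu

end PD

namespace PD

/-- prepend a vertex -/
def cns {V : Type} (x : V) (t : ℕ → V) : ℕ → V
  | 0 => x
  | k + 1 => t k

/-- a path inside an edge set -/
def gd {V : Type} (n : ℕ) (E : Sym2 V → Prop) (P : ℕ → V) : Prop :=
  (∀ j ≤ n, ∀ k ≤ n, P j = P k → j = k) ∧ ∀ k < n, E s(P k, P (k + 1))

lemma gd_cns {V : Type} {n : ℕ} {E : Sym2 V → Prop} {P : ℕ → V} (x : V) (hP : gd n E P) (hx : ∀ k ≤ n, P k ≠ x)
    (he : E s(x, P 0)) : gd (n + 1) E (cns x P) := by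
  refine ⟨?_, ?_⟩
  · intro j hj k hk h
    rcases j with _ | j <;> rcases k with _ | k
    · rfl
    · exact absurd h.symm (hx k (by omega))
    · exact absurd h (hx j (by omega))
    · have := hP.1 j (by omega) k (by omega) h
      omega
  · intro k hk
    rcases k with _ | k
    · exact he
    · exact hP.2 k (by omega)

lemma gd_mono {V : Type} {n n' : ℕ} {E : Sym2 V → Prop} {P : ℕ → V} (hP : gd n E P) (h : n' ≤ n) : gd n' E P :=
  ⟨fun j hj k hk => hP.1 j (by omega) k (by omega), fun k hk => hP.2 k (by omega)⟩

set_option maxHeartbeats 1000000 in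
theorem gadget {V : Type} [Fintype V] [Nontrivial V] (col : V → Bool) (Out : ℕ → V → Finset V)
    (f : Fin 5 → V → V) (h : Fin 5 → V → ℕ) (root : Fin 5 → V)
    (hlay : ∀ k k' v v' w w', w ∈ Out k v → w' ∈ Out k' v' → s(v, w) = s(v', w') → k = k' ∧ v = v')
    (hf : ∀ i v, v ≠ root i → col v ≠ col (f i v) ∧ h i (f i v) < h i v)
    (htl : ∀ i k v v' w, v ≠ root i → w ∈ Out k v' → s(v, f i v) ≠ s(v', w))
    (hdis : ∀ i j v w, i ≠ j → v ≠ root i → w ≠ root j → s(v, f i v) ≠ s(w, f j w))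
    (ℓ : ℕ) (hℓ : 2 ≤ ℓ) (Q M : ℕ) (hQ : 1 ≤ Q) (hM : 1 ≤ M) (m : V → ℕ) (hmM : ∀ v, M ≤ m v)
    (hOut : ∀ k, k < 2 + ℓ → ∀ v, (ℓ + 10) * m v ≤ (Out k v).card)
    (hin : ∀ k, k < 2 + ℓ → ∀ v, (Finset.univ.filter (fun x => v ∈ Out k x)).card ≤ Q * m v)
    (δ1 δ2 ρ : ℝ) (h1a : 192 ≤ δ1 * M) (h1b : (2 * Q : ℝ) ^ 2 * δ1 ≤ 1) (h2a : 1 ≤ δ2 / 2 * M)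
    (h2b : (2 * Q : ℝ) ^ 2 * δ1 ≤ δ2 / 2) (h2c : 4 * ((ℓ : ℝ) + 2) * (4 + ℓ + 6) ≤ δ2 * M) (h2d : (2 * Q : ℝ) ^ ℓ * δ2 ≤ 1)
    (hρ : 2 * ((2 * Q : ℝ) ^ 2 * δ1) + ℓ * ((2 * Q : ℝ) ^ ℓ * δ2) ≤ ρ) :
    ∃ (a b : V) (P : V → ℕ → V) (Eg : Finset (Sym2 V)) (og : Sym2 V → V), a ≠ b ∧
      (∀ e ∈ Eg, og e ∈ e) ∧ (∀ e ∈ Eg, TEdge f root e ∨ ∃ k < 2 + ℓ, ∃ v w, w ∈ Out k v ∧ e = s(v, w)) ∧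
      (∀ v, ((Eg.filter (fun e => og e = v)).card : ℝ) ≤ 4 + ρ * m v) ∧
      (∀ y, y ≠ a → y ≠ b → gd ℓ (fun e => e ∈ Eg) (P y)) ∧
      (∀ y y', y ≠ a → y ≠ b → y' ≠ a → y' ≠ b → ∀ k < ℓ, ∀ k' < ℓ,
        s(P y k, P y (k + 1)) = s(P y' k', P y' (k' + 1)) → y = y') ∧
      Cn (Sum.elim (fun y : {y // y ≠ a ∧ y ≠ b} => P y.1 0) (fun _ : Unit => a))
        (Sum.elim (fun y : {y // y ≠ a ∧ y ≠ b} => P y.1 ℓ) (fun _ : Unit => b)) := by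
  obtain ⟨a, b, par, z, hab, hp1, hp2, hp3⟩ := parents col f h root hf hdis
  have hmr : ∀ v, (M : ℝ) ≤ m v := fun v => by exact_mod_cast hmM v
  have hMr : (1:ℝ) ≤ M := by exact_mod_cast hM
  have hpos : ∀ δ c : ℝ, 0 < c → c ≤ δ * M → 0 < δ := by
    intro δ c hc h
    by_contra hn
    push Not at hn
    have : δ * M ≤ 0 := mul_nonpos_of_nonpos_of_nonneg hn (by linarith)
    linarith
  have hδ1 := hpos δ1 192 (by norm_num) h1a
  have hδ2 : 0 < δ2 := by have := hpos (δ2 / 2) 1 (by norm_num) h2a; linarith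
  -- A1
  obtain ⟨u, u0, u1, u2, u3, u4, u5, -⟩ := walk_lemma (I := V) 2 4 Q M hQ hM Out m hmM
    (fun k hk v => le_trans (Nat.mul_le_mul_right _ (by omega)) (hOut k (by omega) v))
    (fun k hk v => hin k (by omega) v) (fun y => y) (fun _ => ∅) (fun _ => by simp) δ1 δ1 192 (by norm_num) h1a h1a h1b
    (by
      intro x
      have : Finset.univ.filter (fun i : V => i = x) = {x} := by ext; simp
      rw [this, Finset.card_singleton]
      have := mul_le_mul_of_nonneg_left (hmr x) hδ1.le
      push_cast; linarith)
  -- A2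
  obtain ⟨st, st1, st2⟩ : ∃ st : V ⊕ V → V, (∀ y, st (.inl y) = y) ∧ ∀ y, st (.inr y) = u y 1 :=
    ⟨Sum.elim id (fun y => u y 1), fun _ => rfl, fun _ => rfl⟩
  obtain ⟨fb, fb1, fb2⟩ : ∃ fb : V ⊕ V → Finset V, (∀ y, fb (.inl y) = {par y, z y, u y 1, u y 2}) ∧ ∀ y, fb (.inr y) = {y, u y 2} :=
    ⟨Sum.elim (fun y => {par y, z y, u y 1, u y 2}) (fun y => {y, u y 2}), fun _ => rfl, fun _ => rfl⟩
  obtain ⟨r, r0, r1, r2, r3, r4, r5, -⟩ := walk_lemma (I := V ⊕ V) ℓ 4 Q M hQ hM (fun k => Out (2 + k)) m hmM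
    (fun k hk v => le_trans (Nat.mul_le_mul_right _ (by omega)) (hOut (2 + k) (by omega) v))
    (fun k hk v => hin (2 + k) (by omega) v) st fb (by
      rintro (y | y)
      · rw [fb1]; exact Finset.card_le_four
      · rw [fb2]; exact Finset.card_le_two.trans (by norm_num)) δ2 δ2 _ rfl (by push_cast; exact h2c) (by push_cast; exact h2c) h2d
    (by
      intro x
      have e1 : (Finset.univ.filter (fun i => st i = x)).card = 1 + (Finset.univ.filter (fun i => u i 1 = x)).card := by
        simp only [Finset.card_filter, Fintype.sum_sum_type, st1, st2]
        simp
      rw [e1]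
      push_cast
      have := u5 1 (by norm_num) x
      have h6 := mul_le_mul_of_nonneg_right h2b (Nat.cast_nonneg (m x) : (0:ℝ) ≤ m x)
      have h7 := mul_le_mul_of_nonneg_left (hmr x) (by linarith : 0 ≤ δ2 / 2)
      linarith)
  -- edge classes
  obtain ⟨EY, hEY⟩ : ∃ EY : V → Sym2 V → Prop, ∀ y e, EY y e ↔ ((e = s(par y, z y) ∨ e = s(z y, y)) ∨
      (∃ k < 2, e = s(u y k, u y (k + 1))) ∨ (∃ c, (c = .inl y ∨ c = .inr y) ∧ ∃ k < ℓ, e = s(r c k, r c (k + 1)))) :=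
    ⟨_, fun _ _ => Iff.rfl⟩
  have hTL : ∀ e k v w, TEdge f root e → w ∈ Out k v → e ≠ s(v, w) := by
    rintro e k v w ⟨i, _, x, hx, rfl⟩ hw
    exact htl i k x v w hx hw
  have hEYu : ∀ y y' e, y ≠ a → y ≠ b → y' ≠ a → y' ≠ b → EY y e → EY y' e → y = y' := by
    intro y y' e ha hb ha' hb' he he'
    rw [hEY] at he he'
    have hT : ∀ y e, y ≠ a → y ≠ b → (e = s(par y, z y) ∨ e = s(z y, y)) → TEdge f root e := by
      intro y e ha hb he
      obtain ⟨_, _, _, g1, g2⟩ := hp1 y ha hb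
      rcases he with rfl | rfl <;> assumption
    have hA1 : ∀ y y' k k', k < 2 → k' < 2 → s(u y k, u y (k + 1)) = s(u y' k', u y' (k' + 1)) → y = y' := by
      intro y y' k k' hk hk' he
      obtain ⟨rfl, h2⟩ := hlay _ _ _ _ _ _ (u1 k hk y) (u1 k' hk' y') he
      rw [h2, Sym2.congr_right] at he
      exact u2 k hk _ _ h2 he
    have hA2 : ∀ c c' k k', k < ℓ → k' < ℓ → s(r c k, r c (k + 1)) = s(r c' k', r c' (k' + 1)) → c = c' := by
      intro y y' k k' hk hk' he
      obtain ⟨h1, h2⟩ := hlay _ _ _ _ _ _ (r1 k hk y) (r1 k' hk' y') he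
      have : k = k' := by omega
      subst this
      rw [h2, Sym2.congr_right] at he
      exact r2 k hk _ _ h2 he
    have hA12 : ∀ y c k k', k < 2 → k' < ℓ → s(u y k, u y (k + 1)) ≠ s(r c k', r c (k' + 1)) := by
      intro y c k k' hk hk' he
      obtain ⟨h1, h2⟩ := hlay _ _ _ _ _ _ (u1 k hk y) (r1 k' hk' c) he
      omega
    rcases he with he | ⟨k, hk, he⟩ | ⟨c, hc, k, hk, he⟩ <;> rcases he' with he' | ⟨k', hk', he'⟩ | ⟨c', hc', k', hk', he'⟩
    · exact hp2 y y' e ha hb ha' hb' he he'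
    · exact absurd he' (hTL _ _ _ _ (hT _ _ ha hb he) (u1 k' hk' y'))
    · exact absurd he' (hTL _ _ _ _ (hT _ _ ha hb he) (r1 k' hk' c'))
    · exact absurd he (hTL _ _ _ _ (hT _ _ ha' hb' he') (u1 k hk y))
    · exact hA1 _ _ _ _ hk hk' (he.symm.trans he')
    · exact absurd (he.symm.trans he') (hA12 _ _ _ _ hk hk')
    · exact absurd he (hTL _ _ _ _ (hT _ _ ha' hb' he') (r1 k hk c))
    · exact absurd (he'.symm.trans he) (hA12 _ _ _ _ hk' hk)
    · have := hA2 _ _ _ _ hk hk' (he.symm.trans he')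
      subst this
      rcases hc with rfl | rfl <;> rcases hc' with hc' | hc' <;> simpa using hc'
  have hq : ∀ y, gd ℓ (EY y) (r (.inl y)) := by
    intro y
    refine ⟨r4 _, ?_⟩
    intro k hk
    rw [hEY]
    exact Or.inr (Or.inr ⟨_, Or.inl rfl, k, hk, rfl⟩)
  have hs : ∀ y, gd ℓ (EY y) (r (.inr y)) := by
    intro y
    refine ⟨r4 _, ?_⟩
    intro k hk
    rw [hEY]
    exact Or.inr (Or.inr ⟨_, Or.inr rfl, k, hk, rfl⟩)
  have hq0 : ∀ y, r (.inl y) 0 = y := fun y => by rw [r0, st1]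
  have hs0 : ∀ y, r (.inr y) 0 = u y 1 := fun y => by rw [r0, st2]
  have hqf : ∀ y k, k ≤ ℓ → 1 ≤ k → r (.inl y) k ≠ par y ∧ r (.inl y) k ≠ z y ∧ r (.inl y) k ≠ u y 1 ∧ r (.inl y) k ≠ u y 2 := by
    intro y k hk hk1
    obtain ⟨k, rfl⟩ : ∃ j, k = j + 1 := ⟨k - 1, by omega⟩
    have := r3 k (by omega) (.inl y)
    rw [fb1] at this
    simpa using this
  have hsf : ∀ y k, k ≤ ℓ → 1 ≤ k → r (.inr y) k ≠ y ∧ r (.inr y) k ≠ u y 2 := by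
    intro y k hk hk1
    obtain ⟨k, rfl⟩ : ∃ j, k = j + 1 := ⟨k - 1, by omega⟩
    have := r3 k (by omega) (.inr y)
    rw [fb2] at this
    simpa using this
  have hune : ∀ y, u y 1 ≠ y ∧ u y 2 ≠ y ∧ u y 1 ≠ u y 2 := by
    intro y
    refine ⟨?_, ?_, ?_⟩
    · intro h; have := u4 y 1 (by norm_num) 0 (by norm_num) (by rw [h, u0]); omega
    · intro h; have := u4 y 2 (by norm_num) 0 (by norm_num) (by rw [h, u0]); omega
    · intro h; have := u4 y 1 (by norm_num) 2 (by norm_num) h; omega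
  have euw : ∀ y, EY y s(u y 1, y) := by
    intro y
    rw [hEY]
    exact Or.inr (Or.inl ⟨0, by norm_num, by rw [u0]; exact Sym2.eq_swap⟩)
  have euw' : ∀ y, EY y s(u y 2, u y 1) := by
    intro y
    rw [hEY]
    exact Or.inr (Or.inl ⟨1, by norm_num, Sym2.eq_swap⟩)
  obtain ⟨n, rfl⟩ : ∃ n, ℓ = n + 2 := ⟨ℓ - 2, by omega⟩
  have optI : ∀ y, y ≠ a → y ≠ b → ∀ x, (x = par y ∨ x = u y 2) → ∃ P, gd (n + 2) (EY y) P ∧ P 0 = x ∧ P (n + 2) = r (.inl y) n := by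
    intro y ha hb x hx
    obtain ⟨g1, g2, g3, _⟩ := hp1 y ha hb
    rcases hx with rfl | rfl
    · refine ⟨cns (par y) (cns (z y) (r (.inl y))), ?_, rfl, rfl⟩
      apply gd_cns
      · apply gd_cns
        · exact gd_mono (hq y) (by omega)
        · intro k hk
          by_cases hk0 : k = 0
          · subst hk0; rw [hq0]; exact g2.symm
          · exact (hqf y k (by omega) (by omega)).2.1
        · rw [hq0, hEY]; exact Or.inl (Or.inr rfl)
      · intro k hk
        rcases k with _ | k
        · exact g3
        · by_cases hk0 : k = 0
          · subst hk0; show r (.inl y) 0 ≠ _; rw [hq0]; exact g1.symm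
          · exact (hqf y k (by omega) (by omega)).1
      · rw [hEY]; exact Or.inl (Or.inl rfl)
    · refine ⟨cns (u y 2) (cns (u y 1) (r (.inl y))), ?_, rfl, rfl⟩
      apply gd_cns
      · apply gd_cns
        · exact gd_mono (hq y) (by omega)
        · intro k hk
          by_cases hk0 : k = 0
          · subst hk0; rw [hq0]; exact (hune y).1.symm
          · exact (hqf y k (by omega) (by omega)).2.2.1
        · rw [hq0]; exact euw y
      · intro k hk
        rcases k with _ | k
        · exact (hune y).2.2
        · by_cases hk0 : k = 0
          · subst hk0; show r (.inl y) 0 ≠ _; rw [hq0]; exact (hune y).2.1.symm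
          · exact (hqf y k (by omega) (by omega)).2.2.2
      · exact euw' y
  have optII : ∀ y, ∀ x, (x = y ∨ x = u y 2) → ∃ P, gd (n + 2) (EY y) P ∧ P 0 = x ∧ P (n + 2) = r (.inr y) (n + 1) := by
    intro y x hx
    refine ⟨cns x (r (.inr y)), ?_, rfl, rfl⟩
    rcases hx with rfl | rfl
    · apply gd_cns
      · exact gd_mono (hs _) (by omega)
      · intro k hk
        by_cases hk0 : k = 0
        · subst hk0; rw [hs0]; exact (hune _).1
        · exact (hsf _ k (by omega) (by omega)).1
      · rw [hs0, Sym2.eq_swap]; exact euw _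
    · apply gd_cns
      · exact gd_mono (hs _) (by omega)
      · intro k hk
        by_cases hk0 : k = 0
        · subst hk0; rw [hs0]; exact (hune _).2.2
        · exact (hsf _ k (by omega) (by omega)).2
      · rw [hs0]; exact euw' _
  obtain ⟨c1, c1a, c1b⟩ := te _ _ (Sum.elim (fun y : {y // y ≠ a ∧ y ≠ b} => u y.1 2) (fun _ : Unit => b)) hp3
    (Finset.univ.filter (fun i => ∃ y, i = Sum.inl y))
  obtain ⟨c2, c2a, c2b⟩ := te _ _ (Sum.elim (fun y : {y // y ≠ a ∧ y ≠ b} => if c1 (.inl y) = par y.1 then r (.inl y.1) n else r (.inr y.1) (n + 1))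
    (fun _ : Unit => b)) c1b (Finset.univ.filter (fun i => ∃ y, i = Sum.inl y))
  have hch : ∀ y : V, ∃ P : ℕ → V, ∀ hy : y ≠ a ∧ y ≠ b, gd (n + 2) (EY y) P ∧ P 0 = c2 (.inl ⟨y, hy⟩) ∧
      P (n + 2) = if c1 (.inl ⟨y, hy⟩) = par y then r (.inl y) n else r (.inr y) (n + 1) := by
    intro y
    by_cases hy : y ≠ a ∧ y ≠ b
    · have hmem : (Sum.inl ⟨y, hy⟩ : {y // y ≠ a ∧ y ≠ b} ⊕ Unit) ∈ Finset.univ.filter (fun i : {y // y ≠ a ∧ y ≠ b} ⊕ Unit => ∃ y, i = Sum.inl y) :=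
        Finset.mem_filter.2 ⟨Finset.mem_univ _, ⟨y, hy⟩, rfl⟩
      have d1 := c1a (.inl ⟨y, hy⟩) hmem
      have d2 := c2a (.inl ⟨y, hy⟩) hmem
      rw [if_pos hmem, if_pos hmem] at d2
      simp only [Sum.elim_inl] at d1 d2
      by_cases hc : c1 (.inl ⟨y, hy⟩) = par y
      · rw [hc] at d2
        obtain ⟨P, hP⟩ := optI y hy.1 hy.2 _ d2
        refine ⟨P, fun hy' => ?_⟩
        rw [if_pos hc]; exact hP
      · have d1 := d1.resolve_left hc
        rw [d1] at d2
        obtain ⟨P, hP⟩ := optII y _ d2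
        refine ⟨P, fun hy' => ?_⟩
        rw [if_neg hc]; exact hP
    · exact ⟨fun _ => y, fun h => absurd h hy⟩
  choose P hP using hch
  -- Eg
  let Eg : Finset (Sym2 V) := Finset.univ.filter (fun e => TEdge f root e ∨ (∃ y, ∃ k < 2, e = s(u y k, u y (k + 1))) ∨
    (∃ c, ∃ k < n + 2, e = s(r c k, r c (k + 1))))
  have hEg : ∀ e, e ∈ Eg ↔ (TEdge f root e ∨ (∃ y, ∃ k < 2, e = s(u y k, u y (k + 1))) ∨
    (∃ c, ∃ k < n + 2, e = s(r c k, r c (k + 1)))) := by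
    intro e; simp only [Eg, Finset.mem_filter, Finset.mem_univ, true_and]
  have : ∀ e : Sym2 V, ∃ o : V, e ∈ Eg → ((∃ i : Fin 5, i ≠ 4 ∧ o ≠ root i ∧ e = s(o, f i o)) ∨
      (∃ y, ∃ k < 2, u y k = o ∧ e = s(u y k, u y (k + 1))) ∨ (∃ c, ∃ k < n + 2, r c k = o ∧ e = s(r c k, r c (k + 1)))) := by
    intro e
    by_cases he : e ∈ Eg
    · rcases (hEg e).1 he with ⟨i, hi, v, hv⟩ | ⟨y, k, hk, h⟩ | ⟨y, k, hk, h⟩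
      · exact ⟨v, fun _ => Or.inl ⟨i, hi, hv⟩⟩
      · exact ⟨u y k, fun _ => Or.inr (Or.inl ⟨y, k, hk, rfl, h⟩)⟩
      · exact ⟨r y k, fun _ => Or.inr (Or.inr ⟨y, k, hk, rfl, h⟩)⟩
    · exact ⟨a, fun h => absurd h he⟩
  choose og hog using this
  refine ⟨a, b, P, Eg, og, hab, ?_, ?_, ?_, ?_, ?_, ?_⟩
  · intro e he
    rcases hog e he with ⟨i, hi, hv, he⟩ | ⟨y, k, hk, h, he⟩ | ⟨y, k, hk, h, he⟩
    · have := Sym2.mem_mk_left (og e) (f i (og e)); rwa [← he] at this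
    · have := Sym2.mem_mk_left (u y k) (u y (k + 1)); rwa [← he, h] at this
    · have := Sym2.mem_mk_left (r y k) (r y (k + 1)); rwa [← he, h] at this
  · intro e he
    rcases (hEg e).1 he with h | ⟨y, k, hk, h⟩ | ⟨c, k, hk, h⟩
    · exact Or.inl h
    · exact Or.inr ⟨k, by omega, _, _, u1 k hk y, h⟩
    · exact Or.inr ⟨2 + k, by omega, _, _, r1 k hk c, h⟩
  · intro v
    have hsub : Eg.filter (fun e => og e = v) ⊆
        ((Finset.univ.filter (fun i : Fin 5 => i ≠ 4)).image (fun i => s(v, f i v)) ∪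
        (Finset.range 2).biUnion (fun k => (Finset.univ.filter (fun y => u y k = v)).image (fun y => s(u y k, u y (k + 1))))) ∪
        (Finset.range (n + 2)).biUnion (fun k => (Finset.univ.filter (fun y => r y k = v)).image (fun y => s(r y k, r y (k + 1)))) := by
      intro e he
      obtain ⟨he1, he2⟩ := Finset.mem_filter.1 he
      rcases hog e he1 with ⟨i, hi, hv, h⟩ | ⟨y, k, hk, h, he⟩ | ⟨y, k, hk, h, he⟩
      · refine Finset.mem_union_left _ (Finset.mem_union_left _ (Finset.mem_image.2 ⟨i, by simp [hi], ?_⟩))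
        rw [h, he2]
      · refine Finset.mem_union_left _ (Finset.mem_union_right _ (Finset.mem_biUnion.2 ⟨k, by simpa using hk, ?_⟩))
        exact Finset.mem_image.2 ⟨y, by simp [h, he2], he.symm⟩
      · refine Finset.mem_union_right _ (Finset.mem_biUnion.2 ⟨k, by simpa using hk, ?_⟩)
        exact Finset.mem_image.2 ⟨y, by simp [h, he2], he.symm⟩
    have c1 := ((Finset.card_le_card hsub).trans (Finset.card_union_le _ _)).trans (Nat.add_le_add_right (Finset.card_union_le _ _) _)
    have b1 : (((Finset.univ.filter (fun i : Fin 5 => i ≠ 4)).image (fun i => s(v, f i v))).card : ℝ) ≤ 4 := by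
      have : ((Finset.univ.filter (fun i : Fin 5 => i ≠ 4)).image (fun i => s(v, f i v))).card ≤ 4 :=
        Finset.card_image_le.trans (by
          have : (Finset.univ.filter (fun i : Fin 5 => i ≠ 4)) = Finset.univ.erase 4 := by ext; simp
          rw [this]; simp)
      exact_mod_cast this
    have b2 : (((Finset.range 2).biUnion (fun k => (Finset.univ.filter (fun y => u y k = v)).image (fun y => s(u y k, u y (k + 1))))).card : ℝ)
        ≤ 2 * ((2 * Q : ℝ) ^ 2 * δ1 * m v) := by
      have e1 : (((Finset.range 2).biUnion (fun k => (Finset.univ.filter (fun y => u y k = v)).image (fun y => s(u y k, u y (k + 1))))).card : ℝ)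
        ≤ ∑ k ∈ Finset.range 2, ((Finset.univ.filter (fun y => u y k = v)).card : ℝ) := by
        exact_mod_cast Finset.card_biUnion_le.trans (Finset.sum_le_sum (fun k _ => Finset.card_image_le))
      refine e1.trans ?_
      have : ∀ k ∈ Finset.range 2, ((Finset.univ.filter (fun y => u y k = v)).card : ℝ) ≤ (2 * Q : ℝ) ^ 2 * δ1 * m v := by
        intro k hk
        rw [Finset.mem_range] at hk
        exact u5 k (by omega) v
      refine (Finset.sum_le_sum this).trans ?_
      rw [Finset.sum_const, Finset.card_range, nsmul_eq_mul]; push_cast; exact le_rfl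
    have b3 : (((Finset.range (n + 2)).biUnion (fun k => (Finset.univ.filter (fun y => r y k = v)).image (fun y => s(r y k, r y (k + 1))))).card : ℝ)
        ≤ ((n + 2 : ℕ) : ℝ) * ((2 * Q : ℝ) ^ (n + 2) * δ2 * m v) := by
      have e1 : (((Finset.range (n + 2)).biUnion (fun k => (Finset.univ.filter (fun y => r y k = v)).image (fun y => s(r y k, r y (k + 1))))).card : ℝ)
        ≤ ∑ k ∈ Finset.range (n + 2), ((Finset.univ.filter (fun y => r y k = v)).card : ℝ) := by
        exact_mod_cast Finset.card_biUnion_le.trans (Finset.sum_le_sum (fun k _ => Finset.card_image_le))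
      refine e1.trans ?_
      have : ∀ k ∈ Finset.range (n + 2), ((Finset.univ.filter (fun y => r y k = v)).card : ℝ) ≤ (2 * Q : ℝ) ^ (n + 2) * δ2 * m v := by
        intro k hk
        rw [Finset.mem_range] at hk
        exact r5 k (by omega) v
      refine (Finset.sum_le_sum this).trans ?_
      rw [Finset.sum_const, Finset.card_range, nsmul_eq_mul]
    have c1' := (Nat.cast_le (α := ℝ)).2 c1
    have h8 := mul_le_mul_of_nonneg_right hρ (Nat.cast_nonneg (m v) : (0:ℝ) ≤ m v)
    push_cast at c1' b3 h8
    linarith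
  · intro y ha hb
    obtain ⟨g1, _⟩ := hP y ⟨ha, hb⟩
    refine ⟨g1.1, ?_⟩
    intro k hk
    have := g1.2 k hk
    rw [hEY] at this
    rw [hEg]
    rcases this with he | ⟨k, hk, he⟩ | ⟨c, hc, k, hk, he⟩
    · left
      obtain ⟨_, _, _, g1, g2⟩ := hp1 y ha hb
      rcases he with he | he <;> rw [he] <;> assumption
    · exact Or.inr (Or.inl ⟨y, k, hk, he⟩)
    · exact Or.inr (Or.inr ⟨c, k, hk, he⟩)
  · intro y y' ha hb ha' hb' k hk k' hk' he
    have g1 := (hP y ⟨ha, hb⟩).1.2 k hk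
    have g2 := (hP y' ⟨ha', hb'⟩).1.2 k' hk'
    rw [← he] at g2
    exact hEYu y y' _ ha hb ha' hb' g1 g2
  · intro S hS
    apply c2b S
    rintro (y | t)
    · have := hS (.inl y)
      obtain ⟨_, g2, g3⟩ := hP y.1 y.2
      simp only [Sum.elim_inl] at this
      rw [g2, g3] at this
      have hmem : (Sum.inl y : {y // y ≠ a ∧ y ≠ b} ⊕ Unit) ∈ Finset.univ.filter (fun i : {y // y ≠ a ∧ y ≠ b} ⊕ Unit => ∃ y, i = Sum.inl y) :=
        Finset.mem_filter.2 ⟨Finset.mem_univ _, y, rfl⟩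
      simp only [if_pos hmem, Sum.elim_inl]
      exact this
    · have := hS (.inr t)
      have hmem : (Sum.inr t : {y // y ≠ a ∧ y ≠ b} ⊕ Unit) ∉ Finset.univ.filter (fun i : {y // y ≠ a ∧ y ≠ b} ⊕ Unit => ∃ y, i = Sum.inl y) := by
        intro h
        obtain ⟨_, _, h⟩ := Finset.mem_filter.1 h
        cases h
      simp only [if_neg hmem]
      exact this

end PD

namespace PD

lemma mem_fm {V I : Type} (ℓ : ℕ) (s : Finset I) (q : I → ℕ → V) (e : Sym2 V) :
    e ∈ s.toList.flatMap (fun i => pe (wl ℓ (q i))) ↔ ∃ i ∈ s, ∃ k < ℓ, e = s(q i k, q i (k + 1)) := by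
  simp only [List.mem_flatMap, Finset.mem_toList, pe_wl, List.mem_map, List.mem_range]
  constructor
  · rintro ⟨i, hi, k, hk, rfl⟩; exact ⟨i, hi, k, hk, rfl⟩
  · rintro ⟨i, hi, k, hk, rfl⟩; exact ⟨i, hi, k, hk, rfl⟩

lemma nodup_fm {V I : Type} (ℓ : ℕ) (s : Finset I) (q : I → ℕ → V)
    (hi : ∀ i ∈ s, ∀ j ≤ ℓ, ∀ k ≤ ℓ, q i j = q i k → j = k)
    (hd : ∀ i ∈ s, ∀ j ∈ s, ∀ k < ℓ, ∀ k' < ℓ, s(q i k, q i (k + 1)) = s(q j k', q j (k' + 1)) → i = j) :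
    (s.toList.flatMap (fun i => pe (wl ℓ (q i)))).Nodup := by
  rw [List.nodup_flatMap]
  refine ⟨fun i hi' => pe_nodup _ (wl_nodup _ _ (hi i (Finset.mem_toList.1 hi'))), ?_⟩
  refine List.Pairwise.imp_of_mem ?_ (Finset.nodup_toList s)
  intro i j h1 h2 hne
  rw [Finset.mem_toList] at h1 h2
  intro e he he'
  simp only [pe_wl, List.mem_map, List.mem_range] at he he'
  obtain ⟨k, hk, rfl⟩ := he
  obtain ⟨k', hk', he'⟩ := he'
  exact hne (hd i h1 j h2 k hk k' hk' he'.symm)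

lemma sum_fm {V I : Type} (ℓ : ℕ) (s : Finset I) (q : I → ℕ → V) (hi : ∀ i ∈ s, ∀ k < ℓ, q i k ≠ q i (k + 1)) (v : V) :
    ((s.toList.flatMap (fun i => pe (wl ℓ (q i)))).map (inc2 v)).sum = ∑ i ∈ s, (ind (q i 0) v + ind (q i ℓ) v) := by
  have h1 : ∀ i ∈ s, ((pe (wl ℓ (q i))).map (inc2 v)).sum = ind (q i 0) v + ind (q i ℓ) v := by
    intro i his
    have hne : wl ℓ (q i) ≠ [] := by rw [wl_cons]; simp
    rw [pe_par v (wl ℓ (q i)) hne (wl_chain _ _ _ (hi i his))]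
    congr 2
    · simp [wl_cons]
    · have := wl_last ℓ (q i)
      rw [List.getLast?_eq_getLast_of_ne_nil hne] at this
      exact Option.some.inj this
  rw [← Finset.sum_congr rfl h1, ← Finset.sum_map_toList]
  rw [List.flatMap, List.map_flatten, List.sum_flatten, List.map_map, List.map_map]
  rfl

lemma sum_inc2 {V : Type} [Fintype V] (e : Sym2 V) (he : ¬ e.IsDiag) : ∑ v, inc2 v e = 0 := by
  induction e with
  | h x y =>
    have hne : x ≠ y := fun h => he (by simp [h])
    rw [Finset.sum_congr rfl (fun v _ => inc2_mk v x y hne), Finset.sum_add_distrib]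
    simp only [ind, Finset.sum_ite_eq, Finset.mem_univ, if_true]
    decide

end PD

namespace PD

lemma chain_of_pe {V : Type} (G : SimpleGraph V) : ∀ l : List V, (∀ e ∈ pe l, e ∈ G.edgeSet) → l.IsChain G.Adj
  | [], _ => by simp
  | [_], _ => by simp
  | x :: y :: l, h => by
    rw [pe] at h
    refine List.IsChain.cons_cons (h s(x, y) (by simp)) (chain_of_pe G (y :: l) (fun e he => h e (List.mem_cons_of_mem _ he)))

set_option maxHeartbeats 1600000 in
theorem asm {V I : Type} [Fintype V] [Fintype I] (G : SimpleGraph V) (ℓ : ℕ) (hℓ : 2 ≤ ℓ) (p : I → ℕ → V)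
    (pinj : ∀ i, ∀ j ≤ ℓ, ∀ k ≤ ℓ, p i j = p i k → j = k) (pR : ∀ i, ∀ k < ℓ, G.Adj (p i k) (p i (k + 1)))
    (pdis : ∀ i j, ∀ k < ℓ, ∀ k' < ℓ, s(p i k, p i (k + 1)) = s(p j k', p j (k' + 1)) → i = j)
    (f : V → V) (h : V → ℕ) (r : V) (hf : ∀ v, v ≠ r → G.Adj v (f v) ∧ h (f v) < h v)
    (pT : ∀ i, ∀ k < ℓ, ∀ v, v ≠ r → s(v, f v) ≠ s(p i k, p i (k + 1)))
    (a b : V) (P : V → ℕ → V) (Eg : Finset (Sym2 V)) (og : Sym2 V → V)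
    (hEgG : ∀ e ∈ Eg, e ∈ G.edgeSet) (hog : ∀ e ∈ Eg, og e ∈ e)
    (hEgP : ∀ i, ∀ k < ℓ, s(p i k, p i (k + 1)) ∉ Eg) (hEgT : ∀ v, v ≠ r → s(v, f v) ∉ Eg)
    (hP : ∀ y, y ≠ a → y ≠ b → gd ℓ (fun e => e ∈ Eg) (P y))
    (hPd : ∀ y y', y ≠ a → y ≠ b → y' ≠ a → y' ≠ b → ∀ k < ℓ, ∀ k' < ℓ,
      s(P y k, P y (k + 1)) = s(P y' k', P y' (k' + 1)) → y = y')
    (hCn : Cn (Sum.elim (fun y : {y // y ≠ a ∧ y ≠ b} => P y.1 0) (fun _ : Unit => a))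
      (Sum.elim (fun y : {y // y ≠ a ∧ y ≠ b} => P y.1 ℓ) (fun _ : Unit => b)))
    (own : V → ℕ) (hown : ∀ v, (Eg.filter (fun e => og e = v)).card ≤ own v)
    (D θ Bk : V → ℕ) (B : ℕ) (hθ : ∀ v, 0 < θ v)
    (hD : ∀ u v k, 1 ≤ k → k ≤ ℓ → (Finset.univ.filter (fun i => p i 0 = u ∧ p i k = v)).card ≤ D u)
    (hBk : ∀ w v j, 1 ≤ j → j < ℓ → (Finset.univ.filter (fun i => p i j = w ∧ p i ℓ = v)).card ≤ Bk v)
    (hload : ∀ x, ℓ * (3 * dg G x) ≤ B * θ x)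
    (h3 : ∀ v, (own v + ℓ) + 2 + ℓ * ((B + 1) * D v) < (Finset.univ.filter (fun i => p i 0 = v)).card)
    (hdeg : ∀ v, 4 * (ℓ * (ℓ * Bk v + ℓ * D v + θ v + 1)) + 2 + ((own v + ℓ) + 2) <
      (Finset.univ.filter (fun i => p i 0 = v)).card) :
    ∃ P : Finset (Σ u : V, Σ v : V, G.Walk u v),
        (∀ p ∈ P, p.2.2.IsPath ∧ 1 ≤ p.2.2.length ∧ p.2.2.length ≤ ℓ) ∧
        ((P.filter (fun p => p.2.2.length ≠ ℓ)).card ≤ 1) ∧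
        (∀ p ∈ P, ∀ q ∈ P, p ≠ q → ∀ e, e ∈ p.2.2.edges → e ∉ q.2.2.edges) ∧
        (∀ e : Sym2 V, e ∈ G.edgeSet ↔ ∃ p ∈ P, e ∈ p.2.2.edges) := by
  obtain ⟨EG, hEG⟩ : ∃ EG : Finset (Sym2 V), ∀ e, e ∈ EG ↔ e ∈ G.edgeSet :=
    ⟨Finset.univ.filter (fun e => e ∈ G.edgeSet), fun e => by simp⟩
  have hnd : ∀ e ∈ G.edgeSet, ¬ e.IsDiag := fun e he => SimpleGraph.not_isDiag_of_mem_edgeSet G he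
  obtain ⟨TT, hTT⟩ : ∃ TT : Sym2 V → Prop, ∀ e, TT e ↔ ∃ v, v ≠ r ∧ e = s(v, f v) := ⟨_, fun _ => Iff.rfl⟩
  obtain ⟨PP, hPP⟩ : ∃ PP : Sym2 V → Prop, ∀ e, PP e ↔ ∃ i, ∃ k < ℓ, e = s(p i k, p i (k + 1)) := ⟨_, fun _ => Iff.rfl⟩
  have TG : ∀ e, TT e → e ∈ G.edgeSet := by
    intro e he; obtain ⟨v, hv, rfl⟩ := (hTT e).1 he; exact (hf v hv).1
  have PG : ∀ e, PP e → e ∈ G.edgeSet := by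
    intro e he; obtain ⟨i, k, hk, rfl⟩ := (hPP e).1 he; exact pR i k hk
  have TP : ∀ e, TT e → ¬ PP e := by
    intro e he he'
    obtain ⟨v, hv, rfl⟩ := (hTT e).1 he
    obtain ⟨i, k, hk, h⟩ := (hPP _).1 he'
    exact pT i k hk v hv h
  have TEg : ∀ e, TT e → e ∉ Eg := by
    intro e he he'
    obtain ⟨v, hv, rfl⟩ := (hTT e).1 he
    exact hEgT v hv he'
  have PEg : ∀ e, PP e → e ∉ Eg := by
    intro e he he'
    obtain ⟨i, k, hk, rfl⟩ := (hPP e).1 he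
    exact hEgP i k hk he'
  obtain ⟨E0, hE0⟩ : ∃ E0 : Finset (Sym2 V), ∀ e, e ∈ E0 ↔ e ∈ G.edgeSet ∧ e ∉ Eg ∧ ¬ TT e ∧ ¬ PP e :=
    ⟨Finset.univ.filter (fun e => e ∈ G.edgeSet ∧ e ∉ Eg ∧ ¬ TT e ∧ ¬ PP e), fun e => by simp⟩
  obtain ⟨RR, o, hR1, hR2, hR3, hR4⟩ := pool ℓ (by omega) _ E0 le_rfl (fun e he => hnd e ((hE0 e).1 he).1)
  obtain ⟨SR, hSR⟩ : ∃ SR : List (Sym2 V), SR = RR.flatMap pe := ⟨_, rfl⟩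
  rw [← hSR] at hR2
  simp only [← hSR] at hR3 hR4
  have hSR0 : ∀ e ∈ SR, e ∈ E0 := by
    intro e he
    rw [hSR, List.mem_flatMap] at he
    obtain ⟨l, hl, he⟩ := he
    exact (hR1 l hl).2.2 e he
  -- parity targets
  have ht : ∑ v : V, (∑ e ∈ EG, inc2 v e + (SR.map (inc2 v)).sum) = 0 := by
    have : ∀ v : V, (SR.map (inc2 v)).sum = ∑ e ∈ SR.toFinset, inc2 v e := by
      intro v; rw [List.sum_toFinset _ hR2]
    simp only [this, Finset.sum_add_distrib]
    rw [Finset.sum_comm, Finset.sum_comm (s := Finset.univ)]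
    rw [Finset.sum_eq_zero, Finset.sum_eq_zero, add_zero]
    · intro e he
      exact sum_inc2 e (hnd e ((hE0 e).1 (hSR0 e (List.mem_toFinset.1 he))).1)
    · intro e he
      exact sum_inc2 e (hnd e ((hEG e).1 he))
  obtain ⟨c, hc⟩ := tj _ _ hCn _ ht
  obtain ⟨J, hJ⟩ : ∃ J : Finset {y // y ≠ a ∧ y ≠ b}, ∀ y, y ∈ J ↔ c (.inl y) = 1 :=
    ⟨Finset.univ.filter (fun y => c (.inl y) = 1), fun e => by simp⟩
  obtain ⟨SJ, hSJ⟩ : ∃ SJ : List (Sym2 V), SJ = J.toList.flatMap (fun y => pe (wl ℓ (P y.1))) := ⟨_, rfl⟩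
  have hSJm : ∀ e, e ∈ SJ → e ∈ Eg := by
    intro e he
    rw [hSJ, mem_fm ℓ J (fun y => P y.1)] at he
    obtain ⟨y, hy, k, hk, rfl⟩ := he
    exact (hP y.1 y.2.1 y.2.2).2 k hk
  have hSJn : SJ.Nodup := by
    rw [hSJ]
    apply nodup_fm ℓ J (fun y => P y.1)
    · intro y _; exact (hP y.1 y.2.1 y.2.2).1
    · intro y _ y' _ k hk k' hk' h
      exact Subtype.ext (hPd y.1 y'.1 y.2.1 y.2.2 y'.2.1 y'.2.2 k hk k' hk' h)
  have hSJs : ∀ v, (SJ.map (inc2 v)).sum = ∑ y ∈ J, (ind (P y.1 0) v + ind (P y.1 ℓ) v) := by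
    intro v
    rw [hSJ]
    apply sum_fm ℓ J (fun y => P y.1)
    intro y _ k hk h
    have := (hP y.1 y.2.1 y.2.2).1 k (by omega) (k + 1) (by omega) h
    omega
  obtain ⟨EY, hEY⟩ : ∃ EY : Finset (Sym2 V), ∀ e, e ∈ EY ↔ (e ∈ Eg ∧ e ∉ SJ) ∨ (e ∈ E0 ∧ e ∉ SR) :=
    ⟨Finset.univ.filter (fun e => (e ∈ Eg ∧ e ∉ SJ) ∨ (e ∈ E0 ∧ e ∉ SR)), fun e => by simp⟩
  have hoy : ∀ e : {e // e ∈ EY}, ∃ y x : V, e.1 = s(x, y) ∧ ((e.1 ∈ Eg ∧ og e.1 = y) ∨ (e.1 ∈ E0 ∧ e.1 ∉ SR ∧ o e.1 = y)) := by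
    intro e
    rcases (hEY e.1).1 e.2 with h | h
    · refine ⟨og e.1, Sym2.Mem.other (hog e.1 h.1), ?_, Or.inl ⟨h.1, rfl⟩⟩
      rw [Sym2.eq_swap, Sym2.other_spec]
    · refine ⟨o e.1, Sym2.Mem.other (hR3 e.1 h.1 h.2), ?_, Or.inr ⟨h.1, h.2, rfl⟩⟩
      rw [Sym2.eq_swap, Sym2.other_spec]
  choose oy ox hox hoy' using hoy
  have hYG : ∀ e : {e // e ∈ EY}, e.1 ∈ G.edgeSet := by
    intro e
    rcases (hEY e.1).1 e.2 with h | h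
    · exact hEgG _ h.1
    · exact ((hE0 _).1 h.1).1
  have hYA : ∀ e : {e // e ∈ EY}, G.Adj (ox e) (oy e) := by
    intro e
    have := hYG e
    rw [hox e] at this
    exact this
  have hYT : ∀ e ∈ EY, ¬ TT e ∧ ¬ PP e := by
    intro e he
    rcases (hEY e).1 he with h | h
    · exact ⟨fun h' => TEg e h' h.1, fun h' => PEg e h' h.1⟩
    · exact ((hE0 _).1 h.1).2.2
  have inj1 : ∀ e e' : {e // e ∈ EY}, s(ox e, oy e) = s(ox e', oy e') → e = e' := by
    intro e e' h
    rw [← hox, ← hox] at h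
    exact Subtype.ext h
  have inj2 := tree_edge_inj f h r (fun v hv => (hf v hv).2)
  have inj3 : ∀ (e : {e // e ∈ EY}) v, v ≠ r → s(ox e, oy e) ≠ s(v, f v) := by
    intro e v hv h
    rw [← hox] at h
    exact (hYT e.1 e.2).1 ((hTT _).2 ⟨v, hv, h⟩)
  have hoyc : ∀ v, (Finset.univ.filter (fun e => oy e = v)).card ≤ own v + ℓ := by
    intro v
    have hsub : (Finset.univ.filter (fun e => oy e = v)).image Subtype.val ⊆
        Eg.filter (fun e => og e = v) ∪ E0.filter (fun e => e ∉ SR ∧ o e = v) := by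
      intro e he
      obtain ⟨e, he2, rfl⟩ := Finset.mem_image.1 he
      have he := (Finset.mem_filter.1 he2).2
      rcases hoy' e with h | h
      · exact Finset.mem_union_left _ (Finset.mem_filter.2 ⟨h.1, h.2.trans he⟩)
      · exact Finset.mem_union_right _ (Finset.mem_filter.2 ⟨h.1, h.2.1, h.2.2.trans he⟩)
    rw [← Finset.card_image_of_injective _ Subtype.val_injective]
    exact ((Finset.card_le_card hsub).trans (Finset.card_union_le _ _)).trans (Nat.add_le_add (hown v) (hR4 v))
  have hoxc : ∀ x, (Finset.univ.filter (fun e => ox e = x)).card ≤ dg G x := by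
    intro x
    apply Finset.card_le_card_of_injOn oy
    · intro e he
      have he := (Finset.mem_filter.1 he).2
      exact Finset.mem_coe.2 (Finset.mem_filter.2 ⟨Finset.mem_univ _, he ▸ hYA e⟩)
    · intro e he e' he' h
      have he := (Finset.mem_filter.1 he).2
      have he' := (Finset.mem_filter.1 he').2
      exact inj1 e e' (by rw [he, he', h])
  have hfc : ∀ x, (Finset.univ.filter (fun v : {v // v ≠ r} => f v.1 = x)).card ≤ dg G x := by
    intro x
    apply Finset.card_le_card_of_injOn Subtype.val
    · intro e he
      have he := (Finset.mem_filter.1 he).2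
      exact Finset.mem_coe.2 (Finset.mem_filter.2 ⟨Finset.mem_univ _, he ▸ (hf e.1 e.2).1.symm⟩)
    · intro e he e' he' h
      exact Subtype.ext h
  -- the three end lists
  obtain ⟨LY, hLY⟩ : ∃ LY : List (Sym2 V), LY = (Finset.univ : Finset {e // e ∈ EY}).toList.map (fun e => s(ox e, oy e)) := ⟨_, rfl⟩
  obtain ⟨LT, hLT⟩ : ∃ LT : List (Sym2 V), LT = (Finset.univ : Finset {v // v ≠ r}).toList.map (fun z => s(z.1, f z.1)) := ⟨_, rfl⟩
  obtain ⟨LI, hLI⟩ : ∃ LI : List (Sym2 V), LI = (Finset.univ : Finset I).toList.flatMap (fun i => pe (wl ℓ (p i))) := ⟨_, rfl⟩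
  have mY : ∀ e, e ∈ LY ↔ e ∈ EY := by
    intro e
    rw [hLY, List.mem_map]
    constructor
    · rintro ⟨e, _, rfl⟩; rw [← hox]; exact e.2
    · intro he; exact ⟨⟨e, he⟩, by simp, (hox ⟨e, he⟩).symm⟩
  have mT : ∀ e, e ∈ LT ↔ TT e := by
    intro e
    rw [hLT, List.mem_map, hTT]
    constructor
    · rintro ⟨e, _, rfl⟩; exact ⟨e.1, e.2, rfl⟩
    · rintro ⟨v, hv, rfl⟩; exact ⟨⟨v, hv⟩, by simp, rfl⟩
  have mI : ∀ e, e ∈ LI ↔ PP e := by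
    intro e
    rw [hLI, mem_fm, hPP]
    constructor
    · rintro ⟨i, _, h⟩; exact ⟨i, h⟩
    · rintro ⟨i, h⟩; exact ⟨i, Finset.mem_univ _, h⟩
  have nY : LY.Nodup := by
    rw [hLY]
    exact (Finset.nodup_toList _).map (fun e e' h => inj1 e e' h)
  have nT : LT.Nodup := by
    rw [hLT]
    exact (Finset.nodup_toList _).map (fun e e' h => Subtype.ext (inj2 _ _ e.2 e'.2 h))
  have nI : LI.Nodup := by
    rw [hLI]
    exact nodup_fm ℓ _ p (fun i _ => pinj i) (fun i _ j _ => pdis i j)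
  have sY : ∀ v, (LY.map (inc2 v)).sum = ∑ e, (ind (ox e) v + ind (oy e) v) := by
    intro v
    rw [hLY, List.map_map, ← Finset.sum_map_toList]
    congr 1
    apply List.map_congr_left
    intro e _
    exact inc2_mk v _ _ (hYA e).ne
  have sT : ∀ v, (LT.map (inc2 v)).sum = ∑ z : {v // v ≠ r}, (ind z.1 v + ind (f z.1) v) := by
    intro v
    rw [hLT, List.map_map, ← Finset.sum_map_toList]
    congr 1
    apply List.map_congr_left
    intro e _
    exact inc2_mk v _ _ (hf e.1 e.2).1.ne
  have sI : ∀ v, (LI.map (inc2 v)).sum = ∑ i, (ind (p i 0) v + ind (p i ℓ) v) := by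
    intro v
    rw [hLI]
    exact sum_fm ℓ _ p (fun i _ k hk => (pR i k hk).ne) v
  have hWn : ((SR ++ SJ) ++ ((LY ++ LT) ++ LI)).Nodup := by
    rw [List.nodup_append', List.nodup_append', List.nodup_append', List.nodup_append']
    refine ⟨⟨hR2, hSJn, ?_⟩, ⟨⟨nY, nT, ?_⟩, nI, ?_⟩, ?_⟩
    · intro e h1 h2
      exact ((hE0 e).1 (hSR0 e h1)).2.1 (hSJm e h2)
    · intro e h1 h2
      exact (hYT e ((mY e).1 h1)).1 ((mT e).1 h2)
    · intro e h1 h2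
      rcases List.mem_append.1 h1 with h1 | h1
      · exact (hYT e ((mY e).1 h1)).2 ((mI e).1 h2)
      · exact TP e ((mT e).1 h1) ((mI e).1 h2)
    · intro e h1 h2
      simp only [List.mem_append, mY, mT, mI, hEY] at h1 h2
      rcases h1 with h1 | h1
      · obtain ⟨_, k1, k2, k3⟩ := (hE0 e).1 (hSR0 e h1)
        rcases h2 with ((h2 | h2) | h2) | h2
        · exact k1 h2.1
        · exact h2.2 h1
        · exact k2 h2
        · exact k3 h2
      · have k1 := hSJm e h1
        rcases h2 with ((h2 | h2) | h2) | h2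
        · exact h2.2 h1
        · exact ((hE0 e).1 h2.1).2.1 k1
        · exact TEg e h2 k1
        · exact PEg e h2 k1
  have hWm : ∀ e, e ∈ G.edgeSet ↔ e ∈ ((SR ++ SJ) ++ ((LY ++ LT) ++ LI)) := by
    intro e
    simp only [List.mem_append, mY, mT, mI, hEY]
    constructor
    · intro he
      by_cases k1 : TT e
      · exact Or.inr (Or.inl (Or.inr k1))
      by_cases k2 : PP e
      · exact Or.inr (Or.inr k2)
      by_cases k3 : e ∈ Eg
      · by_cases k4 : e ∈ SJ
        · exact Or.inl (Or.inr k4)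
        · exact Or.inr (Or.inl (Or.inl (Or.inl ⟨k3, k4⟩)))
      · by_cases k4 : e ∈ SR
        · exact Or.inl (Or.inl k4)
        · exact Or.inr (Or.inl (Or.inl (Or.inr ⟨(hE0 e).2 ⟨he, k3, k1, k2⟩, k4⟩)))
    · rintro ((h1 | h1) | ((h2 | h2) | h2) | h2)
      · exact ((hE0 e).1 (hSR0 e h1)).1
      · exact hEgG e (hSJm e h1)
      · exact hEgG e h2.1
      · exact ((hE0 e).1 h2.1).1
      · exact TG e h2
      · exact PG e h2
  have hpar : ∀ v, ∑ e ∈ EG, inc2 v e = (SR.map (inc2 v)).sum + (SJ.map (inc2 v)).sum +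
      ((LY.map (inc2 v)).sum + (LT.map (inc2 v)).sum + (LI.map (inc2 v)).sum) := by
    intro v
    have : EG = ((SR ++ SJ) ++ ((LY ++ LT) ++ LI)).toFinset := by
      ext e; rw [hEG, hWm, List.mem_toFinset]
    rw [this, List.sum_toFinset _ hWn]
    simp only [List.map_append, List.sum_append]
  have hc2 : ∀ v, (SJ.map (inc2 v)).sum + c (.inr ()) * (ind a v + ind b v) = ∑ e ∈ EG, inc2 v e + (SR.map (inc2 v)).sum := by
    intro v
    rw [← hc v, Fintype.sum_sum_type, hSJs]
    congr 1
    · rw [← Finset.sum_subset (Finset.subset_univ J)]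
      · apply Finset.sum_congr rfl
        intro y hy
        rw [(hJ y).1 hy, one_mul]; rfl
      · intro y _ hy
        have : c (.inl y) = 0 := by
          have : ∀ x : ZMod 2, x ≠ 1 → x = 0 := by decide
          exact this _ (fun h => hy ((hJ y).2 h))
        rw [this, zero_mul]
    · rw [Fintype.sum_unique]; rfl
  have c2 : ∀ x : ZMod 2, x + x = 0 := by decide
  obtain ⟨LL, hL1, hL2, hL3⟩ := end2 (Dm := {u : Unit // c (.inr ()) = 1}) G.Adj (fun a b h => h.symm) (fun a h => h.ne rfl) ℓ hℓ p pinj pR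
    ox oy hYA f h r hf inj1 (fun v w hv hw => inj2 v w hv hw) inj3 D θ Bk B hθ hD hBk
    (by
      intro x
      refine le_trans ?_ (hload x)
      apply Nat.mul_le_mul_left
      have := hoxc x
      have := hfc x
      omega)
    (by
      intro v
      have := hoyc v
      have := h3 v
      omega)
    (by
      intro v
      have := hoyc v
      have := hdeg v
      omega) a b
    (by
      intro v
      rw [← sY, ← sT, ← sI]
      have h1 := hpar v
      have h2 := hc2 v
      have h4 : ∑ _d : {u : Unit // c (.inr ()) = 1}, (ind a v + ind b v) = c (.inr ()) * (ind a v + ind b v) := by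
        have : ∀ x : ZMod 2, x = 1 ∨ x = 0 := by decide
        rcases this (c (.inr ())) with hh | hh
        · rw [hh, one_mul, Finset.sum_const, Finset.card_univ]
          have : Fintype.card {u : Unit // (1 : ZMod 2) = 1} = 1 := by simp
          rw [this, one_smul]
        · rw [hh, zero_mul, Finset.sum_const, Finset.card_univ]
          have : Fintype.card {u : Unit // (0 : ZMod 2) = 1} = 0 := by simp
          rw [this, zero_smul]
      rw [h4]
      rw [h1] at h2
      have e1 := c2 (SR.map (inc2 v)).sum
      have e2 := c2 (c (.inr ()) * (ind a v + ind b v))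
      linear_combination (-1 : ZMod 2) * h2 + e2 - e1)
  rw [← hLY, ← hLT, ← hLI] at hL3
  apply final_lists G ℓ ((RR ++ J.toList.map (fun y => wl ℓ (P y.1))) ++ LL)
  · intro l hl
    rcases List.mem_append.1 hl with hl | hl
    · rcases List.mem_append.1 hl with hl | hl
      · obtain ⟨g1, g2, g3⟩ := hR1 l hl
        refine ⟨g1, ?_, by omega, by omega⟩
        exact chain_of_pe G l (fun e he => ((hE0 e).1 (g3 e he)).1)
      · obtain ⟨y, hy, rfl⟩ := List.mem_map.1 hl
        obtain ⟨g1, g2⟩ := hP y.1 y.2.1 y.2.2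
        refine ⟨wl_nodup _ _ g1, wl_chain _ _ _ (fun k hk => hEgG _ (g2 k hk)), ?_, ?_⟩ <;> rw [wl_len] <;> omega
    · exact hL1 l hl
  · rw [List.filter_append, List.length_append]
    have : (RR ++ J.toList.map (fun y => wl ℓ (P y.1))).filter (fun l => l.length ≠ ℓ + 1) = [] := by
      rw [List.filter_eq_nil_iff]
      intro l hl
      have : l.length = ℓ + 1 := by
        rcases List.mem_append.1 hl with hl | hl
        · exact (hR1 l hl).2.1
        · obtain ⟨y, hy, rfl⟩ := List.mem_map.1 hl
          exact wl_len _ _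
      simp [this]
    rw [this]
    simpa using hL2
  · have e1 : ((RR ++ J.toList.map (fun y => wl ℓ (P y.1))) ++ LL).flatMap pe = (SR ++ SJ) ++ LL.flatMap pe := by
      rw [List.flatMap_append, List.flatMap_append, hSR, hSJ, List.flatMap_map]
    rw [e1]
    exact ((List.Perm.append_left _ hL3).nodup_iff).2 hWn
  · intro e
    have e1 : ((RR ++ J.toList.map (fun y => wl ℓ (P y.1))) ++ LL).flatMap pe = (SR ++ SJ) ++ LL.flatMap pe := by
      rw [List.flatMap_append, List.flatMap_append, hSR, hSJ, List.flatMap_map]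
    rw [e1, (List.Perm.append_left _ hL3).mem_iff]
    exact hWm e

end PD

namespace PD

lemma numer (ℓ A Q B M m g τ : ℕ) (hℓ : 2 ≤ ℓ) (hA : 1 ≤ A) (hQ : 1 ≤ Q) (hB : B = 96 * ℓ ^ 2 * Q * A)
    (hM1 : 8 * (ℓ * (B + 1)) ≤ M) (hM2 : 8 * A * (ℓ * ((B + 1) * (τ + 1)) + 9 * ℓ + 9) ≤ m) (hg : g ≤ Q * m) :
    (4 + m / (8 * A) + ℓ) + 2 + ℓ * ((B + 1) * (m / A / M + τ + 1)) < m / A ∧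
    4 * (ℓ * (ℓ * (m / (32 * ℓ ^ 2 * A)) + ℓ * (m / A / M + τ + 1) + (3 * ℓ * g / B + 1) + 1)) + 2
      + ((4 + m / (8 * A) + ℓ) + 2) < m / A := by
  obtain ⟨x, hx⟩ : ∃ x, x = m / (8 * A) := ⟨_, rfl⟩
  obtain ⟨z, hz⟩ : ∃ x, x = m / A / M := ⟨_, rfl⟩
  obtain ⟨w, hw⟩ : ∃ x, x = m / (32 * ℓ ^ 2 * A) := ⟨_, rfl⟩
  obtain ⟨y, hy⟩ : ∃ x, x = 3 * ℓ * g / B := ⟨_, rfl⟩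
  obtain ⟨n, hn⟩ : ∃ x, x = m / A := ⟨_, rfl⟩
  rw [← hx, ← hw, ← hy, ← hz, ← hn]
  have hl0 : 0 < ℓ := by omega
  have hA8 : 0 < 8 * A := by omega
  have hB0 : 0 < B := by rw [hB]; positivity
  have hM0 : 0 < M := lt_of_lt_of_le (by positivity) hM1
  have x1 : 8 * A * x ≤ m := by rw [hx]; exact Nat.mul_div_le _ _
  have n1 : A * n ≤ m := by rw [hn]; exact Nat.mul_div_le _ _
  have n2 : 8 * x ≤ n := by
    rw [hn, Nat.le_div_iff_mul_le (by omega)]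
    nlinarith
  have z1 : M * z ≤ n := by rw [hz, hn]; exact Nat.mul_div_le _ _
  have w1 : 32 * ℓ ^ 2 * A * w ≤ m := by rw [hw]; exact Nat.mul_div_le _ _
  have y1 : B * y ≤ 3 * ℓ * g := by rw [hy]; exact Nat.mul_div_le _ _
  have hxle : ∀ t, 8 * A * t ≤ m → t ≤ x := by
    intro t ht
    rw [hx, Nat.le_div_iff_mul_le hA8]
    linarith [mul_comm t (8 * A)]
  have w2 : 4 * ℓ ^ 2 * w ≤ x := by
    apply hxle; nlinarith
  have z2 : ℓ * (B + 1) * z ≤ x := by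
    apply hxle
    have : 8 * (ℓ * (B + 1)) * z ≤ M * z := Nat.mul_le_mul_right _ hM1
    have := Nat.mul_le_mul_left A (this.trans z1)
    nlinarith
  have y2 : 4 * ℓ * y ≤ x := by
    apply hxle
    have h1 : B * y ≤ 3 * ℓ * (Q * m) := y1.trans (Nat.mul_le_mul_left _ hg)
    rw [hB] at h1
    have h2 : (3 * ℓ * Q) * (8 * A * (4 * ℓ * y)) ≤ (3 * ℓ * Q) * m := by
      calc _ = 96 * ℓ ^ 2 * Q * A * y := by ring
        _ ≤ _ := h1
        _ = _ := by ring
    exact Nat.le_of_mul_le_mul_left h2 (by positivity)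
  have x2 : ℓ * ((B + 1) * (τ + 1)) + 9 * ℓ + 9 ≤ x := hxle _ hM2
  have hD : ℓ * ((B + 1) * (z + τ + 1)) = ℓ * (B + 1) * z + ℓ * ((B + 1) * (τ + 1)) := by ring
  have hB4 : 4 * ℓ ≤ B + 1 := by
    rw [hB]
    have : 1 ≤ ℓ * Q * A := Nat.succ_le_of_lt (by positivity)
    nlinarith
  have hD2 : 4 * (ℓ * (ℓ * (z + τ + 1))) ≤ ℓ * ((B + 1) * (z + τ + 1)) := by
    calc _ = ℓ * (4 * ℓ * (z + τ + 1)) := by ring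
      _ ≤ _ := Nat.mul_le_mul_left _ (Nat.mul_le_mul_right _ hB4)
  constructor
  · rw [hD]; omega
  · have : 4 * (ℓ * (ℓ * w + ℓ * (z + τ + 1) + (y + 1) + 1)) = 4 * ℓ ^ 2 * w + 4 * (ℓ * (ℓ * (z + τ + 1))) + 4 * ℓ * y + 8 * ℓ := by ring
    rw [this]
    rw [hD] at hD2
    omega

lemma nat_div_of_real (c m k : ℕ) (hk : 0 < k) (h : (c : ℝ) ≤ m / k) : c ≤ m / k := by
  rw [Nat.le_div_iff_mul_le hk]
  rw [le_div_iff₀ (by exact_mod_cast hk)] at h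
  exact_mod_cast h

end PD

namespace PD

lemma consts (ℓ Q A : ℕ) (hℓ : 2 ≤ ℓ) (hQ : 1 ≤ Q) (hA : 1 ≤ A) (T : ℕ) :
    ∃ (M : ℕ) (δ1 δ2 : ℝ), 1 ≤ M ∧ T ≤ M ∧ 192 ≤ δ1 * M ∧ (2 * Q : ℝ) ^ 2 * δ1 ≤ 1 ∧ 1 ≤ δ2 / 2 * M ∧
      (2 * Q : ℝ) ^ 2 * δ1 ≤ δ2 / 2 ∧ 4 * ((ℓ : ℝ) + 2) * (4 + ℓ + 6) ≤ δ2 * M ∧ (A : ℝ) * δ2 ≤ 1 ∧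
      2 * ((2 * Q : ℝ) ^ 2 * δ1) + ℓ * ((A : ℝ) * δ2) ≤ 1 / (8 * A) ∧
      4 * ((ℓ : ℝ) + 2) * ((0 : ℕ) + ℓ + 6) ≤ 1 / A * M ∧ 4 * ((ℓ : ℝ) + 2) * ((0 : ℕ) + ℓ + 6) ≤ 1 / (32 * ℓ ^ 2 * A ^ 2) * M := by
  have hℓr : (2 : ℝ) ≤ ℓ := by exact_mod_cast hℓ
  have hQr : (1 : ℝ) ≤ Q := by exact_mod_cast hQ
  have hAr : (1 : ℝ) ≤ A := by exact_mod_cast hA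
  obtain ⟨δ2, hδ2⟩ : ∃ δ2 : ℝ, δ2 = 1 / (32 * ℓ * A ^ 2) := ⟨_, rfl⟩
  obtain ⟨δ1, hδ1⟩ : ∃ δ1 : ℝ, δ1 = δ2 / 2 / (2 * Q) ^ 2 := ⟨_, rfl⟩
  have d2 : 0 < δ2 := by rw [hδ2]; positivity
  have d1 : 0 < δ1 := by rw [hδ1]; positivity
  have big : ∀ c δ : ℝ, 0 < δ → ∃ N : ℕ, ∀ M : ℕ, N ≤ M → c ≤ δ * M := by
    intro c δ hδ
    obtain ⟨N, hN⟩ := exists_nat_ge (c / δ)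
    refine ⟨N, fun M hM => ?_⟩
    rw [div_le_iff₀ hδ] at hN
    have : (N : ℝ) ≤ M := by exact_mod_cast hM
    nlinarith
  obtain ⟨N1, h1⟩ := big 192 δ1 d1
  obtain ⟨N2, h2⟩ := big 1 (δ2 / 2) (by positivity)
  obtain ⟨N3, h3⟩ := big (4 * ((ℓ : ℝ) + 2) * (4 + ℓ + 6)) δ2 d2
  obtain ⟨N4, h4⟩ := big (4 * ((ℓ : ℝ) + 2) * ((0 : ℕ) + ℓ + 6)) (1 / A) (by positivity)
  obtain ⟨N5, h5⟩ := big (4 * ((ℓ : ℝ) + 2) * ((0 : ℕ) + ℓ + 6)) (1 / (32 * ℓ ^ 2 * A ^ 2)) (by positivity)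
  have e1 : (2 * Q : ℝ) ^ 2 * δ1 = δ2 / 2 := by
    rw [hδ1]; field_simp
  have e2 : ℓ * ((A : ℝ) * δ2) = 1 / (32 * A) := by
    rw [hδ2]; field_simp
  have e3 : δ2 ≤ 1 / (32 * A) := by
    rw [hδ2]
    apply one_div_le_one_div_of_le (by positivity)
    nlinarith [mul_le_mul hℓr hAr (by norm_num) (by linarith)]
  have e4 : (1 : ℝ) / (32 * A) ≤ 1 / 32 := one_div_le_one_div_of_le (by norm_num) (by linarith)
  have e5 : (1 : ℝ) / (8 * A) = 4 * (1 / (32 * A)) := by field_simp; norm_num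
  have e6 : 0 < (A : ℝ) * δ2 := by positivity
  refine ⟨1 + T + N1 + N2 + N3 + N4 + N5, δ1, δ2, by omega, by omega, h1 _ (by omega), ?_, h2 _ (by omega), e1.le, h3 _ (by omega),
    ?_, ?_, h4 _ (by omega), h5 _ (by omega)⟩
  · rw [e1]; linarith
  · nlinarith
  · rw [e1, e2, e5]; linarith

lemma nat_own (c m k : ℕ) (hk : 0 < k) (h : (c : ℝ) ≤ 4 + 1 / k * m) : c ≤ 4 + m / k := by
  by_cases h4 : c ≤ 4
  · exact h4.trans (Nat.le_add_right _ _)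
  · obtain ⟨c', rfl⟩ : ∃ c', c = 4 + c' := ⟨c - 4, by omega⟩
    apply Nat.add_le_add_left
    apply nat_div_of_real _ _ _ hk
    push_cast at h
    have : (1 : ℝ) / k * m = m / k := by ring
    linarith

set_option maxHeartbeats 1600000 in
theorem core (ℓ : ℕ) (hℓ : 2 ≤ ℓ) :
    ∃ d : ℕ, ∀ (V : Type) [Fintype V] [Nontrivial V] (G : SimpleGraph V), EdgeConn G 24 → (∀ v : V, d ≤ dg G v) →
    ∃ P : Finset (Σ u : V, Σ v : V, G.Walk u v),
        (∀ p ∈ P, p.2.2.IsPath ∧ 1 ≤ p.2.2.length ∧ p.2.2.length ≤ ℓ) ∧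
        ((P.filter (fun p => p.2.2.length ≠ ℓ)).card ≤ 1) ∧
        (∀ p ∈ P, ∀ q ∈ P, p ≠ q → ∀ e, e ∈ p.2.2.edges → e ∉ q.2.2.edges) ∧
        (∀ e : Sym2 V, e ∈ G.edgeSet ↔ ∃ p ∈ P, e ∈ p.2.2.edges) := by
  obtain ⟨C, hC⟩ : ∃ C : ℕ, C = 8 * ((2 * ℓ + 2) * (ℓ + 10)) := ⟨_, rfl⟩
  have hC0 : 0 < C := by rw [hC]; positivity
  obtain ⟨Q, hQ⟩ : ∃ Q : ℕ, Q = 2 * C := ⟨_, rfl⟩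
  have hQ1 : 1 ≤ Q := by omega
  obtain ⟨A, hA⟩ : ∃ A : ℕ, A = (2 * Q) ^ ℓ := ⟨_, rfl⟩
  have hA1 : 1 ≤ A := by rw [hA]; exact Nat.one_le_pow _ _ (by omega)
  have hAr : ((2 * Q : ℝ)) ^ ℓ = (A : ℝ) := by rw [hA]; push_cast; rfl
  have hA0 : (A : ℝ) ≠ 0 := by have : (1 : ℝ) ≤ A := by exact_mod_cast hA1
                               linarith
  have hℓ0 : (ℓ : ℝ) ≠ 0 := by have : (2 : ℝ) ≤ ℓ := by exact_mod_cast hℓ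
                               linarith
  obtain ⟨B, hB⟩ : ∃ B : ℕ, B = 96 * ℓ ^ 2 * Q * A := ⟨_, rfl⟩
  obtain ⟨τ, hτ⟩ : ∃ τ : ℕ, τ = 4 * (ℓ + 2) * (ℓ + 6) := ⟨_, rfl⟩
  obtain ⟨M, δ1, δ2, hM1, hMT, k1, k2, k3, k4, k5, k6, k7, k8, k9⟩ := consts ℓ Q A hℓ hQ1 hA1
    (8 * (ℓ * (B + 1)) + 8 * A * (ℓ * ((B + 1) * (τ + 1)) + 9 * ℓ + 9))
  refine ⟨C * M + 40, ?_⟩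
  intro V _ _ G hG hd
  obtain ⟨m, hm⟩ : ∃ m : V → ℕ, ∀ v, m v = dg G v / C := ⟨_, fun _ => rfl⟩
  have hmM : ∀ v, M ≤ m v := by
    intro v
    rw [hm, Nat.le_div_iff_mul_le hC0, mul_comm]
    exact le_trans (by omega) (hd v)
  have hmd : ∀ v, C * m v ≤ dg G v := fun v => by rw [hm]; exact Nat.mul_div_le _ _
  have hdQ : ∀ v, dg G v ≤ Q * m v := by
    intro v
    have h1 : dg G v < C * (m v + 1) := by
      rw [hm, mul_comm]; exact Nat.lt_mul_of_div_lt (Nat.lt_succ_self _) hC0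
    have h2 : 1 ≤ m v := hM1.trans (hmM v)
    rw [hQ]
    nlinarith
  obtain ⟨v0⟩ : Nonempty V := inferInstance
  obtain ⟨col, Out, f, h, s1, s2, s3, s4, s5, s6⟩ := struct G hG (fun v => le_trans (by omega) (hd v)) (2 * ℓ + 2)
    (fun v => (ℓ + 10) * m v) (fun v => by
      refine le_trans (le_of_eq ?_) (hmd v)
      rw [hC]; ring) (fun _ => v0)
  have hin : ∀ k v, (Finset.univ.filter (fun x => v ∈ Out k x)).card ≤ Q * m v := by
    intro k v
    refine le_trans (Finset.card_le_card ?_) (hdQ v)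
    intro x hx
    exact Finset.mem_filter.2 ⟨Finset.mem_univ _, (s1 k x v (Finset.mem_filter.1 hx).2).1.symm⟩
  obtain ⟨a, b, P, Eg, og, hab, g1, g2, g3, g4, g5, g6⟩ := gadget col Out f h (fun _ => v0) s3 (fun i v hv => (s4 i v hv).2) s5 s6
    ℓ hℓ Q M hQ1 hM1 m hmM (fun k hk v => (s2 k (by omega) v).ge) (fun k _ => hin k) δ1 δ2 (1 / (8 * A)) k1 k2 k3 k4 k5
    (by rw [hAr]; exact k6) (by rw [hAr]; exact k7)
  -- the path system
  have hcn : ∀ v : V, (Finset.univ.filter (fun i : Σ v : V, Fin (m v / A) => i.1 = v)).card = m v / A := by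
    intro v
    rw [Finset.card_filter, Fintype.sum_sigma, Finset.sum_eq_single v]
    · simp
    · intro x _ hx; simp [hx]
    · intro hx; exact absurd (Finset.mem_univ _) hx
  obtain ⟨p, p0, p1, p2, -, p4, -, p6, p7⟩ := walk_lemma (I := Σ v : V, Fin (m v / A)) ℓ 0 Q M hQ1 hM1 (fun k => Out (2 + ℓ + k)) m hmM
    (fun k hk v => by
      rw [s2 _ (by omega)]
      exact Nat.mul_le_mul_right _ (by omega))
    (fun k _ => hin _) (fun i => i.1) (fun _ => ∅) (fun _ => by simp) (1 / A) (1 / (32 * ℓ ^ 2 * A ^ 2)) _ rfl k8 k9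
    (by rw [hAr]; exact (mul_one_div_cancel hA0).le)
    (fun v => by
      rw [hcn]
      refine Nat.cast_div_le.trans (le_of_eq ?_)
      ring)
  have hpc : ∀ v, (Finset.univ.filter (fun i => p i 0 = v)).card = m v / A := by
    intro v
    refine Eq.trans ?_ (hcn v)
    congr 1
    ext i
    simp [p0]
  refine asm G ℓ hℓ p p4 (fun i k hk => (s1 _ _ _ (p1 k hk i)).1) ?_ (f 4) (h 4) v0
    (fun v hv => ⟨(s4 4 v hv).1, (s4 4 v hv).2.2⟩) (fun i k hk v hv => s5 4 _ v _ _ hv (p1 k hk i)) a b P Eg og ?_ g1 ?_ ?_ g4 g5 g6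
    (fun v => 4 + m v / (8 * A)) ?_ (fun v => m v / A / M + τ + 1) (fun v => 3 * ℓ * dg G v / B + 1) (fun v => m v / (32 * ℓ ^ 2 * A)) B
    (fun v => Nat.succ_pos _) ?_ ?_ ?_ ?_ ?_
  · intro i j k hk k' hk' he
    obtain ⟨e1, e2⟩ := s3 _ _ _ _ _ _ (p1 k hk i) (p1 k' hk' j) he
    have e1 : k = k' := by omega
    subst e1
    rw [e2] at he
    exact p2 k hk i j e2 (Sym2.congr_right.1 he)
  · intro e he
    rcases g2 e he with ⟨i, _, v, hv, rfl⟩ | ⟨k, _, v, w, hw, rfl⟩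
    · exact (s4 i v hv).1
    · exact (s1 _ _ _ hw).1
  · intro i k hk he
    rcases g2 _ he with ⟨i', _, v, hv, h'⟩ | ⟨k', hk', v, w, hw, h'⟩
    · exact s5 i' _ v _ _ hv (p1 k hk i) h'.symm
    · have := (s3 _ _ _ _ _ _ (p1 k hk i) hw h').1
      omega
  · intro v hv he
    rcases g2 _ he with ⟨i', hi, w, hw, h'⟩ | ⟨k', hk', w, x, hx, h'⟩
    · exact s6 i' 4 w v hi hw hv h'.symm
    · exact s5 4 _ v _ _ hv hx h'
  · intro v
    apply nat_own _ _ _ (by omega)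
    have := g3 v
    push_cast
    exact this
  · intro u v k hk1 hk
    have h1 := p7 k hk hk1 u v
    rw [hcn] at h1
    have h2 : ((Finset.univ.filter (fun i => p i 0 = u ∧ p i k = v)).card : ℝ) ≤ ((m u / A : ℕ) : ℝ) / M + τ := by
      refine le_trans (le_of_eq ?_) (h1.trans (le_of_eq ?_))
      · congr 2
        ext i
        simp [p0]
      · rw [hτ]; push_cast; ring
    have h3 : ((m u / A : ℕ) : ℝ) / M < ((m u / A / M : ℕ) : ℝ) + 1 := by
      rw [div_lt_iff₀ (by exact_mod_cast hM1)]
      have : m u / A < (m u / A / M + 1) * M := Nat.lt_mul_of_div_lt (Nat.lt_succ_self _) hM1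
      exact_mod_cast this
    have h4 : ((Finset.univ.filter (fun i => p i 0 = u ∧ p i k = v)).card : ℝ) < ((m u / A / M + τ + 1 : ℕ) : ℝ) := by
      push_cast at h2 h3 ⊢
      linarith
    exact (Nat.cast_lt.1 h4).le
  · intro w v j hj1 hj
    apply nat_div_of_real _ _ _ (by positivity)
    refine (p6 ℓ le_rfl j hj w v).trans (le_of_eq ?_)
    rw [hAr]; push_cast
    field_simp
  · intro x
    have : 3 * ℓ * dg G x < (3 * ℓ * dg G x / B + 1) * B := Nat.lt_mul_of_div_lt (Nat.lt_succ_self _) (by rw [hB]; positivity)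
    nlinarith
  · intro v
    rw [hpc]
    exact (numer ℓ A Q B M (m v) (dg G v) τ hℓ hA1 hQ1 hB (by omega) ((by omega : _ ≤ M).trans (hmM v)) (hdQ v)).1
  · intro v
    rw [hpc]
    exact (numer ℓ A Q B M (m v) (dg G v) τ hℓ hA1 hQ1 hB (by omega) ((by omega : _ ≤ M).trans (hmM v)) (hdQ v)).2

end PD

/-- For every `ℓ ≥ 2` there exists `d_ℓ` such that every 24-edge-connected
graph with minimum degree at least `d_ℓ` has a decomposition of its edge set
into paths of length exactly `ℓ` and at most one additional path of length at
most `ℓ`. -/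
theorem path_decomposition_24_edge_connected (ℓ : ℕ) (hℓ : 2 ≤ ℓ) :
    ∃ d : ℕ, ∀ (V : Type) [Fintype V] [DecidableEq V]
      (G : SimpleGraph V) [DecidableRel G.Adj],
      EdgeConn G 24 →
      (∀ v : V, d ≤ G.degree v) →
      ∃ P : Finset (PathOn G),
        (∀ p ∈ P, p.2.2.IsPath ∧ 1 ≤ p.2.2.length ∧ p.2.2.length ≤ ℓ) ∧
        ((P.filter (fun p => p.2.2.length ≠ ℓ)).card ≤ 1) ∧
        (∀ p ∈ P, ∀ q ∈ P, p ≠ q → ∀ e, e ∈ p.2.2.edges → e ∉ q.2.2.edges) ∧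
        (∀ e : Sym2 V, e ∈ G.edgeSet ↔ ∃ p ∈ P, e ∈ p.2.2.edges) := by
  obtain ⟨d, hd⟩ := PD.core ℓ hℓ
  refine ⟨d + 1, ?_⟩
  intro V _ _ G _ hG hdeg
  by_cases hV : Nonempty V
  swap
  · refine ⟨∅, by simp, by simp, by simp, ?_⟩
    intro e
    induction e with
    | h x y => exact absurd ⟨x⟩ hV
  obtain ⟨v0⟩ := hV
  have hdg : ∀ v, G.degree v = PD.dg G v := by
    intro v
    unfold PD.dg
    rw [← SimpleGraph.card_neighborFinset_eq_degree]
    congr 1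
    ext w
    simp
  have : Nontrivial V := by
    have h0 : 0 < G.degree v0 := lt_of_lt_of_le (Nat.succ_pos _) (hdeg v0)
    obtain ⟨w, hw⟩ := (G.degree_pos_iff_exists_adj v0).1 h0
    exact ⟨v0, w, hw.ne⟩
  obtain ⟨P, h1, h2, h3, h4⟩ := hd V G hG (fun v => by rw [← hdg]; exact le_trans (Nat.le_succ _) (hdeg v))
  refine ⟨P, h1, ?_, h3, h4⟩
  convert h2
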